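/- arXiv:2402.18693 — 2 statements merged into one kernel-verified Lean document; each statement's English description precedes it below -/
import Mathlib

section
/- Let k be a field of characteristic zero, Y = (y_{ij}) an m×m generic symmetric matrix of indeterminates (so y_{ij} = y_{ji}, with the y_{ij} for i ≤ j independent indeterminates), R = k[y_{ij} : 1 ≤ i ≤ j ≤ m], and for 1 ≤ t ≤ m let I_t(Y) be the ideal generated by all t×t minors of Y. Then for every positive integer k and every integer 0 ≤ l ≤ m−t, α(I_t(Y)^{(k(m−t+1)−l)}) = km − l; moreover, the Waldschmidt constant of I_t(Y) equals m/(m−t+1), i.e., α(I_t(Y)^{(s)})/s → m/(m−t+1) as s → ∞. -/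
open MvPolynomial Filter

/-- The `s`-th symbolic power of an ideal: the intersection over the associated primes `p` of
`R ⧸ I` of the contractions of `I^s` localized at `p`. -/
noncomputable def symbolicPower {R : Type*} [CommRing R] (I : Ideal R) (s : ℕ) : Ideal R :=
  ⨅ p : {p : Ideal R // p.IsPrime ∧ ∃ x : R ⧸ I, p = (Submodule.span R {x}).annihilator},
    letI : p.1.IsPrime := p.2.1
    Ideal.comap (algebraMap R (Localization.AtPrime p.1))
      (Ideal.map (algebraMap R (Localization.AtPrime p.1)) (I ^ s))

/-- The least degree of a nonzero homogeneous element of an ideal of a polynomial ring. -/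
noncomputable def alphaDeg {σ K : Type*} [CommSemiring K] (I : Ideal (MvPolynomial σ K)) : ℕ :=
  sInf {d | ∃ f ∈ I, f ≠ 0 ∧ MvPolynomial.IsHomogeneous f d}

/-- The ideal `I_t(Y)` generated by the `t × t` minors of the generic `m × m` symmetric matrix
`Y = (y_{ij})`, realized over the polynomial ring on the unordered pairs `Sym2 (Fin m)`
(so that `y_{ij} = y_{ji}` and the `y_{ij}` with `i ≤ j` are independent indeterminates). -/
noncomputable def symMinors (K : Type*) [Field K] (m t : ℕ) :
    Ideal (MvPolynomial (Sym2 (Fin m)) K) :=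
  Ideal.span {d | ∃ r c : Fin t → Fin m,
    Function.Injective r ∧ Function.Injective c ∧
    d = Matrix.det (Matrix.of fun i j =>
      (MvPolynomial.X (Sym2.mk (r i) (c j)) : MvPolynomial (Sym2 (Fin m)) K))}

namespace SymDet

open Finset

variable {K : Type*} [Field K] {m : ℕ}

abbrev PR (K : Type*) [Field K] (m : ℕ) := MvPolynomial (Sym2 (Fin m)) K

/-- the raising operator `y_{jb} ↦ y_{ib}` -/
noncomputable def EE (i j : Fin m) : Derivation K (PR K m) (PR K m) :=
  ∑ b : Fin m, (if b = j then (2 : K) else 1) •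
    ((X s(i, b) : PR K m) • (pderiv s(j, b) : Derivation K (PR K m) (PR K m)))

lemma EE_apply (i j : Fin m) (f : PR K m) :
    EE i j f = ∑ b : Fin m, (if b = j then (2 : K) else 1) • (X s(i, b) * pderiv s(j, b) f) := by
  simp only [EE]
  rw [← Derivation.coeFnAddMonoidHom_apply, map_sum, Finset.sum_apply]
  refine Finset.sum_congr rfl fun b _ => ?_
  rw [Derivation.coeFnAddMonoidHom_apply, Derivation.smul_apply, Derivation.smul_apply, smul_eq_mul]

lemma EE_X (i j p q : Fin m) : EE i j (X s(p, q) : PR K m) =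
    (if p = j then X s(i, q) else 0) + (if q = j then X s(p, i) else 0) := by
  classical
  rw [EE_apply]
  simp only [pderiv_X, Pi.single_apply, Sym2.eq_iff]
  by_cases hp : p = j
  · subst hp
    by_cases hq : q = p
    · subst hq
      rw [Finset.sum_eq_single q]
      · simp [Sym2.eq_swap (a := q) (b := i), ← two_mul, ofNat_smul_eq_nsmul]
      · intro b _ hb
        simp [hb, hb.symm]
      · simp
    · rw [Finset.sum_eq_single q]
      · simp [hq]
      · intro b _ hb
        simp [hb.symm, hq]
      · simp
  · by_cases hq : q = j
    · subst hq
      rw [Finset.sum_eq_single p]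
      · simp [hp, Sym2.eq_swap (a := p) (b := i)]
      · intro b _ hb
        simp [hb.symm, hp]
      · simp
    · apply (Finset.sum_eq_zero _).trans
      · simp [hp, hq]
      · intro b _
        simp [hp, hq]

/-! ### the bilinear form -/

noncomputable def om (e : Sym2 (Fin m)) : ℚ := open Classical in if e.IsDiag then 1 else 1 / 2

lemma om_pos (e : Sym2 (Fin m)) : 0 < om e := by
  unfold om; split_ifs <;> norm_num

noncomputable def ww (a : Sym2 (Fin m) →₀ ℕ) : ℚ := ∏ e, ((a e).factorial : ℚ) * om e ^ a e

lemma ww_pos (a : Sym2 (Fin m) →₀ ℕ) : 0 < ww a := by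
  unfold ww
  exact Finset.prod_pos fun e _ => mul_pos (by positivity) (pow_pos (om_pos e) _)

lemma ww_add_single (a : Sym2 (Fin m) →₀ ℕ) (e : Sym2 (Fin m)) :
    ww (a + Finsupp.single e 1) = ww a * (a e + 1) * om e := by
  classical
  unfold ww
  rw [← Finset.mul_prod_erase _ _ (Finset.mem_univ e), ← Finset.mul_prod_erase (a := e) (s := univ)
    (f := fun e => ((a e).factorial : ℚ) * om e ^ a e) (by simp)]
  have : ∏ x ∈ univ.erase e, (((a + Finsupp.single e 1 : Sym2 (Fin m) →₀ ℕ) x).factorial : ℚ) *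
      om x ^ (a + Finsupp.single e 1 : Sym2 (Fin m) →₀ ℕ) x = ∏ x ∈ univ.erase e, ((a x).factorial : ℚ) * om x ^ a x := by
    refine Finset.prod_congr rfl fun x hx => ?_
    have : x ≠ e := (Finset.mem_erase.1 hx).1
    simp [this.symm]
  rw [this]
  simp [Nat.factorial_succ, pow_succ]
  ring

/-- The Fischer form. -/
noncomputable def BB : PR K m →ₗ[K] PR K m →ₗ[K] K :=
  (basisMonomials (Sym2 (Fin m)) K).constr K (fun a => (ww a : K) • lcoeff K a)

lemma BB_monomial (a : Sym2 (Fin m) →₀ ℕ) (c : K) (g : PR K m) :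
    BB (monomial a c) g = c * ww a * coeff a g := by
  have h1 : (monomial a c : PR K m) = c • basisMonomials (Sym2 (Fin m)) K a := by
    simp [smul_monomial]
  rw [h1, map_smul, BB, Module.Basis.constr_basis]
  simp [mul_assoc]

lemma BB_monomial_monomial (a b : Sym2 (Fin m) →₀ ℕ) (c d : K) :
    BB (monomial a c : PR K m) (monomial b d) = if a = b then c * d * ww a else 0 := by
  classical
  rw [BB_monomial, coeff_monomial]
  by_cases h : a = b
  · subst h; simp; ring
  · simp [h, Ne.symm h]

lemma bilin_ext {B B' : PR K m →ₗ[K] PR K m →ₗ[K] K}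
    (h : ∀ a b, B (monomial a 1) (monomial b 1) = B' (monomial a 1) (monomial b 1)) : B = B' := by
  apply (basisMonomials (Sym2 (Fin m)) K).ext
  intro a
  apply (basisMonomials (Sym2 (Fin m)) K).ext
  intro b
  simpa using h a b

lemma BB_symm (f g : PR K m) : BB f g = BB g f := by
  have : (BB : PR K m →ₗ[K] PR K m →ₗ[K] K) = BB.flip := by
    apply bilin_ext
    intro a b
    rw [LinearMap.flip_apply, BB_monomial_monomial, BB_monomial_monomial]
    by_cases h : a = b
    · subst h; simp
    · simp [h, Ne.symm h]
  conv_lhs => rw [this]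
  rfl

lemma BB_X_mul [CharZero K] (e : Sym2 (Fin m)) (f g : PR K m) :
    BB (X e * f) g = (om e : K) * BB f (pderiv e g) := by
  classical
  have : BB.comp (LinearMap.mulLeft K (X e : PR K m)) =
      (om e : K) • BB.compl₂ (pderiv e : Derivation K (PR K m) (PR K m)).toLinearMap := by
    apply bilin_ext
    intro a b
    have h1 : (X e * monomial a 1 : PR K m) = monomial (a + Finsupp.single e 1) 1 := by
      rw [X, monomial_mul, add_comm, one_mul]
    simp only [LinearMap.comp_apply, LinearMap.mulLeft_apply, LinearMap.smul_apply,
      LinearMap.compl₂_apply, smul_eq_mul, Derivation.coeFn_coe]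
    rw [h1, BB_monomial_monomial, pderiv_monomial, BB_monomial_monomial]
    by_cases hb : a + Finsupp.single e 1 = b
    · subst hb
      rw [if_pos rfl, if_pos (by simp), ww_add_single]
      push_cast
      simp
      ring
    · rw [if_neg hb]
      by_cases hbe : b e = 0
      · simp [hbe]
      · rw [if_neg]
        · simp
        · rintro rfl
          apply hb
          ext x
          simp [Finsupp.single_apply]
          split_ifs with hx
          · subst hx; omega
          · simp
  have := congrArg (fun B => B f g) this
  simpa using this

lemma BB_EE [CharZero K] (i j : Fin m) (f g : PR K m) : BB (EE i j f) g = BB f (EE j i g) := by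
  simp only [EE_apply, map_sum, LinearMap.sum_apply, map_smul, LinearMap.smul_apply]
  refine Finset.sum_congr rfl fun b _ => ?_
  rw [BB_X_mul, BB_symm f, BB_X_mul, BB_symm (pderiv _ f)]
  have : ∀ x y : Fin m, (om s(x, y) : K) = if y = x then 1 else 1/2 := by
    intro x y
    unfold om
    by_cases h : x = y
    · simp [h]
    · simp [h, Ne.symm h]
  rw [this, this]
  split_ifs <;> simp

end SymDet
namespace SymDet

open Finset

variable {K : Type*} [Field K] {m : ℕ}

/-- a (possibly degenerate) minor -/
noncomputable def mn {t : ℕ} (r c : Fin t → Fin m) : PR K m :=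
  Matrix.det (Matrix.of fun i j => (X s(r i, c j) : PR K m))

lemma mn_mem {t : ℕ} (r c : Fin t → Fin m) : (mn r c : PR K m) ∈ symMinors K m t := by
  by_cases hr : Function.Injective r
  · by_cases hc : Function.Injective c
    · exact Ideal.subset_span ⟨r, c, hr, hc, rfl⟩
    · have : (mn r c : PR K m) = 0 := by
        simp only [Function.Injective, not_forall] at hc
        obtain ⟨a, b, h1, h2⟩ := hc
        exact Matrix.det_zero_of_column_eq h2 (fun k => by simp [h1])
      rw [this]; exact zero_mem _
  · have : (mn r c : PR K m) = 0 := by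
      simp only [Function.Injective, not_forall] at hr
      obtain ⟨a, b, h1, h2⟩ := hr
      exact Matrix.det_zero_of_row_eq h2 (by ext k; simp [h1])
    rw [this]; exact zero_mem _

lemma der_prod {A : Type*} [CommRing A] [Algebra K A] (D : Derivation K A A) {ι : Type*}
    [DecidableEq ι] (s : Finset ι) (g : ι → A) :
    D (∏ i ∈ s, g i) = ∑ a ∈ s, D (g a) * ∏ i ∈ s.erase a, g i := by
  induction s using Finset.induction_on with
  | empty => simp
  | insert x s hx ih =>
    rw [Finset.prod_insert hx, Derivation.leibniz, ih, Finset.sum_insert hx,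
      Finset.erase_insert hx, smul_eq_mul, smul_eq_mul, Finset.mul_sum, add_comm, mul_comm]
    congr 1
    refine Finset.sum_congr rfl fun a ha => ?_
    have hax : a ≠ x := fun h => hx (h ▸ ha)
    rw [Finset.erase_insert_of_ne hax.symm, Finset.prod_insert (fun h => hx (Finset.mem_of_mem_erase h))]
    ring

lemma der_det {A : Type*} [CommRing A] [Algebra K A] (D : Derivation K A A) {t : ℕ}
    (M N1 N2 : Matrix (Fin t) (Fin t) A) (h : ∀ p q, D (M p q) = N1 p q + N2 p q) :
    D M.det = ∑ p, (M.updateRow p (N1 p)).det + ∑ q, (M.updateCol q (fun p => N2 p q)).det := by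
  have hd : ∀ (σ : Equiv.Perm (Fin t)) (x : A), D (Equiv.Perm.sign σ • x) =
      Equiv.Perm.sign σ • D x := by
    intro σ x
    rcases Int.units_eq_one_or (Equiv.Perm.sign σ) with h | h <;> simp [h]
  rw [Matrix.det_apply, map_sum]
  simp only [hd, der_prod, h, add_mul, Finset.sum_add_distrib, smul_add]
  congr 1
  · simp only [Matrix.det_apply]
    rw [Finset.sum_comm]
    refine Finset.sum_congr rfl fun σ _ => ?_
    rw [← Finset.smul_sum]
    congr 1
    rw [← Equiv.sum_comp σ (fun p => ∏ i, M.updateRow p (N1 p) (σ i) i)]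
    refine Finset.sum_congr rfl fun a _ => ?_
    rw [← Finset.mul_prod_erase _ _ (Finset.mem_univ a)]
    congr 1
    · simp
    · refine Finset.prod_congr rfl fun i hi => ?_
      rw [Matrix.updateRow_ne]
      exact fun h => (Finset.mem_erase.1 hi).1 (σ.injective h)
  · simp only [Matrix.det_apply]
    rw [Finset.sum_comm]
    refine Finset.sum_congr rfl fun σ _ => ?_
    rw [← Finset.smul_sum]
    congr 1
    refine Finset.sum_congr rfl fun a _ => ?_
    rw [← Finset.mul_prod_erase _ _ (Finset.mem_univ a)]
    congr 1
    · simp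
    · refine Finset.prod_congr rfl fun i hi => ?_
      rw [Matrix.updateCol_ne]
      exact (Finset.mem_erase.1 hi).1

lemma EE_mn (i j : Fin m) {t : ℕ} (r c : Fin t → Fin m) :
    EE i j (mn r c : PR K m) = ∑ p, (if r p = j then mn (Function.update r p i) c else 0) +
      ∑ q, (if c q = j then mn r (Function.update c q i) else 0) := by
  unfold mn
  rw [der_det (EE i j) _ (Matrix.of fun p q => if r p = j then X s(i, c q) else 0)
    (Matrix.of fun p q => if c q = j then X s(r p, i) else 0)]
  · congr 1
    · refine Finset.sum_congr rfl fun p _ => ?_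
      split_ifs with hp
      · congr 1
        ext a b
        by_cases ha : a = p
        · subst ha; simp [hp]
        · simp [Matrix.updateRow_ne ha, Function.update_of_ne ha]
      · apply Matrix.det_eq_zero_of_row_eq_zero p
        intro b
        simp [hp]
    · refine Finset.sum_congr rfl fun q _ => ?_
      split_ifs with hq
      · congr 1
        ext a b
        by_cases hb : b = q
        · subst hb; simp [hq]
        · simp [Matrix.updateCol_ne hb, Function.update_of_ne hb]
      · apply Matrix.det_eq_zero_of_column_eq_zero q
        intro b
        simp [hq]
  · intro p q
    simp [EE_X]

lemma EE_mem_symMinors (i j : Fin m) {t : ℕ} {f : PR K m} (hf : f ∈ symMinors K m t) :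
    EE i j f ∈ symMinors K m t := by
  unfold symMinors at hf
  induction hf using Submodule.span_induction with
  | mem x hx =>
    obtain ⟨r, c, _, _, rfl⟩ := hx
    have := EE_mn (K := K) i j r c
    unfold mn at this
    rw [this]
    refine add_mem (sum_mem fun p _ => ?_) (sum_mem fun p _ => ?_)
    · split_ifs
      · exact mn_mem _ _
      · exact zero_mem _
    · split_ifs
      · exact mn_mem _ _
      · exact zero_mem _
  | zero => simp
  | add x y _ _ hx hy => rw [map_add]; exact add_mem hx hy
  | smul a x hx0 hx =>
    rw [smul_eq_mul, Derivation.leibniz]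
    refine add_mem (Ideal.mul_mem_left _ _ hx) ?_
    rw [smul_eq_mul]
    exact Ideal.mul_mem_right _ _ hx0

lemma symMinors_anti {t t' : ℕ} (h : t ≤ t') : symMinors K m t' ≤ symMinors K m t := by
  induction t', h using Nat.le_induction with
  | base => exact le_rfl
  | succ n _ ih =>
    refine le_trans ?_ ih
    refine Ideal.span_le.2 ?_
    rintro _ ⟨r, c, _, _, rfl⟩
    rw [Matrix.det_succ_row_zero]
    refine sum_mem fun j _ => Ideal.mul_mem_left _ _ ?_
    exact mn_mem (fun a => r a.succ) (fun b => c (j.succAbove b))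

/-! ### The parametrization -/

noncomputable def PsiX (K : Type*) [Field K] (m : ℕ) (ι : Type*) [Fintype ι] (e : Sym2 (Fin m)) :
    MvPolynomial ((Fin m × ι) ⊕ ι) K :=
  Sym2.lift ⟨fun i j => ∑ k : ι, X (Sum.inl (i, k)) * X (Sum.inl (j, k)) * X (Sum.inr k),
    fun i j => by simp only [mul_comm (X (Sum.inl (i, _)))]⟩ e

lemma PsiX_mk (ι : Type*) [Fintype ι] (i j : Fin m) : PsiX K m ι s(i, j) =
    ∑ k : ι, X (Sum.inl (i, k)) * X (Sum.inl (j, k)) * X (Sum.inr k) := rfl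

noncomputable def Psi (K : Type*) [Field K] (m : ℕ) (ι : Type*) [Fintype ι] :
    PR K m →ₐ[K] MvPolynomial ((Fin m × ι) ⊕ ι) K := aeval (PsiX K m ι)

lemma Psi_X (ι : Type*) [Fintype ι] (i j : Fin m) : Psi K m ι (X s(i, j)) =
    ∑ k : ι, X (Sum.inl (i, k)) * X (Sum.inl (j, k)) * X (Sum.inr k) := by
  rw [Psi, aeval_X, PsiX_mk]

/-- the lifted raising operator -/
noncomputable def EEx (ι : Type*) (i j : Fin m) :
    Derivation K (MvPolynomial ((Fin m × ι) ⊕ ι) K) (MvPolynomial ((Fin m × ι) ⊕ ι) K) :=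
  mkDerivation K (Sum.elim (fun p => if p.1 = j then X (Sum.inl (i, p.2)) else 0) (fun _ => 0))

lemma Psi_EE (ι : Type*) [Fintype ι] (i j : Fin m) (f : PR K m) :
    Psi K m ι (EE i j f) = EEx ι i j (Psi K m ι f) := by
  induction f using MvPolynomial.induction_on with
  | C a =>
    rw [derivation_C, map_zero, ← MvPolynomial.algebraMap_eq, AlgHom.commutes,
      Derivation.map_algebraMap]
  | add p q hp hq => simp only [map_add, hp, hq]
  | mul_X p e hp =>
    rw [Derivation.leibniz, map_add, smul_eq_mul, smul_eq_mul, map_mul, map_mul, hp, map_mul,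
      Derivation.leibniz, smul_eq_mul, smul_eq_mul]
    congr 2
    induction e using Sym2.inductionOn with
    | _ a b =>
    rw [EE_X, Psi_X, map_sum, map_add]
    have : ∀ (x : Fin m) (k : ι), EEx (K := K) ι i j (X (Sum.inl (x, k))) =
      if x = j then X (Sum.inl (i, k)) else 0 := by
      intro x k
      simp [EEx, mkDerivation_X]
    have h2 : ∀ (k : ι), EEx (K := K) ι i j (X (Sum.inr k)) = 0 := by
      intro k
      simp [EEx, mkDerivation_X]
    simp only [Derivation.leibniz, this, h2, smul_eq_mul]
    split_ifs <;> simp [Psi_X, ← Finset.sum_add_distrib] <;>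
      exact Finset.sum_congr rfl fun k _ => by ring

end SymDet
namespace SymDet

open Finset

variable {K : Type*} [Field K] {m : ℕ}

lemma det_mul_zero_of_card_lt {A : Type*} [CommRing A] [IsDomain A] {ι : Type*} [Fintype ι] {t : ℕ}
    (h : Fintype.card ι < t) (P : Matrix (Fin t) ι A) (Q : Matrix ι (Fin t) A) :
    (P * Q).det = 0 := by
  classical
  let φ := algebraMap A (FractionRing A)
  have hφ : Function.Injective φ := IsFractionRing.injective A (FractionRing A)
  apply hφ
  rw [map_zero, RingHom.map_det, RingHom.mapMatrix_apply, Matrix.map_mul]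
  by_contra hne
  have hu : IsUnit (P.map φ * Q.map φ) := by
    rw [Matrix.isUnit_iff_isUnit_det]; exact isUnit_iff_ne_zero.2 hne
  have h1 := Matrix.rank_of_isUnit _ hu
  have h2 := Matrix.rank_mul_le_left (P.map φ) (Q.map φ)
  have h3 := Matrix.rank_le_card_width (P.map φ)
  simp at h1
  omega

lemma symMinors_le_ker (ι : Type*) [Fintype ι] {t : ℕ} (h : Fintype.card ι < t) :
    symMinors K m t ≤ RingHom.ker (Psi K m ι) := by
  refine Ideal.span_le.2 ?_
  rintro _ ⟨r, c, _, _, rfl⟩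
  rw [SetLike.mem_coe, RingHom.mem_ker, AlgHom.map_det, AlgHom.mapMatrix_apply]
  rw [← det_mul_zero_of_card_lt h
    (Matrix.of fun i k => X (Sum.inl (r i, k)) * X (Sum.inr k) : Matrix _ _ (MvPolynomial ((Fin m × ι) ⊕ ι) K))
    (Matrix.of fun k j => X (Sum.inl (c j, k)))]
  congr 1
  ext1 i j
  simp only [Matrix.map_apply, Matrix.of_apply, Psi_X, Matrix.mul_apply]
  exact Finset.sum_congr rfl fun k _ => by ring

lemma mem_restrict_iff (d : ℕ) (f : PR K m) : f ∈ restrictTotalDegree (Sym2 (Fin m)) K d ↔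
    ∀ a, coeff a f ≠ 0 → (a.sum fun _ n => n) ≤ d := by
  rw [mem_restrictTotalDegree, totalDegree, Finset.sup_le_iff]
  simp [mem_support_iff]

lemma EE_mem_restrict (i j : Fin m) (d : ℕ) {f : PR K m}
    (hf : f ∈ restrictTotalDegree (Sym2 (Fin m)) K d) :
    EE i j f ∈ restrictTotalDegree (Sym2 (Fin m)) K d := by
  classical
  rw [mem_restrictTotalDegree] at hf
  rw [f.as_sum, map_sum]
  refine sum_mem fun a ha => ?_
  have hd : (a.sum fun _ n => n) ≤ d := (le_totalDegree ha).trans hf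
  rw [EE_apply]
  refine sum_mem fun b _ => Submodule.smul_mem _ _ ?_
  rw [pderiv_monomial]
  by_cases h0 : a s(j, b) = 0
  · simp [h0]
  rw [X, monomial_mul, mem_restrictTotalDegree]
  refine (totalDegree_monomial_le _ _).trans ?_
  have ha' : a = (a - Finsupp.single s(j, b) 1) + Finsupp.single s(j, b) 1 := by
    rw [tsub_add_cancel_of_le]
    rw [Finsupp.single_le_iff]
    omega
  rw [ha'] at hd
  rw [Finsupp.sum_add_index' (by simp) (by simp)] at *
  simp only [Finsupp.sum_single_index, id] at *
  have : ((a - Finsupp.single s(j, b) 1).sum fun x => id) =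
    (a - Finsupp.single s(j, b) 1).sum fun _ n => n := rfl
  simp only [Finsupp.sum, id] at *
  omega

/-- weights -/
noncomputable def wt (e : Sym2 (Fin m)) : Fin m → ℤ :=
  Sym2.lift ⟨fun i j => Pi.single i 1 + Pi.single j 1, fun _ _ => add_comm _ _⟩ e

lemma wt_mk (i j : Fin m) : wt s(i, j) = Pi.single i 1 + Pi.single j 1 := rfl

lemma EE_wt (i j : Fin m) {f : PR K m} {a : Fin m → ℤ} (hf : IsWeightedHomogeneous wt f a) :
    IsWeightedHomogeneous wt (EE i j f) (a + Pi.single i 1 - Pi.single j 1) := by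
  rw [EE_apply]
  refine IsWeightedHomogeneous.sum _ _ _ fun b _ => ?_
  rw [smul_eq_C_mul]
  refine IsWeightedHomogeneous.C_mul ?_ _
  have h1 := hf.pderiv (i := s(j, b)) (n' := a - wt s(j, b)) (by simp)
  have h2 := (isWeightedHomogeneous_X K wt s(i, b)).mul h1
  convert h2 using 1
  simp only [wt_mk]
  abel

lemma comp_mem_symMinors {t : ℕ} (a : Fin m → ℤ) {f : PR K m} (hf : f ∈ symMinors K m t) :
    weightedHomogeneousComponent wt a f ∈ symMinors K m t := by
  classical
  let _ := weightedGradedAlgebra K (wt (m := m))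
  refine weightedHomogeneousComponent_mem_of_mem K wt ?_ hf a
  refine Ideal.homogeneous_span _ _ ?_
  rintro _ ⟨r, c, _, _, rfl⟩
  refine ⟨∑ i, (Pi.single (r i) 1 + Pi.single (c i) 1), ?_⟩
  rw [mem_weightedHomogeneousSubmodule, Matrix.det_apply]
  refine IsWeightedHomogeneous.sum _ _ _ fun σ _ => ?_
  have : IsWeightedHomogeneous wt (∏ i, Matrix.of (fun i j => (X s(r i, c j) : PR K m)) (σ i) i)
      (∑ i, (Pi.single (r i) 1 + Pi.single (c i) 1)) := by
    have h := IsWeightedHomogeneous.prod univ (fun i => (X s(r (σ i), c i) : PR K m))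
      (fun i => wt s(r (σ i), c i)) (w := wt) (fun i _ => isWeightedHomogeneous_X K wt _)
    convert h using 1
    · rfl
    simp only [wt_mk, Finset.sum_add_distrib]
    rw [Equiv.sum_comp σ (fun i => (Pi.single (r i) 1 : Fin m → ℤ))]
  exact (weightedHomogeneousSubmodule K wt _).smul_of_tower_mem _ this

noncomputable def wtx (ι : Type*) : (Fin m × ι) ⊕ ι → (Fin m → ℤ) :=
  Sum.elim (fun p => Pi.single p.1 1) (fun _ => 0)

lemma Psi_comp (ι : Type*) [Fintype ι] (a : Fin m → ℤ) (f : PR K m) :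
    Psi K m ι (weightedHomogeneousComponent wt a f) =
      weightedHomogeneousComponent (wtx ι) a (Psi K m ι f) := by
  classical
  have hX : ∀ e, IsWeightedHomogeneous (wtx ι) (PsiX K m ι e) (wt e) := by
    intro e
    induction e using Sym2.inductionOn with
    | _ i j =>
    rw [PsiX_mk]
    refine IsWeightedHomogeneous.sum _ _ _ fun k _ => ?_
    have := ((isWeightedHomogeneous_X K (wtx ι) (Sum.inl (i, k))).mul
      (isWeightedHomogeneous_X K (wtx ι) (Sum.inl (j, k)))).mul
      (isWeightedHomogeneous_X K (wtx (m := m) ι) (Sum.inr k))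
    convert this using 1
    simp [wt_mk, wtx]
  induction f using MvPolynomial.induction_on' with
  | add p q hp hq => simp only [map_add, hp, hq]
  | monomial d c =>
    have h1 : IsWeightedHomogeneous wt (monomial d c : PR K m) (Finsupp.weight wt d) :=
      isWeightedHomogeneous_monomial _ _ _ rfl
    have h2 : IsWeightedHomogeneous (wtx ι) (Psi K m ι (monomial d c)) (Finsupp.weight wt d) := by
      rw [Psi, aeval_monomial, MvPolynomial.algebraMap_eq]
      refine IsWeightedHomogeneous.C_mul ?_ _
      rw [Finsupp.prod, Finsupp.weight_apply, Finsupp.sum]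
      exact IsWeightedHomogeneous.prod _ _ _ fun e _ => (hX e).pow _
    rw [weightedHomogeneousComponent_of_mem h1, weightedHomogeneousComponent_of_mem h2]
    split_ifs <;> simp

lemma BB_comp (a : Fin m → ℤ) (f g : PR K m) :
    BB (weightedHomogeneousComponent wt a f) g = BB f (weightedHomogeneousComponent wt a g) := by
  classical
  have : BB.comp (weightedHomogeneousComponent wt a) =
    (BB (K := K)).compl₂ (weightedHomogeneousComponent (wt (m := m)) a) := by
    apply bilin_ext
    intro x y
    have h1 : ∀ d, IsWeightedHomogeneous wt (monomial d 1 : PR K m) (Finsupp.weight wt d) :=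
      fun d => isWeightedHomogeneous_monomial _ _ _ rfl
    rw [LinearMap.comp_apply, LinearMap.compl₂_apply, weightedHomogeneousComponent_of_mem (h1 x),
      weightedHomogeneousComponent_of_mem (h1 y)]
    by_cases hxy : x = y
    · subst hxy; split_ifs <;> simp
    · split_ifs <;> simp [BB_monomial_monomial, hxy]
  exact congrArg (fun B => B f g) this

lemma comp_mem_restrict (a : Fin m → ℤ) (d : ℕ) {f : PR K m}
    (hf : f ∈ restrictTotalDegree (Sym2 (Fin m)) K d) :
    weightedHomogeneousComponent wt a f ∈ restrictTotalDegree (Sym2 (Fin m)) K d := by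
  classical
  rw [mem_restrict_iff] at *
  intro b hb
  apply hf
  rw [coeff_weightedHomogeneousComponent] at hb
  split_ifs at hb
  · exact hb
  · exact absurd rfl hb

/-! ### swaps -/

noncomputable def sw (π : Equiv.Perm (Fin m)) : PR K m →ₐ[K] PR K m := rename (Sym2.map π)

lemma sw_X (π : Equiv.Perm (Fin m)) (i j : Fin m) : sw π (X s(i, j) : PR K m) = X s(π i, π j) := by
  simp [sw]

lemma sw_mem_symMinors (π : Equiv.Perm (Fin m)) {t : ℕ} {f : PR K m} (hf : f ∈ symMinors K m t) :
    sw π f ∈ symMinors K m t := by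
  have : symMinors K m t ≤ (symMinors K m t).comap (sw π) := by
    refine Ideal.span_le.2 ?_
    rintro _ ⟨r, c, hr, hc, rfl⟩
    rw [SetLike.mem_coe, Ideal.mem_comap, AlgHom.map_det, AlgHom.mapMatrix_apply]
    have := mn_mem (K := K) (fun i => π (r i)) (fun i => π (c i))
    convert this using 1
    unfold mn
    congr 1
    ext1 i j
    simp [sw_X]
  exact this hf

lemma Psi_sw (ι : Type*) [Fintype ι] (π : Equiv.Perm (Fin m)) (f : PR K m) :
    Psi K m ι (sw π f) = rename (Sum.map (Prod.map π id) id) (Psi K m ι f) := by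
  have : (Psi K m ι).comp (sw π) = (rename (Sum.map (Prod.map π id) id)).comp (Psi K m ι) := by
    apply MvPolynomial.algHom_ext
    intro e
    induction e using Sym2.inductionOn with
    | _ i j =>
    simp [sw_X, Psi_X]
  exact congrArg (fun F => F f) this

lemma sw_mem_restrict (π : Equiv.Perm (Fin m)) (d : ℕ) {f : PR K m}
    (hf : f ∈ restrictTotalDegree (Sym2 (Fin m)) K d) :
    sw π f ∈ restrictTotalDegree (Sym2 (Fin m)) K d := by
  rw [mem_restrictTotalDegree] at *
  exact (totalDegree_rename_le _ _).trans hf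

lemma om_map (π : Equiv.Perm (Fin m)) (e : Sym2 (Fin m)) : om (Sym2.map π e) = om e := by
  unfold om
  induction e using Sym2.inductionOn with
  | _ i j => simp

lemma BB_sw (π : Equiv.Perm (Fin m)) (f g : PR K m) : BB (sw π f) (sw π g) = BB f g := by
  have hinj : Function.Injective (Sym2.map π) := Sym2.map.injective π.injective
  have : (BB.comp (sw π).toLinearMap).compl₂ (sw π).toLinearMap =
    (BB (K := K) (m := m)) := by
    apply bilin_ext
    intro x y
    rw [LinearMap.compl₂_apply, LinearMap.comp_apply, AlgHom.toLinearMap_apply,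
      AlgHom.toLinearMap_apply, sw, rename_monomial, rename_monomial, BB_monomial_monomial,
      BB_monomial_monomial]
    have hw : ww (Finsupp.mapDomain (Sym2.map π) x) = ww x := by
      unfold ww
      rw [← Equiv.prod_comp (Equiv.ofBijective _ ((Finite.injective_iff_bijective).1 hinj))]
      refine Finset.prod_congr rfl fun e _ => ?_
      simp only [Equiv.ofBijective_apply]
      rw [Finsupp.mapDomain_apply hinj, om_map]
    simp [(Finsupp.mapDomain_injective hinj).eq_iff, hw]
  exact congrArg (fun B => B f g) this

lemma sw_wt (π : Equiv.Perm (Fin m)) {f : PR K m} {a : Fin m → ℤ}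
    (hf : IsWeightedHomogeneous wt f a) : IsWeightedHomogeneous wt (sw π f) (a ∘ π.symm) := by
  classical
  intro d hd
  rw [sw] at hd
  obtain ⟨u, rfl, hu⟩ := coeff_rename_ne_zero _ _ _ hd
  rw [← hf hu]
  funext i
  simp only [Finsupp.weight_apply]
  rw [Finsupp.sum_mapDomain_index (by simp) (by intros; simp [add_smul])]
  simp only [Finsupp.sum, Function.comp, Finset.sum_apply, Pi.smul_apply]
  refine Finset.sum_congr rfl fun e _ => ?_
  congr 1
  induction e using Sym2.inductionOn with
  | _ x y => simp [wt_mk, Pi.single_apply, Equiv.symm_apply_eq]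

end SymDet
namespace SymDet

open Finset

variable {K : Type*} [Field K] {m : ℕ}

lemma eval_aeval_poly (p : Sym2 (Fin m) → Polynomial K) (s : K) (f : PR K m) :
    (aeval p f).eval s = eval (fun e => (p e).eval s) f := by
  induction f using MvPolynomial.induction_on with
  | C a => simp
  | add p q hp hq => simp only [map_add, Polynomial.eval_add, hp, hq]
  | mul_X p e hp => simp [hp]

noncomputable def pth (M : Sym2 (Fin m) → K) (r : Fin m) (v : Fin m → K) (e : Sym2 (Fin m)) :
    Polynomial K :=
  Sym2.lift ⟨fun a b => Polynomial.C (M s(a, b)) +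
    Polynomial.X * Polynomial.C (v a * M s(r, b) + v b * M s(r, a)) +
    Polynomial.X ^ 2 * Polynomial.C (v a * v b * M s(r, r)), fun a b => by
      simp only [Sym2.eq_swap (a := a) (b := b), add_comm (v a * _), mul_comm (v a) (v b)]⟩ e

lemma pth_mk (M : Sym2 (Fin m) → K) (r : Fin m) (v : Fin m → K) (a b : Fin m) :
    pth M r v s(a, b) = Polynomial.C (M s(a, b)) +
    Polynomial.X * Polynomial.C (v a * M s(r, b) + v b * M s(r, a)) +
    Polynomial.X ^ 2 * Polynomial.C (v a * v b * M s(r, r)) := rfl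

lemma derivative_pth (M : Sym2 (Fin m) → K) (r : Fin m) (v : Fin m → K) (hv : v r = 0)
    (f : PR K m) : Polynomial.derivative (aeval (pth M r v) f) =
      aeval (pth M r v) (∑ j, v j • EE r j f) := by
  induction f using MvPolynomial.induction_on with
  | C a => simp
  | add p q hp hq => simp only [map_add, hp, hq, smul_add, Finset.sum_add_distrib]
  | mul_X p e hp =>
    have h1 : ∑ j, v j • EE r j (p * X e) = p * (∑ j, v j • EE r j (X e)) +
        X e * (∑ j, v j • EE r j p) := by
      simp only [Derivation.leibniz, smul_eq_mul, smul_add, Finset.sum_add_distrib, Finset.mul_sum,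
        mul_smul_comm]
    rw [h1, map_mul, Polynomial.derivative_mul, hp, map_add, map_mul, map_mul, add_comm]
    rw [aeval_X]
    congr 1
    swap
    · ring
    congr 1
    induction e using Sym2.inductionOn with
    | _ a b =>
    have h2 : (∑ j, v j • EE r j (X s(a, b)) : PR K m) = v a • X s(r, b) + v b • X s(a, r) := by
      simp only [EE_X, smul_add, Finset.sum_add_distrib, smul_ite, smul_zero]
      simp
    rw [h2, map_add, map_smul, map_smul, aeval_X, aeval_X, pth_mk, pth_mk, pth_mk]
    simp only [hv, Polynomial.smul_eq_C_mul, Sym2.eq_swap (a := a) (b := r)]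
    simp
    ring

lemma flow_zero [CharZero K] (F : PR K m) (hE : ∀ i j, i < j → EE i j F = 0)
    (hd : ∀ M : Sym2 (Fin m) → K, (∀ a b, a ≠ b → M s(a, b) = 0) → eval M F = 0) : F = 0 := by
  classical
  have key : ∀ q : ℕ, q ≤ m → ∀ M : Sym2 (Fin m) → K,
      (∀ a b : Fin m, a ≠ b → (a : ℕ) < m - q → M s(a, b) = 0) → eval M F = 0 := by
    intro q
    induction q with
    | zero =>
      intro _ M hM
      exact hd M fun a b hab => hM a b hab (by have := a.2; omega)
    | succ q ih =>
      intro hq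
      have hne : ∀ M : Sym2 (Fin m) → K,
          (∀ a b : Fin m, a ≠ b → (a : ℕ) < m - (q + 1) → M s(a, b) = 0) →
          M s(⟨m - (q + 1), by omega⟩, ⟨m - (q + 1), by omega⟩) ≠ 0 → eval M F = 0 := by
        intro M hM hne
        set r : Fin m := ⟨m - (q + 1), by omega⟩ with hr
        let v : Fin m → K := fun j => if r < j then - M s(r, j) / M s(r, r) else 0
        have hvr : v r = 0 := by simp [v]
        have hder := derivative_pth M r v hvr F
        have hz : (∑ j, v j • EE r j F : PR K m) = 0 := by
          refine Finset.sum_eq_zero fun j _ => ?_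
          by_cases h : r < j
          · rw [hE r j h, smul_zero]
          · simp [v, h]
        rw [hz, map_zero] at hder
        have hc := Polynomial.eq_C_of_derivative_eq_zero hder
        have e0 := eval_aeval_poly (pth M r v) 0 F
        have e1 := eval_aeval_poly (pth M r v) 1 F
        have h0 : (fun e => (pth M r v e).eval 0) = M := by
          funext e
          induction e using Sym2.inductionOn with
          | _ a b => simp [pth_mk]
        rw [h0] at e0
        have hce : ∀ s : K, (aeval (pth M r v) F).eval s = (aeval (pth M r v) F).coeff 0 := by
          intro s
          conv_lhs => rw [hc]
          rw [Polynomial.eval_C]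
        rw [← e0, hce 0, ← hce 1, e1]
        apply ih (by omega)
        intro a b hab ha
        rw [pth_mk]
        simp only [Polynomial.eval_add, Polynomial.eval_C, Polynomial.eval_mul, Polynomial.eval_X,
          Polynomial.eval_pow, one_pow, one_mul]
        by_cases har : a = r
        · subst har
          rw [hvr]
          by_cases hb : r < b
          · simp only [v, hb, if_true]
            field_simp
            ring
          · have hbr : b < r := lt_of_le_of_ne (not_lt.1 hb) hab.symm
            have : M s(r, b) = 0 := by
              rw [Sym2.eq_swap]; exact hM b r hab.symm hbr
            simp [v, hb, this]
        · have har' : (a : ℕ) < m - (q + 1) := by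
            have : (a : ℕ) ≠ m - (q + 1) := fun h => har (Fin.ext h)
            omega
          have hva : v a = 0 := by
            have : ¬ r < a := by rw [Fin.lt_def]; simp only [hr]; omega
            simp [v, this]
          rw [hva, hM a b hab har', Sym2.eq_swap (a := r) (b := a), hM a r har har']
          ring
      intro M hM
      set r : Fin m := ⟨m - (q + 1), by omega⟩ with hr
      let p : Sym2 (Fin m) → Polynomial K := fun e =>
        if e = s(r, r) then Polynomial.X else Polynomial.C (M e)
      have hp : aeval p F = 0 := by
        apply Polynomial.eq_zero_of_infinite_isRoot
        refine Set.Infinite.mono (s := {0}ᶜ) ?_ ((Set.finite_singleton 0).infinite_compl)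
        intro s hs
        change (aeval p F).eval s = 0
        rw [eval_aeval_poly]
        apply hne
        · intro a b hab ha
          have : s(a, b) ≠ s(r, r) := by
            intro h
            simp only [Sym2.eq_iff] at h
            apply hab
            rcases h with h | h <;> rw [h.1, h.2]
          simp [p, this, hM a b hab ha]
        · simpa [p, ← hr] using hs
      have := eval_aeval_poly p (M s(r, r)) F
      rw [hp, Polynomial.eval_zero] at this
      rw [this]
      congr 2
      funext e
      by_cases he : e = s(r, r)
      · simp [p, he]
      · simp [p, he]
  apply MvPolynomial.funext
  intro M
  rw [map_zero]
  exact key m le_rfl M (fun a b _ h => by omega)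

/-- the leading principal minor -/
noncomputable def Dl (K : Type*) [Field K] {m : ℕ} (r : ℕ) (hr : r ≤ m) : PR K m :=
  mn (Fin.castLE hr) (Fin.castLE hr)

lemma EE_Dl (r : ℕ) (hr : r ≤ m) (i j : Fin m) (hij : i < j) : EE i j (Dl K r hr) = 0 := by
  rw [Dl, EE_mn]
  have hlt : ∀ p : Fin r, Fin.castLE hr p = j → (i : ℕ) < r := by
    rintro p rfl
    have := Fin.lt_def.1 hij
    have := p.2
    simp at *
    omega
  have this : ∀ (p : Fin r) (hp : Fin.castLE hr p = j), (⟨i, hlt p hp⟩ : Fin r) ≠ p := by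
    rintro p rfl h
    rw [← h] at hij
    exact absurd hij (by rw [Fin.lt_def]; simp)
  rw [Finset.sum_eq_zero, Finset.sum_eq_zero, add_zero]
  all_goals
    intro p _
    split_ifs with hp
    swap
    · rfl
    unfold mn
  · refine Matrix.det_zero_of_column_eq (this p hp) fun k => ?_
    simp [Function.update_of_ne (this p hp)]
  · refine Matrix.det_zero_of_row_eq (this p hp) ?_
    ext k
    simp [Function.update_of_ne (this p hp)]

lemma eval_Dl (r : ℕ) (hr : r ≤ m) (M : Sym2 (Fin m) → K) (hM : ∀ a b, a ≠ b → M s(a, b) = 0) :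
    eval M (Dl K r hr) = ∏ i : Fin m, if (i : ℕ) < r then M s(i, i) else 1 := by
  rw [Dl, mn, RingHom.map_det, RingHom.mapMatrix_apply]
  have : (Matrix.of fun i j => (X s(Fin.castLE hr i, Fin.castLE hr j) : PR K m)).map (eval M) =
    Matrix.diagonal fun i => M s(Fin.castLE hr i, Fin.castLE hr i) := by
    ext i j
    by_cases h : i = j
    · subst h; simp
    · rw [Matrix.diagonal_apply_ne _ h]
      simp only [Matrix.map_apply, Matrix.of_apply, eval_X]
      exact hM _ _ (fun h' => h (Fin.castLE_injective hr h'))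
  rw [this, Matrix.det_diagonal, Finset.prod_ite, Finset.prod_const_one, mul_one]
  refine Finset.prod_bij (fun i _ => Fin.castLE hr i) ?_ ?_ ?_ ?_
  · intro i _; simp
  · intro i _ j _ h; exact Fin.castLE_injective hr h
  · intro b hb
    exact ⟨⟨b, by simpa using hb⟩, by simp, by ext; simp⟩
  · intro i _; rfl

lemma exists_hw [CharZero K] (n : ℕ) (N : ℕ) : ∀ b : Fin m → ℕ, Antitone b → ∑ i, b i = N →
    ∃ h : PR ℚ m, (∀ i j, i < j → EE i j (map (algebraMap ℚ K) h) = 0) ∧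
      (∀ M : Sym2 (Fin m) → K, (∀ a b, a ≠ b → M s(a, b) = 0) →
        eval M (map (algebraMap ℚ K) h) = ∏ i, M s(i, i) ^ b i) ∧
      ((∃ i : Fin m, n ≤ i ∧ b i ≠ 0) → map (algebraMap ℚ K) h ∈ symMinors K m (n + 1)) := by
  induction N using Nat.strong_induction_on with
  | _ N ih =>
  intro b hb hN
  by_cases h0 : ∀ i, b i = 0
  · refine ⟨1, ?_, ?_, ?_⟩
    · intro i j _; simp
    · intro M _; simp [h0]
    · rintro ⟨i, _, hi⟩; exact absurd (h0 i) hi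
  · push Not at h0
    -- the support is an initial segment
    obtain ⟨r, hr, hrb⟩ : ∃ r : ℕ, r ≤ m ∧ ∀ i : Fin m, b i ≠ 0 ↔ (i : ℕ) < r := by
      have hex : ∃ r : ℕ, r ≤ m ∧ ∀ i : Fin m, r ≤ i → b i = 0 :=
        ⟨m, le_rfl, fun i hi => absurd i.2 (by omega)⟩
      classical
      refine ⟨Nat.find hex, (Nat.find_spec hex).1, fun i => ⟨fun h => ?_, fun h hbi => ?_⟩⟩
      · by_contra hlt
        exact h ((Nat.find_spec hex).2 i (by omega))
      · refine Nat.find_min hex h ⟨i.2.le, fun j hj => ?_⟩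
        have := hb (show i ≤ j from hj)
        omega
    let b' : Fin m → ℕ := fun i => b i - if (i : ℕ) < r then 1 else 0
    have hbb : ∀ i, b i = b' i + if (i : ℕ) < r then 1 else 0 := by
      intro i
      have := hrb i
      simp only [b']
      split_ifs with h <;> omega
    have hb' : Antitone b' := by
      intro i j hij
      have h1 := hb hij
      have h2 := hrb i
      have h3 := hrb j
      have h4 := hbb i
      have h5 := hbb j
      have h6 : (i : ℕ) ≤ j := hij
      split_ifs at h4 h5 <;> omega
    have hlt : ∑ i, b' i < N := by
      rw [← hN]
      obtain ⟨i, hi⟩ := h0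
      refine Finset.sum_lt_sum (fun i _ => by rw [hbb i]; omega) ⟨i, by simp, ?_⟩
      have := (hrb i).1 hi
      rw [hbb i, if_pos this]; omega
    obtain ⟨h, h1, h2, -⟩ := ih _ hlt b' hb' rfl
    have hmap : map (algebraMap ℚ K) (Dl ℚ r hr) = Dl K r hr := by
      rw [Dl, Dl, mn, mn, RingHom.map_det]
      congr 1
      ext1 i j
      simp
    refine ⟨Dl ℚ r hr * h, ?_, ?_, ?_⟩
    · intro i j hij
      rw [map_mul, hmap, Derivation.leibniz, h1 i j hij, EE_Dl r hr i j hij]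
      simp
    · intro M hM
      rw [map_mul, hmap, map_mul, h2 M hM, eval_Dl r hr M hM, ← Finset.prod_mul_distrib]
      refine Finset.prod_congr rfl fun i _ => ?_
      rw [hbb i, pow_add, mul_comm]
      split_ifs <;> simp
    · rintro ⟨i, hi, hbi⟩
      rw [map_mul, hmap]
      apply Ideal.mul_mem_right
      have : n + 1 ≤ r := by have := (hrb i).1 hbi; omega
      exact symMinors_anti this (mn_mem _ _)

end SymDet
namespace SymDet

open Finset

variable {K : Type*} [Field K] {m : ℕ}

lemma BB_map [CharZero K] (f g : PR ℚ m) :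
    BB (map (algebraMap ℚ K) f) (map (algebraMap ℚ K) g) = algebraMap ℚ K (BB f g) := by
  induction f using MvPolynomial.induction_on' with
  | add p q hp hq => simp only [map_add, LinearMap.add_apply, hp, hq]
  | monomial a c =>
    rw [map_monomial, BB_monomial, BB_monomial, coeff_map, map_mul, map_mul]
    simp

lemma BB_self_pos (h : PR ℚ m) (h0 : h ≠ 0) : 0 < BB h h := by
  have : BB h h = ∑ a ∈ h.support, coeff a h * ww a * coeff a h := by
    conv_lhs => enter [1]; rw [h.as_sum]
    rw [map_sum, LinearMap.sum_apply]
    refine Finset.sum_congr rfl fun a _ => ?_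
    rw [BB_monomial]; simp
  rw [this]
  apply Finset.sum_pos
  · intro a ha
    have h1 := ww_pos a
    have h2 : coeff a h ≠ 0 := mem_support_iff.1 ha
    have h3 : 0 < coeff a h * coeff a h := mul_self_pos.2 h2
    calc 0 < (coeff a h * coeff a h) * ww a := mul_pos h3 h1
      _ = _ := by ring
  · exact support_nonempty.2 h0

lemma weight_diag (u : Sym2 (Fin m) →₀ ℕ) (hu : ∀ x y, x ≠ y → u s(x, y) = 0) (i : Fin m) :
    Finsupp.weight wt u i = 2 * (u s(i, i) : ℤ) := by
  rw [Finsupp.weight_apply, Finsupp.sum_fintype _ _ (by simp), Finset.sum_apply,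
    Fintype.sum_eq_single s(i, i)]
  · simp [wt_mk]; ring
  · intro e he
    induction e using Sym2.inductionOn with
    | _ x y =>
    by_cases hxy : x = y
    · subst hxy
      have : x ≠ i := fun h => he (by rw [h])
      simp [wt_mk, this.symm]
    · simp [hu x y hxy]

lemma diag_ext (u v : Sym2 (Fin m) →₀ ℕ) (hu : ∀ x y, x ≠ y → u s(x, y) = 0)
    (hv : ∀ x y, x ≠ y → v s(x, y) = 0) (h : Finsupp.weight wt u = Finsupp.weight wt v) : u = v := by
  ext e
  induction e using Sym2.inductionOn with
  | _ x y =>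
  by_cases hxy : x = y
  · subst hxy
    have := congrFun h x
    rw [weight_diag u hu, weight_diag v hv] at this
    omega
  · rw [hu x y hxy, hv x y hxy]

lemma term_zero (M : Sym2 (Fin m) → K) (hM : ∀ a b, a ≠ b → M s(a, b) = 0)
    (u : Sym2 (Fin m) →₀ ℕ) (hu : ¬ ∀ x y, x ≠ y → u s(x, y) = 0) : ∏ e, M e ^ u e = 0 := by
  push Not at hu
  obtain ⟨x, y, hxy, h⟩ := hu
  refine Finset.prod_eq_zero (Finset.mem_univ s(x, y)) ?_
  rw [hM x y hxy, zero_pow h]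

lemma prod_diag (M : Sym2 (Fin m) → K) (u : Sym2 (Fin m) →₀ ℕ)
    (hu : ∀ x y, x ≠ y → u s(x, y) = 0) : ∏ e, M e ^ u e = ∏ i, M s(i, i) ^ u s(i, i) := by
  symm
  refine Fintype.prod_of_injective (fun i => s(i, i)) ?_ _ _ ?_ ?_
  · intro i j h
    simpa using h
  · intro e he
    induction e using Sym2.inductionOn with
    | _ x y =>
    have : x ≠ y := by rintro rfl; exact he ⟨x, rfl⟩
    simp [hu x y this]
  · intro i; rfl

lemma weight_bound (u : Sym2 (Fin m) →₀ ℕ) (i : Fin m) :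
    Finsupp.weight wt u i ≤ 2 * ((u.sum fun _ n => n : ℕ) : ℤ) := by
  rw [Finsupp.weight_apply, Finsupp.sum, Finsupp.sum, Finset.sum_apply, Nat.cast_sum,
    Finset.mul_sum]
  refine Finset.sum_le_sum fun e _ => ?_
  have : wt e i ≤ 2 := by
    induction e using Sym2.inductionOn with
    | _ x y =>
    simp only [wt_mk, Pi.add_apply, Pi.single_apply]
    split_ifs <;> norm_num
  simp only [Pi.smul_apply, nsmul_eq_mul]
  nlinarith

/-- the height of a weight -/
def ht (a : Fin m → ℤ) : ℤ := ∑ i : Fin m, ((m : ℤ) - i) * a i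

/-- the set of bad vectors -/
def Bad (K : Type*) [Field K] (m n d : ℕ) (f : PR K m) : Prop :=
  Psi K m (Fin n) f = 0 ∧ f ∈ restrictTotalDegree (Sym2 (Fin m)) K d ∧
    ∀ g ∈ symMinors K m (n + 1), g ∈ restrictTotalDegree (Sym2 (Fin m)) K d → BB f g = 0

lemma Bad.EE [CharZero K] {n d : ℕ} {f : PR K m} (hf : Bad K m n d f) (i j : Fin m) :
    Bad K m n d (EE i j f) := by
  obtain ⟨h1, h2, h3⟩ := hf
  refine ⟨?_, EE_mem_restrict _ _ _ h2, fun g hg hg' => ?_⟩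
  · rw [Psi_EE, h1, map_zero]
  · rw [BB_EE]
    exact h3 _ (EE_mem_symMinors _ _ hg) (EE_mem_restrict _ _ _ hg')

lemma Bad.comp {n d : ℕ} {f : PR K m} (hf : Bad K m n d f) (a : Fin m → ℤ) :
    Bad K m n d (weightedHomogeneousComponent wt a f) := by
  obtain ⟨h1, h2, h3⟩ := hf
  refine ⟨?_, comp_mem_restrict _ _ h2, fun g hg hg' => ?_⟩
  · rw [Psi_comp, h1, map_zero]
  · rw [BB_comp]
    exact h3 _ (comp_mem_symMinors _ hg) (comp_mem_restrict _ _ hg')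

lemma Bad.sw {n d : ℕ} {f : PR K m} (hf : Bad K m n d f) (π : Equiv.Perm (Fin m)) :
    Bad K m n d (sw π f) := by
  obtain ⟨h1, h2, h3⟩ := hf
  refine ⟨?_, sw_mem_restrict _ _ h2, fun g hg hg' => ?_⟩
  · rw [Psi_sw, h1, map_zero]
  · have : g = SymDet.sw π (SymDet.sw π⁻¹ g) := by
      simp only [SymDet.sw, rename_rename]
      rw [← Sym2.map_comp]
      have : (⇑π ∘ ⇑π⁻¹) = id := by ext x; simp
      rw [this, Sym2.map_id, rename_id]; rfl
    rw [this, BB_sw]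
    exact h3 _ (sw_mem_symMinors _ hg) (sw_mem_restrict _ _ hg')

/-- highest weight vectors -/
lemma exists_highest [CharZero K] {n d : ℕ} {f : PR K m} (hf : Bad K m n d f) (h0 : f ≠ 0) :
    ∃ (f : PR K m) (a : Fin m → ℤ), Bad K m n d f ∧ f ≠ 0 ∧ IsWeightedHomogeneous wt f a ∧
      Antitone a ∧ ∀ i j, i < j → EE i j f = 0 := by
  classical
  let P : ℤ → Prop := fun z => ∃ (f : PR K m) (a : Fin m → ℤ), Bad K m n d f ∧ f ≠ 0 ∧
    IsWeightedHomogeneous wt f a ∧ z = ht a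
  have hne : ∃ z, P z := by
    obtain ⟨u, hu⟩ := exists_coeff_ne_zero h0
    refine ⟨_, weightedHomogeneousComponent wt (Finsupp.weight wt u) f, Finsupp.weight wt u,
      hf.comp _, ?_, weightedHomogeneousComponent_isWeightedHomogeneous _ _, rfl⟩
    intro h
    have := congrArg (coeff u) h
    rw [coeff_weightedHomogeneousComponent, if_pos rfl] at this
    exact hu (by simpa using this)
  have hb : ∃ b, ∀ z, P z → z ≤ b := by
    refine ⟨∑ i : Fin m, ((m : ℤ) - i) * (2 * d), ?_⟩
    rintro z ⟨f, a, hW, hf0, ha, rfl⟩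
    obtain ⟨u, hu⟩ := exists_coeff_ne_zero hf0
    have h1 := ha hu
    have h2 := (mem_restrict_iff d f).1 hW.2.1 u hu
    refine Finset.sum_le_sum fun i _ => ?_
    have h3 := weight_bound u i
    rw [h1] at h3
    have h4 : (i : ℤ) < m := by exact_mod_cast i.2
    refine mul_le_mul_of_nonneg_left (h3.trans ?_) (by linarith)
    exact_mod_cast Nat.mul_le_mul_left 2 h2
  obtain ⟨z, ⟨f, a, hW, hf0, ha, rfl⟩, hmax⟩ := Int.exists_greatest_of_bdd hb hne
  refine ⟨f, a, hW, hf0, ha, ?_, ?_⟩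
  · intro i j hij
    rcases eq_or_lt_of_le hij with rfl | hlt
    · exact le_rfl
    have hsw0 : sw (Equiv.swap i j) f ≠ 0 := by
      intro h
      apply hf0
      have hinj : Function.Injective (sw (K := K) (Equiv.swap i j)) :=
        rename_injective _ (Sym2.map.injective (Equiv.swap i j).injective)
      exact hinj (by rw [h, map_zero])
    have h1 := hmax _ ⟨_, _, hW.sw (Equiv.swap i j), hsw0, sw_wt _ ha, rfl⟩
    have h2 : ht (a ∘ (Equiv.swap i j).symm) - ht a = ((j : ℤ) - i) * (a j - a i) := by
      unfold ht
      rw [← Finset.sum_sub_distrib, Fintype.sum_eq_add i j hlt.ne]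
      · simp; ring
      · rintro x ⟨hx, hy⟩
        simp [Equiv.swap_apply_of_ne_of_ne hx hy]
    have h3 : (i : ℤ) < j := by exact_mod_cast hlt
    by_contra hcon
    push Not at hcon
    have : 0 < ((j : ℤ) - i) * (a j - a i) := mul_pos (by linarith) (by linarith)
    linarith
  · intro i j hij
    by_contra hne
    have h1 := hmax _ ⟨_, _, hW.EE i j, hne, EE_wt i j ha, rfl⟩
    have h2 : ht (a + Pi.single i 1 - Pi.single j 1) = ht a + ((j : ℤ) - i) := by
      unfold ht
      simp only [Pi.add_apply, Pi.sub_apply, Pi.single_apply, mul_add, mul_sub, Finset.sum_add_distrib,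
        Finset.sum_sub_distrib, mul_ite, mul_one, mul_zero]
      simp
      ring
    have h3 : (i : ℤ) < j := by exact_mod_cast hij
    linarith

lemma exists_point (n : ℕ) : ∃ M0 : Sym2 (Fin m) → K,
    (∀ i j : Fin m, M0 s(i, j) = if i = j ∧ (i : ℕ) < n then 1 else 0) ∧
    ∀ f : PR K m, Psi K m (Fin n) f = 0 → eval M0 f = 0 := by
  classical
  let M0 : Sym2 (Fin m) → K :=
    fun e => Sym2.lift ⟨fun i j : Fin m => if i = j ∧ (i : ℕ) < n then 1 else 0,
    fun i j => by
      by_cases hij : i = j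
      · subst hij; rfl
      · simp [hij, Ne.symm hij]⟩ e
  have hM0 : ∀ i j : Fin m, M0 s(i, j) = if i = j ∧ (i : ℕ) < n then 1 else 0 := fun i j => rfl
  let χ : (Fin m × Fin n) ⊕ Fin n → K :=
    Sum.elim (fun p => if (p.1 : ℕ) = p.2 then 1 else 0) (fun _ => 1)
  have hcomp : (aeval χ : _ →ₐ[K] K).comp (Psi K m (Fin n)) = aeval M0 := by
    apply MvPolynomial.algHom_ext
    intro e
    induction e using Sym2.inductionOn with
    | _ i j =>
    rw [AlgHom.comp_apply, Psi_X, aeval_X, hM0, map_sum]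
    simp only [map_mul, aeval_X, χ, Sum.elim_inl, Sum.elim_inr, mul_one]
    by_cases hi : (i : ℕ) < n
    · rw [Fintype.sum_eq_single ⟨i, hi⟩]
      · by_cases hij : i = j
        · subst hij; simp [hi]
        · have : ¬ (j : ℕ) = i := fun h => hij (Fin.ext h.symm)
          simp [hij, this]
      · intro k hk
        have : ¬ (i : ℕ) = k := fun h => hk (Fin.ext h.symm)
        simp [this]
    · rw [Finset.sum_eq_zero]
      · simp [hi]
      · intro k _
        have : ¬ (i : ℕ) = k := by have := k.2; omega
        simp [this]
  refine ⟨M0, hM0, fun f hf => ?_⟩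
  have := congrArg (fun F => F f) hcomp
  simp only [AlgHom.comp_apply] at this
  rw [hf, map_zero] at this
  rw [← coe_aeval_eq_eval]
  exact this.symm

lemma Bad.zero [CharZero K] {n d : ℕ} {f : PR K m} (hf : Bad K m n d f) : f = 0 := by
  classical
  by_contra h0
  obtain ⟨f, a, hW, hf0, ha, hanti, hE⟩ := exists_highest hf h0
  by_cases hu : ∃ u, coeff u f ≠ 0 ∧ ∀ x y, x ≠ y → u s(x, y) = 0
  swap
  · apply hf0
    apply flow_zero f hE
    intro M hM
    rw [eval_eq']
    refine Finset.sum_eq_zero fun u hu' => ?_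
    rw [term_zero M hM, mul_zero]
    exact fun h => hu ⟨u, mem_support_iff.1 hu', h⟩
  obtain ⟨u, hu, hud⟩ := hu
  have hev : ∀ M : Sym2 (Fin m) → K, (∀ a b, a ≠ b → M s(a, b) = 0) →
      eval M f = coeff u f * ∏ i, M s(i, i) ^ u s(i, i) := by
    intro M hM
    rw [eval_eq', Finset.sum_eq_single u, prod_diag M u hud]
    · intro v hv hvu
      by_cases hvd : ∀ x y, x ≠ y → v s(x, y) = 0
      · exact absurd (diag_ext v u hvd hud ((ha (mem_support_iff.1 hv)).trans (ha hu).symm)) hvu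
      · rw [term_zero M hM v hvd, mul_zero]
    · intro h
      rw [notMem_support_iff.1 h, zero_mul]
  have hbanti : Antitone fun i : Fin m => u s(i, i) := by
    intro i j hij
    have h1 := hanti hij
    rw [← ha hu, weight_diag u hud, weight_diag u hud] at h1
    show u s(j, j) ≤ u s(i, i)
    omega
  obtain ⟨h, h1, h2, h3⟩ := exists_hw (K := K) n _ _ hbanti rfl
  set g := map (algebraMap ℚ K) h with hg
  have hfg : f = coeff u f • g := by
    rw [← sub_eq_zero]
    apply flow_zero
    · intro i j hij
      rw [map_sub, Derivation.map_smul, hE i j hij, h1 i j hij]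
      simp
    · intro M hM
      rw [map_sub, smul_eval, hev M hM, h2 M hM, sub_self]
  have hmem : ∃ i : Fin m, n ≤ i ∧ u s(i, i) ≠ 0 := by
    by_contra hcon
    push Not at hcon
    obtain ⟨M0, hM0, hM1⟩ := exists_point (K := K) (m := m) n
    have h4 : eval M0 f = 0 := hM1 f hW.1
    rw [hev M0 (fun i j hij => by simp [hM0, hij])] at h4
    have h5 : ∏ i, M0 s(i, i) ^ u s(i, i) = 1 := by
      refine Finset.prod_eq_one fun i _ => ?_
      by_cases hi : (i : ℕ) < n
      · simp [hM0, hi]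
      · rw [hcon i (by omega), pow_zero]
    rw [h5, mul_one] at h4
    exact hu h4
  have hgI := h3 hmem
  have hfI : f ∈ symMinors K m (n + 1) := by
    rw [hfg, smul_eq_C_mul]; exact Ideal.mul_mem_left _ _ hgI
  have hff := hW.2.2 f hfI hW.2.1
  rw [hfg, map_smul, map_smul, LinearMap.smul_apply, hg, BB_map] at hff
  simp only [smul_eq_mul, mul_eq_zero] at hff
  have hh : h ≠ 0 := by
    rintro rfl
    apply hf0
    rw [hfg, hg]; simp
  have hpos := BB_self_pos h hh
  rcases hff with hff | hff | hff
  · exact hu (by simpa using hff)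
  · exact hu (by simpa using hff)
  · rw [eq_ratCast, Rat.cast_eq_zero] at hff
    linarith

theorem ker_Psi [CharZero K] (m n : ℕ) :
    RingHom.ker (Psi K m (Fin n)) = symMinors K m (n + 1) := by
  refine le_antisymm ?_ (symMinors_le_ker (Fin n) (by simp))
  intro f hf
  let d := f.totalDegree
  let V := restrictTotalDegree (Sym2 (Fin m)) K d
  let P : Submodule K (PR K m) := (RingHom.ker (Psi K m (Fin n))).restrictScalars K ⊓ V
  let I : Submodule K (PR K m) := (symMinors K m (n + 1)).restrictScalars K ⊓ V
  have hIP : I ≤ P := fun x hx => ⟨symMinors_le_ker (Fin n) (by simp) hx.1, hx.2⟩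
  have : FiniteDimensional K V := inferInstanceAs (Module.Finite K (restrictTotalDegree _ K d))
  have : FiniteDimensional K P := Submodule.finiteDimensional_of_le (inf_le_right : P ≤ V)
  have : FiniteDimensional K I := Submodule.finiteDimensional_of_le (inf_le_right : I ≤ V)
  have hfP : f ∈ P := ⟨hf, (mem_restrictTotalDegree _ _ _).2 le_rfl⟩
  suffices h : I = P by
    rw [← h] at hfP
    exact hfP.1
  apply Submodule.eq_of_le_of_finrank_le hIP
  by_contra hlt
  push Not at hlt
  let T : P →ₗ[K] Module.Dual K I := I.subtype.dualMap ∘ₗ BB ∘ₗ P.subtype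
  have hT : LinearMap.ker T ≠ ⊥ := LinearMap.ker_ne_bot_of_finrank_lt (by
    rw [Subspace.dual_finrank_eq]; exact hlt)
  obtain ⟨⟨g, hg⟩, hg1, hg2⟩ := (Submodule.ne_bot_iff _).1 hT
  have hbad : Bad K m n d g := by
    refine ⟨hg.1, hg.2, fun q hq hq' => ?_⟩
    have := congrArg (fun F => F ⟨q, hq, hq'⟩) (LinearMap.mem_ker.1 hg1)
    simpa [T] using this
  apply hg2
  have := hbad.zero
  exact Subtype.ext this

end SymDet
namespace SymDet

open Finset

variable {K : Type*} [Field K] {m : ℕ}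

lemma mem_loc_iff {R : Type*} [CommRing R] (p : Ideal R) [p.IsPrime] (J : Ideal R) (f : R) :
    f ∈ Ideal.comap (algebraMap R (Localization.AtPrime p))
      (Ideal.map (algebraMap R (Localization.AtPrime p)) J) ↔ ∃ u ∉ p, u * f ∈ J := by
  rw [Ideal.mem_comap, IsLocalization.algebraMap_mem_map_algebraMap_iff p.primeCompl]
  rfl

lemma mem_symbolicPower_iff {R : Type*} [CommRing R] (I : Ideal R) (hI : I.IsPrime) (s : ℕ) (f : R) :
    f ∈ symbolicPower I s ↔ ∃ u ∉ I, u * f ∈ I ^ s := by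
  unfold symbolicPower
  rw [Submodule.mem_iInf]
  constructor
  · intro h
    have hI' : I = (Submodule.span R {(1 : R ⧸ I)}).annihilator := by
      ext a
      rw [Submodule.mem_annihilator_span_singleton, Algebra.smul_def, mul_one]
      exact Ideal.Quotient.eq_zero_iff_mem.symm
    exact (mem_loc_iff I _ f).1 (h ⟨I, hI, 1, hI'⟩)
  · rintro ⟨u, hu, hf⟩ ⟨p, hp, x, hx⟩
    have hpI : p = I := by
      obtain ⟨y, rfl⟩ := Ideal.Quotient.mk_surjective x
      have hmem : ∀ a, a ∈ p ↔ a * y ∈ I := by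
        intro a
        rw [hx, Submodule.mem_annihilator_span_singleton, Algebra.smul_def,
          ← Ideal.Quotient.eq_zero_iff_mem, map_mul]
        rfl
      have hy : y ∉ I := by
        intro hy
        apply hp.ne_top
        rw [Ideal.eq_top_iff_one, hmem, one_mul]
        exact hy
      ext a
      rw [hmem]
      exact ⟨fun h => (hI.mem_or_mem h).resolve_right hy, fun h => I.mul_mem_right _ h⟩
    subst hpI
    exact (mem_loc_iff p _ f).2 ⟨u, hu, hf⟩

lemma prime_symMinors [CharZero K] (m n : ℕ) : (symMinors K m (n + 1)).IsPrime := by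
  rw [← ker_Psi]
  exact RingHom.ker_isPrime _

lemma det_block {R : Type*} [CommRing R] {n q : ℕ} (A : Matrix (Fin n) (Fin n) R)
    (B : Matrix (Fin n) (Fin q) R) (C : Matrix (Fin q) (Fin n) R) (D : Matrix (Fin q) (Fin q) R) :
    (Matrix.fromBlocks A B C D).det * A.det ^ q = A.det * (A.det • D - C * A.adjugate * B).det := by
  have h : Matrix.fromBlocks A B C D * Matrix.fromBlocks 1 (-(A.adjugate * B)) 0 (A.det • 1) =
      Matrix.fromBlocks A 0 C (A.det • D - C * A.adjugate * B) := by
    rw [Matrix.fromBlocks_multiply]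
    congr 1
    · simp
    · rw [Matrix.mul_neg, ← Matrix.mul_assoc, Matrix.mul_adjugate]
      simp
    · simp
    · simp [Matrix.mul_assoc, sub_eq_neg_add]
  have h2 := congrArg Matrix.det h
  rw [Matrix.det_mul, Matrix.det_fromBlocks_zero₂₁, Matrix.det_fromBlocks_zero₁₂] at h2
  rw [← h2]
  simp

lemma det_mem_pow {R : Type*} [CommRing R] {q : ℕ} (I : Ideal R) (E : Matrix (Fin q) (Fin q) R)
    (h : ∀ i j, E i j ∈ I) : E.det ∈ I ^ q := by
  rw [Matrix.det_apply]
  refine Ideal.sum_mem _ fun σ _ => ?_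
  rw [Units.smul_def]
  refine zsmul_mem ?_ _
  have := Ideal.prod_mem_prod (s := Finset.univ) (I := fun _ : Fin q => I)
    (x := fun i => E (σ i) i) (fun i _ => h _ _)
  simpa using this

lemma mn_sum {n q : ℕ} (r c : Fin n ⊕ Fin q → Fin m) :
    (mn (r ∘ finSumFinEquiv.symm) (c ∘ finSumFinEquiv.symm) : PR K m) =
      (Matrix.of fun i j => (X s(r i, c j) : PR K m)).det := by
  rw [mn, ← Matrix.det_submatrix_equiv_self finSumFinEquiv.symm]
  rfl

lemma mn_homog {t : ℕ} (r c : Fin t → Fin m) : (mn r c : PR K m).IsHomogeneous t := by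
  rw [mn, Matrix.det_apply']
  refine IsHomogeneous.sum _ _ _ fun σ _ => ?_
  have h1 : (∏ i, (X s(r (σ i), c i) : PR K m)).IsHomogeneous t := by
    have := IsHomogeneous.prod Finset.univ (fun i => (X s(r (σ i), c i) : PR K m)) (fun _ => 1)
      (fun i _ => isHomogeneous_X _ _)
    simpa using this
  have h2 : (((Equiv.Perm.sign σ : ℤ) : PR K m)).IsHomogeneous 0 := by
    have : (((Equiv.Perm.sign σ : ℤ) : PR K m)) = C ((Equiv.Perm.sign σ : ℤ) : K) := by simp
    rw [this]; exact isHomogeneous_C _ _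
  simpa using h2.mul h1

lemma Dl_ne_zero (r : ℕ) (hr : r ≤ m) : Dl K r hr ≠ 0 := by
  intro h
  obtain ⟨M0, hM0, -⟩ := exists_point (K := K) (m := m) m
  have h1 := eval_Dl r hr M0 (fun a b hab => by simp [hM0, hab])
  rw [h, map_zero, Finset.prod_eq_one] at h1
  · exact zero_ne_one h1
  · intro i _
    simp [hM0]

lemma Dl_notMem [CharZero K] (n : ℕ) (hr : n ≤ m) : Dl K n hr ∉ symMinors K m (n + 1) := by
  intro h
  rw [← ker_Psi, RingHom.mem_ker] at h
  obtain ⟨M0, hM0, hM1⟩ := exists_point (K := K) (m := m) n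
  have h1 := eval_Dl n hr M0 (fun a b hab => by simp [hM0, hab])
  rw [hM1 _ h, Finset.prod_eq_one] at h1
  · exact zero_ne_one h1
  · intro i _
    by_cases hi : (i : ℕ) < n <;> simp [hM0, hi]

lemma Dl_mul_mem (n q : ℕ) (hn : n ≤ m) (hr : n + q ≤ m) :
    Dl K n hn ^ q * Dl K (n + q) hr ∈ symMinors K m (n + 1) ^ q := by
  let a : Fin n → Fin m := Fin.castLE hn
  let b : Fin q → Fin m := fun i => Fin.castLE hr (Fin.natAdd n i)
  let A : Matrix (Fin n) (Fin n) (PR K m) := Matrix.of fun i j => X s(a i, a j)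
  let B : Matrix (Fin n) (Fin q) (PR K m) := Matrix.of fun i j => X s(a i, b j)
  let C : Matrix (Fin q) (Fin n) (PR K m) := Matrix.of fun i j => X s(b i, a j)
  let D : Matrix (Fin q) (Fin q) (PR K m) := Matrix.of fun i j => X s(b i, b j)
  have hA : A.det = Dl K n hn := rfl
  have hM : (Matrix.fromBlocks A B C D).det = Dl K (n + q) hr := by
    have : (Fin.castLE hr : Fin (n + q) → Fin m) = Sum.elim a b ∘ finSumFinEquiv.symm := by
      funext i
      refine Fin.addCases (fun i => ?_) (fun i => ?_) i
      · simp [a]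
        rfl
      · simp [b]
    rw [Dl, this, mn_sum]
    congr 1
    ext (i | i) (j | j) <;> rfl
  have hE : ∀ i j, (A.det • D - C * A.adjugate * B) i j ∈ symMinors K m (n + 1) := by
    intro i j
    have h1 := det_block A (B.submatrix id (fun _ : Fin 1 => j)) (C.submatrix (fun _ : Fin 1 => i) id)
      (D.submatrix (fun _ : Fin 1 => i) (fun _ : Fin 1 => j))
    rw [pow_one, mul_comm] at h1
    have h2 := mul_left_cancel₀ (hA ▸ Dl_ne_zero n hn) h1
    rw [Matrix.det_fin_one] at h2
    have h3 : (A.det • D - C * A.adjugate * B) i j =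
        mn (Sum.elim a (fun _ : Fin 1 => b i) ∘ finSumFinEquiv.symm)
          (Sum.elim a (fun _ : Fin 1 => b j) ∘ finSumFinEquiv.symm) := by
      rw [mn_sum]
      refine Eq.trans ?_ (h2.symm.trans ?_)
      · rfl
      · congr 1
        ext (i | i) (j | j) <;> rfl
    rw [h3]
    exact mn_mem _ _
  have h := det_block A B C D
  rw [hM, hA, mul_comm] at h
  rw [h]
  exact Ideal.mul_mem_left _ _ (det_mem_pow _ _ hE)

/-- the upper bound -/
lemma upper [CharZero K] (n q k l : ℕ) (hk : 1 ≤ k) (hl : l ≤ q) (hm : n + q = m) :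
    ∃ f ∈ symbolicPower (symMinors K m (n + 1)) (k * q - l), f ≠ 0 ∧
      MvPolynomial.IsHomogeneous f (k * m - l) := by
  obtain ⟨k, rfl⟩ : ∃ k', k = k' + 1 := ⟨k - 1, by omega⟩
  obtain ⟨p, rfl⟩ : ∃ p, q = l + p := ⟨q - l, by omega⟩
  have hn : n ≤ m := by omega
  have hp : n + p ≤ m := by omega
  refine ⟨Dl K (n + (l + p)) hm.le ^ k * Dl K (n + p) hp, ?_, ?_, ?_⟩
  · rw [mem_symbolicPower_iff _ (prime_symMinors m n)]
    have hpr := prime_symMinors (K := K) m n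
    refine ⟨(Dl K n hn ^ (l + p)) ^ k * Dl K n hn ^ p, ?_, ?_⟩
    · rw [← pow_mul, ← pow_add]
      exact fun h => Dl_notMem n hn (hpr.mem_of_pow_mem _ h)
    · have h1 := Ideal.pow_mem_pow (Dl_mul_mem (K := K) n (l + p) hn hm.le) k
      have h2 := Ideal.mul_mem_mul h1 (Dl_mul_mem (K := K) n p hn hp)
      rw [← pow_mul, ← pow_add] at h2
      have h3 : (k + 1) * (l + p) - l = (l + p) * k + p := by
        have : (k + 1) * (l + p) = (l + p) * k + p + l := by ring
        omega
      rw [h3]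
      convert h2 using 1
      rw [mul_pow]
      ring
  · exact mul_ne_zero (pow_ne_zero _ (Dl_ne_zero _ _)) (Dl_ne_zero _ _)
  · have h1 : (Dl K (n + (l + p)) hm.le).IsHomogeneous _ := mn_homog _ _
    have h2 : (Dl K (n + p) hp).IsHomogeneous _ := mn_homog _ _
    have h3 : (k + 1) * m - l = (n + (l + p)) * k + (n + p) := by
      subst hm
      have : (k + 1) * (n + (l + p)) = (n + (l + p)) * k + (n + p) + l := by ring
      omega
    rw [h3]
    exact (h1.pow k).mul h2

end SymDet
namespace SymDet

open Finset

variable {K : Type*} [Field K] {m : ℕ}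

lemma Psi_equiv {ι ι' : Type*} [Fintype ι] [Fintype ι'] (e : ι ≃ ι') (f : PR K m) :
    rename (Sum.map (Prod.map id e) e) (Psi K m ι f) = Psi K m ι' f := by
  have : (rename (Sum.map (Prod.map id e) e)).comp (Psi K m ι) = Psi K m ι' := by
    apply MvPolynomial.algHom_ext
    intro s
    induction s using Sym2.inductionOn with
    | _ i j =>
    rw [AlgHom.comp_apply, Psi_X, Psi_X, map_sum, ← Equiv.sum_comp e]
    simp
  exact congrArg (fun F => F f) this

lemma ker_Psi_card [CharZero K] (m n : ℕ) (ι : Type*) [Fintype ι] (h : Fintype.card ι = n) :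
    RingHom.ker (Psi K m ι) = symMinors K m (n + 1) := by
  refine le_antisymm ?_ (symMinors_le_ker ι (by omega))
  intro f hf
  rw [← ker_Psi, RingHom.mem_ker, ← Psi_equiv (Fintype.equivFinOfCardEq h), hf, map_zero]

/-- the grading map -/
noncomputable def gr {σ : Type*} (w : σ → ℕ) :
    MvPolynomial σ K →ₐ[K] Polynomial (MvPolynomial σ K) :=
  aeval fun v => Polynomial.C (X v) * Polynomial.X ^ w v

lemma gr_monomial {σ : Type*} (w : σ → ℕ) (a : σ →₀ ℕ) (c : K) :
    gr w (monomial a c) = Polynomial.monomial (Finsupp.weight w a) (monomial a c) := by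
  have h1 : (Polynomial.X : Polynomial (MvPolynomial σ K)) ^ (Finsupp.weight w a) =
      ∏ i ∈ a.support, (Polynomial.X ^ w i) ^ a i := by
    rw [Finsupp.weight_apply, Finsupp.sum, ← Finset.prod_pow_eq_pow_sum]
    refine Finset.prod_congr rfl fun i _ => ?_
    rw [← pow_mul, smul_eq_mul, mul_comm]
  have h2 : Polynomial.C (monomial a c) = Polynomial.C (C c) *
      ∏ i ∈ a.support, (Polynomial.C (X i : MvPolynomial σ K)) ^ a i := by
    rw [monomial_eq, map_mul, Finsupp.prod, map_prod]
    simp only [map_pow]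
  rw [gr, aeval_monomial, ← Polynomial.C_mul_X_pow_eq_monomial, h1, h2, Finsupp.prod, mul_assoc,
    ← Finset.prod_mul_distrib]
  simp only [mul_pow]
  rfl

lemma gr_coeff {σ : Type*} (w : σ → ℕ) (F : MvPolynomial σ K) (a : σ →₀ ℕ) :
    coeff a ((gr w F).coeff (Finsupp.weight w a)) = coeff a F := by
  classical
  induction F using MvPolynomial.induction_on' with
  | add p q hp hq => simp only [map_add, Polynomial.coeff_add, coeff_add, hp, hq]
  | monomial b c =>
    rw [gr_monomial, Polynomial.coeff_monomial]
    by_cases hab : b = a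
    · subst hab; simp
    · rw [coeff_monomial, if_neg hab]
      split_ifs
      · rw [coeff_monomial, if_neg hab]
      · simp

/-- the weight which counts the `z`-variables in `S` -/
noncomputable def wS (S : Finset (Fin m)) : (Fin m × Fin m) ⊕ Fin m → ℕ :=
  Sum.elim (fun _ => 0) (fun k => if k ∈ S then 1 else 0)

lemma gr_eval_zero (S : Finset (Fin m)) (f : PR K m) :
    (gr (wS S) (Psi K m (Fin m) f)).eval 0 =
      rename (Sum.map (Prod.map id (Subtype.val : {k // k ∉ S} → Fin m)) Subtype.val)
        (Psi K m {k // k ∉ S} f) := by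
  have : ((Polynomial.aeval (0 : MvPolynomial ((Fin m × Fin m) ⊕ Fin m) K)).restrictScalars K).comp
      ((gr (wS S)).comp (Psi K m (Fin m))) =
      (rename (Sum.map (Prod.map id (Subtype.val : {k // k ∉ S} → Fin m)) Subtype.val)).comp
        (Psi K m {k // k ∉ S}) := by
    apply MvPolynomial.algHom_ext
    intro s
    induction s using Sym2.inductionOn with
    | _ i j =>
    simp only [AlgHom.comp_apply, Psi_X, map_sum, map_mul, rename_X, Sum.map_inl, Sum.map_inr,
      Prod.map, id]
    rw [← Finset.sum_subtype (s := Sᶜ) (p := fun k => k ∉ S) (by simp)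
      (fun k => (X (Sum.inl (i, k)) * X (Sum.inl (j, k)) * X (Sum.inr k) :
        MvPolynomial ((Fin m × Fin m) ⊕ Fin m) K))]
    rw [← Finset.sum_subset (Finset.subset_univ Sᶜ)]
    · refine Finset.sum_congr rfl fun k hk => ?_
      have hk' : k ∉ S := by simpa using hk
      simp [gr, wS, hk']
    · intro k _ hk
      have hk' : k ∈ S := by simpa using hk
      simp [gr, wS, hk']
  have h := congrArg (fun F => F f) this
  simpa [Polynomial.coe_aeval_eq_eval] using h

lemma dvd_iff [CharZero K] {n : ℕ} (S : Finset (Fin m)) (hS : S.card + n = m) (f : PR K m) :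
    Polynomial.X ∣ gr (wS S) (Psi K m (Fin m) f) ↔ f ∈ symMinors K m (n + 1) := by
  rw [Polynomial.X_dvd_iff, Polynomial.coeff_zero_eq_eval_zero, gr_eval_zero,
    ← ker_Psi_card m n {k // k ∉ S} (by
      rw [Fintype.card_subtype_compl]; simp; omega), RingHom.mem_ker]
  rw [map_eq_zero_iff]
  apply rename_injective
  exact Sum.map_injective.2 ⟨Function.Injective.prodMap Function.injective_id
    Subtype.val_injective, Subtype.val_injective⟩

lemma weight_ge [CharZero K] {n s : ℕ} (S : Finset (Fin m)) (hS : S.card + n = m) (f : PR K m)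
    (hf : f ∈ symbolicPower (symMinors K m (n + 1)) s) (a) (ha : coeff a (Psi K m (Fin m) f) ≠ 0) :
    s ≤ Finsupp.weight (wS S) a := by
  rw [mem_symbolicPower_iff _ (prime_symMinors m n)] at hf
  obtain ⟨u, hu, huf⟩ := hf
  rw [← dvd_iff S hS] at hu
  let Φ : PR K m →ₐ[K] _ := (gr (wS S)).comp (Psi K m (Fin m))
  have h1 : symMinors K m (n + 1) ≤ Ideal.comap Φ (Ideal.span {Polynomial.X}) := by
    intro g hg
    rw [Ideal.mem_comap, Ideal.mem_span_singleton]
    exact (dvd_iff S hS g).2 hg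
  have h2 := Ideal.le_comap_pow Φ s (Ideal.pow_right_mono h1 s huf)
  rw [Ideal.mem_comap, Ideal.span_singleton_pow, Ideal.mem_span_singleton, map_mul] at h2
  have h3 := Polynomial.prime_X.pow_dvd_of_dvd_mul_left s hu h2
  rw [Polynomial.X_pow_dvd_iff] at h3
  by_contra hlt
  push Not at hlt
  apply ha
  rw [← gr_coeff (wS S)]
  have := h3 _ hlt
  change (gr (wS S) (Psi K m (Fin m) f)).coeff _ = 0 at this
  rw [this, coeff_zero]

lemma weight_wS (S : Finset (Fin m)) (a) :
    Finsupp.weight (wS S) a = ∑ k ∈ S, a (Sum.inr k) := by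
  rw [Finsupp.weight_apply, Finsupp.sum_fintype _ _ (by simp), Fintype.sum_sum_type]
  simp [wS]

lemma Psi_homog {f : PR K m} {d : ℕ} (hf : f.IsHomogeneous d) :
    IsWeightedHomogeneous (wS Finset.univ) (Psi K m (Fin m) f) d := by
  have hX : ∀ e, IsWeightedHomogeneous (wS Finset.univ) (PsiX K m (Fin m) e) 1 := by
    intro e
    induction e using Sym2.inductionOn with
    | _ i j =>
    rw [PsiX_mk]
    refine IsWeightedHomogeneous.sum _ _ _ fun k _ => ?_
    have := ((isWeightedHomogeneous_X K (wS (Finset.univ)) (Sum.inl (i, k))).mul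
      (isWeightedHomogeneous_X K (wS (Finset.univ)) (Sum.inl (j, k)))).mul
      (isWeightedHomogeneous_X K (wS (Finset.univ)) (Sum.inr k))
    simpa [wS] using this
  rw [Psi, aeval_def, eval₂_eq']
  refine IsWeightedHomogeneous.sum _ _ _ fun a ha => ?_
  have h1 : IsWeightedHomogeneous (wS Finset.univ) (∏ e, PsiX K m (Fin m) e ^ a e) (∑ e, a e • 1) :=
    IsWeightedHomogeneous.prod _ _ _ fun e _ => (hX e).pow _
  have h2 : ∑ e, a e • 1 = d := by
    have := hf (mem_support_iff.1 ha)
    rw [← this, Finsupp.weight_apply, Finsupp.sum_fintype _ _ (by simp)]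
    simp
  rw [h2] at h1
  have h3 := (isWeightedHomogeneous_C (wS (m := m) Finset.univ) (coeff a f)).mul h1
  rwa [zero_add] at h3

lemma Psi_injective [CharZero K] (f : PR K m) (hf : Psi K m (Fin m) f = 0) : f = 0 := by
  have h : f ∈ symMinors K m (m + 1) := by rw [← ker_Psi]; exact hf
  have h2 : symMinors K m (m + 1) = ⊥ := by
    rw [symMinors, Ideal.span_eq_bot]
    rintro _ ⟨r, c, hr, -, -⟩
    have := Fintype.card_le_of_injective r hr
    simp at this
  rw [h2] at h
  simpa using h

lemma exists_min (a : Fin m → ℕ) (q : ℕ) (hq : q ≤ m) :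
    ∃ S : Finset (Fin m), S.card = q ∧ ∀ i ∈ S, ∀ j ∉ S, a i ≤ a j := by
  induction q with
  | zero => exact ⟨∅, by simp⟩
  | succ q ih =>
    obtain ⟨S, hS, h⟩ := ih (by omega)
    have hne : Sᶜ.Nonempty := by
      rw [← Finset.card_pos, Finset.card_compl, Fintype.card_fin]; omega
    obtain ⟨x, hx, hmin⟩ := Finset.exists_min_image Sᶜ a hne
    rw [Finset.mem_compl] at hx
    refine ⟨insert x S, by rw [Finset.card_insert_of_notMem hx, hS], ?_⟩
    intro i hi j hj
    rw [Finset.mem_insert, not_or] at hj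
    rcases Finset.mem_insert.1 hi with rfl | hi
    · exact hmin j (by simpa using hj.2)
    · exact h i hi j hj.2

lemma lower [CharZero K] (n q k l d : ℕ) (hk : 1 ≤ k) (hl : l < q) (hm : n + q = m)
    (f : PR K m) (hf : f ∈ symbolicPower (symMinors K m (n + 1)) (k * q - l)) (h0 : f ≠ 0)
    (hd : f.IsHomogeneous d) : k * m - l ≤ d := by
  have hP : Psi K m (Fin m) f ≠ 0 := fun h => h0 (Psi_injective f h)
  obtain ⟨a, ha⟩ := exists_coeff_ne_zero hP
  have h1 := Psi_homog hd ha
  rw [weight_wS] at h1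
  obtain ⟨S, hS, hmin⟩ := exists_min (fun k => a (Sum.inr k)) q (by omega)
  have h2 := weight_ge S (by omega) f hf a ha
  rw [weight_wS] at h2
  have hex : ∃ i ∈ S, k ≤ a (Sum.inr i) := by
    by_contra hcon
    push Not at hcon
    have h3 : ∑ i ∈ S, a (Sum.inr i) ≤ ∑ i ∈ S, (k - 1) :=
      Finset.sum_le_sum fun i hi => by have := hcon i hi; omega
    rw [Finset.sum_const, hS, smul_eq_mul] at h3
    obtain ⟨k, rfl⟩ : ∃ k', k = k' + 1 := ⟨k - 1, by omega⟩
    have : (k + 1) * q = q * k + q := by ring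
    simp only [Nat.add_sub_cancel] at h3
    omega
  obtain ⟨i, hi, hki⟩ := hex
  have h4 : ∑ j ∈ Sᶜ, k ≤ ∑ j ∈ Sᶜ, a (Sum.inr j) :=
    Finset.sum_le_sum fun j hj => hki.trans (hmin i hi j (by simpa using hj))
  rw [Finset.sum_const, Finset.card_compl, Fintype.card_fin, hS, smul_eq_mul] at h4
  rw [← Finset.sum_add_sum_compl S] at h1
  have h5 : m - q = n := by omega
  rw [h5] at h4
  have h6 : k * m = k * q + n * k := by rw [← hm]; ring
  omega

end SymDet
namespace SymDet

lemma alpha_eq {K : Type*} [Field K] [CharZero K] (n q k l : ℕ) (hk : 1 ≤ k) (hl : l < q) :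
    alphaDeg (symbolicPower (symMinors K (n + q) (n + 1)) (k * q - l)) = k * (n + q) - l := by
  unfold alphaDeg
  apply le_antisymm
  · exact Nat.sInf_le (upper n q k l hk hl.le rfl)
  · refine le_csInf ⟨_, upper n q k l hk hl.le rfl⟩ ?_
    rintro d ⟨f, hf, h0, hd⟩
    exact lower n q k l d hk hl rfl f hf h0 hd

lemma alpha_lim {K : Type*} [Field K] [CharZero K] (n q : ℕ) (hq : 0 < q) :
    Tendsto (fun s : ℕ => (alphaDeg (symbolicPower (symMinors K (n + q) (n + 1)) s) : ℝ) / s)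
      atTop (nhds (((n + q : ℕ) : ℝ) / q)) := by
  have hq' : (0 : ℝ) < q := by exact_mod_cast hq
  have key : ∀ s : ℕ, 1 ≤ s → ∃ k : ℕ, s ≤ k * q ∧ k * q < s + q ∧
      alphaDeg (symbolicPower (symMinors K (n + q) (n + 1)) s) = s + n * k := by
    intro s hs
    obtain ⟨k, hk1, hk2⟩ : ∃ k : ℕ, s ≤ k * q ∧ k * q < s + q := by
      refine ⟨(s + q - 1) / q, ?_, ?_⟩
      · have h1 := Nat.div_add_mod (s + q - 1) q
        have h2 := Nat.mod_lt (s + q - 1) hq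
        rw [mul_comm]; omega
      · have := Nat.div_mul_le_self (s + q - 1) q
        omega
    have hk : 1 ≤ k := by
      rcases Nat.eq_zero_or_pos k with rfl | h
      · omega
      · exact h
    refine ⟨k, hk1, hk2, ?_⟩
    have h := alpha_eq (K := K) n q k (k * q - s) hk (by omega)
    have h1 : k * q - (k * q - s) = s := by omega
    rw [h1] at h
    rw [h]
    have : k * (n + q) = n * k + k * q := by ring
    omega
  have hbd : ∀ᶠ s : ℕ in atTop,
      ((n + q : ℕ) : ℝ) / q ≤ (alphaDeg (symbolicPower (symMinors K (n + q) (n + 1)) s) : ℝ) / s ∧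
      (alphaDeg (symbolicPower (symMinors K (n + q) (n + 1)) s) : ℝ) / s ≤
        ((n + q : ℕ) : ℝ) / q + (n : ℝ) / s := by
    filter_upwards [eventually_ge_atTop 1] with s hs
    obtain ⟨k, h1, h2, h3⟩ := key s hs
    rw [h3]
    have hs' : (0 : ℝ) < s := by exact_mod_cast hs
    have h1' : (s : ℝ) ≤ k * q := by exact_mod_cast h1
    have h2' : (k * q : ℝ) ≤ s + q := by exact_mod_cast h2.le
    have hn : (0 : ℝ) ≤ n := Nat.cast_nonneg n
    push_cast
    constructor
    · rw [div_le_div_iff₀ hq' hs']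
      nlinarith [mul_le_mul_of_nonneg_left h1' hn]
    · rw [div_add_div _ _ hq'.ne' hs'.ne', div_le_div_iff₀ hs' (mul_pos hq' hs')]
      have := mul_le_mul_of_nonneg_left (mul_le_mul_of_nonneg_left h2' hn) hs'.le
      nlinarith
  have hlim : Tendsto (fun s : ℕ => ((n + q : ℕ) : ℝ) / q + (n : ℝ) / s) atTop
      (nhds (((n + q : ℕ) : ℝ) / q)) := by
    have := (tendsto_const_div_atTop_nhds_zero_nat (n : ℝ)).const_add (((n + q : ℕ) : ℝ) / q)
    simpa using this
  exact tendsto_of_tendsto_of_tendsto_of_le_of_le' tendsto_const_nhds hlim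
    (hbd.mono fun s h => h.1) (hbd.mono fun s h => h.2)

end SymDet

/-- Theorem 4.4(1): for the generic symmetric determinantal ideal `I_t(Y)`,
`α(I_t(Y)^{(k(m-t+1)-l)}) = km - l` for `k ≥ 1` and `0 ≤ l ≤ m - t`, and the Waldschmidt
constant of `I_t(Y)` equals `m/(m-t+1)`. -/
theorem symmetric_determinantal_alpha_waldschmidt {K : Type*} [Field K] [CharZero K]
    (m t : ℕ) (ht1 : 1 ≤ t) (htm : t ≤ m) :
    (∀ k l : ℕ, 1 ≤ k → l ≤ m - t →
      alphaDeg (symbolicPower (symMinors K m t) (k * (m - t + 1) - l)) = k * m - l) ∧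
    Tendsto (fun s : ℕ => (alphaDeg (symbolicPower (symMinors K m t) s) : ℝ) / s)
      atTop (nhds ((m : ℝ) / ((m : ℝ) - t + 1))) := by
  obtain ⟨n, rfl⟩ : ∃ n, t = n + 1 := ⟨t - 1, by omega⟩
  obtain ⟨q, rfl⟩ : ∃ q, m = n + q := ⟨m - n, by omega⟩
  have hq : 0 < q := by omega
  have h1 : n + q - (n + 1) + 1 = q := by omega
  rw [h1]
  refine ⟨fun k l hk hl => SymDet.alpha_eq n q k l hk (by omega), ?_⟩
  have h2 : ((n + q : ℕ) : ℝ) - ((n + 1 : ℕ) : ℝ) + 1 = q := by push_cast; ring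
  rw [h2]
  exact SymDet.alpha_lim n q hq
end

section
/- Let k be a field of characteristic zero, Y = (y_{ij}) an m×m generic symmetric matrix of indeterminates (so y_{ij} = y_{ji}, with the y_{ij} for i ≤ j independent indeterminates), R = k[y_{ij} : 1 ≤ i ≤ j ≤ m], and I_t(Y) the ideal generated by all t×t minors of Y, 1 ≤ t ≤ m. Then the asymptotic resurgence of I_t(Y) equals α(I_t(Y))/α̂(I_t(Y)) = t(m−t+1)/m; that is, sup{ s/r : s, r positive integers, I_t(Y)^{(sT)} ⊄ I_t(Y)^{rT} for all sufficiently large T } = t(m−t+1)/m. -/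
open MvPolynomial Filter

/-- The asymptotic resurgence `ρ̂(I) = sup { s/r : I⁽ˢᵀ⁾ ⊄ Iʳᵀ for all T ≫ 0 }`. -/
noncomputable def asympResurgence {R : Type*} [CommRing R] (I : Ideal R) : ℝ :=
  sSup {x : ℝ | ∃ s r : ℕ, 0 < s ∧ 0 < r ∧ x = (s : ℝ) / r ∧
    ∀ᶠ T in atTop, ¬ symbolicPower I (s * T) ≤ I ^ (r * T)}

/-- A minor with arbitrary row and column selections. -/
noncomputable def mnr (K : Type*) [Field K] {m n : ℕ} (r c : Fin n → Fin m) :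
    MvPolynomial (Sym2 (Fin m)) K :=
  Matrix.det (Matrix.of fun i j =>
      (MvPolynomial.X (Sym2.mk (r i) (c j)) : MvPolynomial (Sym2 (Fin m)) K))

lemma mnr_mem (K : Type*) [Field K] {m n : ℕ} (r c : Fin n → Fin m) :
    mnr K r c ∈ symMinors K m n := by
  by_cases hr : Function.Injective r
  · by_cases hc : Function.Injective c
    · exact Ideal.subset_span ⟨r, c, hr, hc, rfl⟩
    · simp only [Function.Injective, not_forall] at hc
      obtain ⟨a, b, hab, hne⟩ := hc
      have : mnr K r c = 0 := Matrix.det_zero_of_column_eq hne (by intro k; simp [hab])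
      rw [this]; exact Ideal.zero_mem _
  · simp only [Function.Injective, not_forall] at hr
    obtain ⟨a, b, hab, hne⟩ := hr
    have : mnr K r c = 0 := Matrix.det_zero_of_row_eq hne (by funext k; simp [hab])
    rw [this]; exact Ideal.zero_mem _

/-- The polarization derivation `y_{ab} ↦ [a=i] y_{jb} + [b=i] y_{aj}`. -/
noncomputable def ED (K : Type*) [Field K] {m : ℕ} (i j : Fin m) :
    Derivation K (MvPolynomial (Sym2 (Fin m)) K) (MvPolynomial (Sym2 (Fin m)) K) :=
  mkDerivation K (Sym2.lift ⟨fun a b => (if a = i then X s(j, b) else 0) +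
    (if b = i then X s(a, j) else 0), by
      intro a b
      beta_reduce
      rw [add_comm, Sym2.eq_swap (a := a), Sym2.eq_swap (a := j) (b := b)]⟩)

lemma ED_X (K : Type*) [Field K] {m : ℕ} (i j a b : Fin m) :
    ED K i j (X s(a, b)) = (if a = i then X s(j, b) else 0) + (if b = i then X s(a, j) else 0) := by
  simp [ED]

/-- Leibniz rule for a product. -/
lemma deriv_prod {K A : Type*} [CommRing K] [CommRing A] [Algebra K A] (D : Derivation K A A)
    {ι : Type*} [DecidableEq ι] (s : Finset ι) (f : ι → A) :
    D (∏ i ∈ s, f i) = ∑ i ∈ s, ∏ k ∈ s, (if k = i then D (f k) else f k) := by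
  induction s using Finset.induction_on with
  | empty => simp
  | insert a s ha ih =>
    rw [Finset.prod_insert ha, D.leibniz, ih, Finset.sum_insert ha, Finset.prod_insert ha]
    simp only [if_true, smul_eq_mul]
    rw [add_comm]
    congr 1
    · rw [mul_comm]
      congr 1
      apply Finset.prod_congr rfl
      intro k hk
      rw [if_neg]; rintro rfl; exact ha hk
    · rw [Finset.mul_sum]
      apply Finset.sum_congr rfl
      intro i hi
      rw [Finset.prod_insert ha, if_neg]
      rintro rfl; exact ha hi

/-- Derivation of a determinant, row by row. -/
lemma deriv_det {K A : Type*} [CommRing K] [CommRing A] [Algebra K A] (D : Derivation K A A)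
    {n : ℕ} (M : Matrix (Fin n) (Fin n) A) :
    D M.det = ∑ p, (M.updateCol p (fun q => D (M q p))).det := by
  simp only [Matrix.det_apply, map_sum]
  rw [Finset.sum_comm]
  apply Finset.sum_congr rfl
  intro σ _
  have : D (Equiv.Perm.sign σ • ∏ i, M (σ i) i) = Equiv.Perm.sign σ • D (∏ i, M (σ i) i) := by
    rcases Int.units_eq_one_or (Equiv.Perm.sign σ) with h | h <;> simp [h]
  rw [this, deriv_prod, Finset.smul_sum]
  apply Finset.sum_congr rfl
  intro p _
  congr 1
  apply Finset.prod_congr rfl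
  intro k _
  by_cases h : k = p
  · subst h; simp
  · simp [h]

lemma ED_mnr (K : Type*) [Field K] {m n : ℕ} (i j : Fin m) (r c : Fin n → Fin m) :
    ED K i j (mnr K r c) = (∑ p, if r p = i then mnr K (Function.update r p j) c else 0) +
      ∑ p, if c p = i then mnr K r (Function.update c p j) else 0 := by
  classical
  have key : ED K i j (mnr K r c) =
      (∑ p, (Matrix.updateRow (Matrix.of fun a b => (X s(r a, c b) : MvPolynomial (Sym2 (Fin m)) K))
        p (fun q => if r p = i then X s(j, c q) else 0)).det) +
      ∑ p, (Matrix.updateCol (Matrix.of fun a b => (X s(r a, c b) : MvPolynomial (Sym2 (Fin m)) K))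
        p (fun q => if c p = i then X s(r q, j) else 0)).det := by
    have h1 : ∀ p, (Matrix.updateCol (Matrix.of fun a b => (X s(r a, c b) : MvPolynomial (Sym2 (Fin m)) K))
        p (fun q => ED K i j (X s(r q, c p)))).det =
        (Matrix.updateCol (Matrix.of fun a b => (X s(r a, c b) : MvPolynomial (Sym2 (Fin m)) K))
        p (fun q => if r q = i then X s(j, c p) else 0)).det +
        (Matrix.updateCol (Matrix.of fun a b => (X s(r a, c b) : MvPolynomial (Sym2 (Fin m)) K))
        p (fun q => if c p = i then X s(r q, j) else 0)).det := by
      intro p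
      rw [← Matrix.det_updateCol_add]
      congr 2
      funext q
      simp [ED_X]
    unfold mnr
    rw [deriv_det]
    simp only [Matrix.of_apply, h1]
    rw [Finset.sum_add_distrib]
    congr 1
    -- exchange rows and columns
    simp only [Matrix.det_apply]
    rw [Finset.sum_comm]
    conv_rhs => rw [Finset.sum_comm]
    apply Finset.sum_congr rfl
    intro σ _
    conv_rhs => rw [← Equiv.sum_comp σ]
    apply Finset.sum_congr rfl
    intro p _
    congr 1
    apply Finset.prod_congr rfl
    intro k _
    by_cases h : k = p
    · subst h; simp
    · rw [Matrix.updateCol_ne h, Matrix.updateRow_ne (by simpa using h)]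
  rw [key]
  congr 1
  · apply Finset.sum_congr rfl
    intro p _
    split_ifs with h
    · unfold mnr
      congr 1
      ext1 a b
      by_cases ha : a = p
      · subst ha; simp
      · simp [Matrix.updateRow_ne ha, Function.update_of_ne ha]
    · exact Matrix.det_eq_zero_of_row_eq_zero p (by simp)
  · apply Finset.sum_congr rfl
    intro p _
    split_ifs with h
    · unfold mnr
      congr 1
      ext1 a b
      by_cases ha : b = p
      · subst ha; simp
      · simp [Matrix.updateCol_ne ha, Function.update_of_ne ha]
    · exact Matrix.det_eq_zero_of_column_eq_zero p (by simp)

/-- An ideal is stable under a derivation if its generators are mapped into it. -/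
lemma deriv_span {K A : Type*} [CommRing K] [CommRing A] [Algebra K A] (D : Derivation K A A)
    (S : Set A) (h : ∀ x ∈ S, D x ∈ Ideal.span S) : ∀ x ∈ Ideal.span S, D x ∈ Ideal.span S := by
  intro x hx
  induction hx using Submodule.span_induction with
  | mem x hx => exact h x hx
  | zero => simp
  | add x y _ _ hx hy => rw [map_add]; exact Ideal.add_mem _ hx hy
  | smul a x hx' hx =>
    rw [smul_eq_mul, D.leibniz]
    exact Ideal.add_mem _ (Ideal.mul_mem_left _ _ hx) (by
      rw [smul_eq_mul]; exact Ideal.mul_mem_right _ _ hx')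

lemma deriv_pow_ideal {K A : Type*} [CommRing K] [CommRing A] [Algebra K A] (D : Derivation K A A)
    (I : Ideal A) (h : ∀ x ∈ I, D x ∈ I) (n : ℕ) : ∀ x ∈ I ^ n, D x ∈ I ^ n := by
  induction n with
  | zero => simp
  | succ n ih =>
    intro x hx
    rw [pow_succ] at hx ⊢
    induction hx using Submodule.mul_induction_on' with
    | mem_mul_mem a ha b hb =>
      rw [D.leibniz]
      refine Ideal.add_mem _ (Ideal.mul_mem_mul ha (h b hb)) ?_
      rw [smul_eq_mul, mul_comm (I ^ n)]
      exact Ideal.mul_mem_mul hb (ih a ha)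
    | add x _ y _ hx hy => rw [map_add]; exact Ideal.add_mem _ hx hy

lemma ED_symMinors (K : Type*) [Field K] {m n : ℕ} (i j : Fin m) :
    ∀ x ∈ symMinors K m n, ED K i j x ∈ symMinors K m n := by
  apply deriv_span
  rintro x ⟨r, c, -, -, rfl⟩
  change ED K i j (mnr K r c) ∈ symMinors K m n
  rw [ED_mnr]
  refine Ideal.add_mem _ (Ideal.sum_mem _ ?_) (Ideal.sum_mem _ ?_)
  · intro p _
    split_ifs
    · exact mnr_mem K _ _
    · simp
  · intro p _
    split_ifs
    · exact mnr_mem K _ _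
    · simp

/-- Weight of a variable in the Fischer form. -/
noncomputable def cw {m : ℕ} (e : Sym2 (Fin m)) : ℚ := if e.IsDiag then 2 else 1

lemma cw_pos {m : ℕ} (e : Sym2 (Fin m)) : 0 < cw e := by
  unfold cw; split_ifs <;> norm_num

/-- Weight of a monomial in the Fischer form. -/
noncomputable def wgt {m : ℕ} (a : Sym2 (Fin m) →₀ ℕ) : ℚ :=
  ∏ e, ((a e).factorial : ℚ) * cw e ^ (a e)

lemma wgt_pos {m : ℕ} (a : Sym2 (Fin m) →₀ ℕ) : 0 < wgt a :=
  Finset.prod_pos fun e _ => mul_pos (by exact_mod_cast Nat.factorial_pos _) (pow_pos (cw_pos e) _)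

lemma wgt_add_single {m : ℕ} (a : Sym2 (Fin m) →₀ ℕ) (e : Sym2 (Fin m)) :
    wgt (a + Finsupp.single e 1) = wgt a * (cw e * (a e + 1)) := by
  classical
  unfold wgt
  rw [← Finset.mul_prod_erase _ _ (Finset.mem_univ e),
    ← Finset.mul_prod_erase (a := e) _ _ (Finset.mem_univ e)]
  have : ∀ x ∈ Finset.univ.erase e, (((a + Finsupp.single e 1 : Sym2 (Fin m) →₀ ℕ) x).factorial : ℚ) *
      cw x ^ ((a + Finsupp.single e 1 : Sym2 (Fin m) →₀ ℕ) x) = ((a x).factorial : ℚ) * cw x ^ (a x) := by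
    intro x hx
    have : x ≠ e := Finset.ne_of_mem_erase hx
    simp [this.symm]
  rw [Finset.prod_congr rfl this]
  simp only [Finsupp.add_apply, Finsupp.single_eq_same, Nat.factorial_succ, pow_succ]
  push_cast
  ring

/-- The Fischer form. -/
noncomputable def fis (m : ℕ) : MvPolynomial (Sym2 (Fin m)) ℚ →ₗ[ℚ]
    MvPolynomial (Sym2 (Fin m)) ℚ →ₗ[ℚ] ℚ :=
  (basisMonomials (Sym2 (Fin m)) ℚ).constr ℚ (fun a => wgt a • lcoeff ℚ a)

lemma fis_monomial {m : ℕ} (a : Sym2 (Fin m) →₀ ℕ) (r : ℚ) (g : MvPolynomial (Sym2 (Fin m)) ℚ) :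
    fis m (monomial a r) g = r * (wgt a * coeff a g) := by
  have : monomial a r = r • (basisMonomials (Sym2 (Fin m)) ℚ a) := by
    simp [smul_monomial]
  rw [this, map_smul, fis, Module.Basis.constr_basis]
  simp

lemma fis_symm {m : ℕ} (f g : MvPolynomial (Sym2 (Fin m)) ℚ) : fis m f g = fis m g f := by
  classical
  induction f using MvPolynomial.induction_on' with
  | add p q hp hq => simp [hp, hq]
  | monomial a r =>
    induction g using MvPolynomial.induction_on' with
    | add p q hp hq => simp [hp, hq]
    | monomial b s =>
      rw [fis_monomial, fis_monomial, coeff_monomial, coeff_monomial]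
      by_cases h : a = b
      · subst h; simp; ring
      · simp [h, Ne.symm h]

lemma fis_pos {m : ℕ} (f : MvPolynomial (Sym2 (Fin m)) ℚ) (h : fis m f f = 0) : f = 0 := by
  have key : ∀ g, fis m f g = ∑ a ∈ f.support, coeff a f * (wgt a * coeff a g) := by
    intro g
    conv_lhs => rw [f.as_sum, map_sum, LinearMap.sum_apply]
    simp only [fis_monomial]
  rw [key] at h
  have := (Finset.sum_eq_zero_iff_of_nonneg (by
    intro a _
    have := (wgt_pos a).le
    have h2 := mul_self_nonneg (coeff a f)
    nlinarith [mul_nonneg this h2])).1 h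
  ext a
  by_cases ha : a ∈ f.support
  · have h3 := this a ha
    have := (wgt_pos a).ne'
    simpa [this] using h3
  · simpa using ha

lemma fis_X {m : ℕ} (e : Sym2 (Fin m)) (f g : MvPolynomial (Sym2 (Fin m)) ℚ) :
    fis m (X e * f) g = fis m f (cw e • pderiv e g) := by
  induction f using MvPolynomial.induction_on' with
  | add p q hp hq => rw [mul_add, map_add, LinearMap.add_apply, hp, hq, map_add, LinearMap.add_apply]
  | monomial a r =>
    have : X e * monomial a r = monomial (a + Finsupp.single e 1) r := by
      rw [X, monomial_mul, one_mul, add_comm]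
    rw [this, fis_monomial, fis_monomial, wgt_add_single, coeff_smul, coeff_pderiv]
    simp only [smul_eq_mul]
    ring

lemma der_sum {K A ι : Type*} [CommRing K] [CommRing A] [Algebra K A] (s : Finset ι)
    (D : ι → Derivation K A A) (x : A) : (∑ k ∈ s, D k) x = ∑ k ∈ s, D k x := by
  classical
  induction s using Finset.induction_on with
  | empty => simp
  | insert a s ha ih => rw [Finset.sum_insert ha, Finset.sum_insert ha, Derivation.add_apply, ih]

lemma ED_eq {m : ℕ} (i j : Fin m) (f : MvPolynomial (Sym2 (Fin m)) ℚ) :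
    ED ℚ i j f = ∑ k, X s(j, k) * (cw s(i, k) • pderiv s(i, k) f) := by
  classical
  have : ED ℚ i j = ∑ k, (X s(j, k) : MvPolynomial (Sym2 (Fin m)) ℚ) •
      (cw s(i, k) • pderiv s(i, k)) := by
    apply derivation_ext
    intro e
    induction e using Sym2.ind with
    | _ a b =>
    rw [ED_X, der_sum]
    simp only [Derivation.smul_apply, pderiv_X, smul_eq_mul]
    by_cases ha : a = i
    · subst ha
      rw [Finset.sum_eq_single b]
      · by_cases hb : b = a
        · subst hb
          simp only [if_true, cw, Sym2.eq_swap (a := j), Sym2.mk_isDiag_iff, Pi.single_eq_same]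
          rw [← two_mul, mul_comm]
          congr 1
          rw [Algebra.smul_def, mul_one]; rfl
        · simp [hb, cw, Ne.symm hb]
      · intro k _ hk
        have : s(a, k) ≠ s(a, b) := by
          rintro h; apply hk; simp at h; rcases h with h | ⟨h, h'⟩ <;> simp_all
        simp [Ne.symm this]
      · simp
    · by_cases hb : b = i
      · subst hb
        rw [Finset.sum_eq_single a]
        · have : s(a, b) = s(b, a) := Sym2.eq_swap
          simp [ha, cw, Ne.symm ha, this, Sym2.eq_swap (a := a) (b := j)]
        · intro k _ hk
          have : s(b, k) ≠ s(a, b) := by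
            rintro h; apply hk; rw [Sym2.eq_swap (a := a)] at h; simp at h; tauto
          simp [Ne.symm this]
        · simp
      · rw [Finset.sum_eq_zero]
        · simp [ha, hb]
        · intro k _
          have : s(i, k) ≠ s(a, b) := by
            rintro h; simp at h; rcases h with h | h <;> simp_all
          simp [Ne.symm this]
  rw [this, der_sum]
  simp

lemma fis_ED {m : ℕ} (i j : Fin m) (f g : MvPolynomial (Sym2 (Fin m)) ℚ) :
    fis m (ED ℚ i j f) g = fis m f (ED ℚ j i g) := by
  rw [ED_eq, ED_eq, map_sum, map_sum, LinearMap.sum_apply]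
  apply Finset.sum_congr rfl
  intro k _
  rw [fis_X, fis_symm, fis_symm f, fis_X, map_smul]


/-- Orthogonal projection. -/
lemma fis_proj {m : ℕ} (W : Submodule ℚ (MvPolynomial (Sym2 (Fin m)) ℚ)) [Module.Finite ℚ W]
    (x : MvPolynomial (Sym2 (Fin m)) ℚ) : ∃ w ∈ W, ∀ u ∈ W, fis m (x - w) u = 0 := by
  let L : W →ₗ[ℚ] Module.Dual ℚ W := (fis m).compl₁₂ W.subtype W.subtype
  have hL : Function.Injective L := by
    rw [← LinearMap.ker_eq_bot, LinearMap.ker_eq_bot']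
    intro w hw
    have : L w w = 0 := by rw [hw]; rfl
    exact Subtype.ext (fis_pos _ this)
  have hs : Function.Surjective L :=
    (LinearMap.injective_iff_surjective_of_finrank_eq_finrank
      (Subspace.dual_finrank_eq).symm).1 hL
  obtain ⟨w, hw⟩ := hs ((fis m x).comp W.subtype)
  refine ⟨w, w.2, fun u hu => ?_⟩
  have := LinearMap.congr_fun hw ⟨u, hu⟩
  rw [map_sub, LinearMap.sub_apply, sub_eq_zero]
  exact this.symm

lemma ED_degree {m : ℕ} (i j : Fin m) (d : ℕ) (f : MvPolynomial (Sym2 (Fin m)) ℚ)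
    (hf : f ∈ restrictTotalDegree (Sym2 (Fin m)) ℚ d) :
    ED ℚ i j f ∈ restrictTotalDegree (Sym2 (Fin m)) ℚ d := by
  classical
  rw [ED_eq]
  refine Submodule.sum_mem _ fun k _ => ?_
  rw [mul_smul_comm]
  refine Submodule.smul_mem _ _ ?_
  rw [mem_restrictTotalDegree] at hf ⊢
  rw [totalDegree, Finset.sup_le_iff]
  intro b hb
  rw [mem_support_iff, coeff_X_mul'] at hb
  split_ifs at hb with h
  · rw [coeff_pderiv] at hb
    have h1 := left_ne_zero_of_mul hb
    have h2 := le_totalDegree (mem_support_iff.2 h1)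
    refine le_trans ?_ (h2.trans hf)
    have h3 : b = b - Finsupp.single s(j,k) 1 + Finsupp.single s(j,k) 1 := by
      rw [tsub_add_cancel_of_le]
      simpa [Nat.one_le_iff_ne_zero] using h
    have h4 : ∀ u v : Sym2 (Fin m) →₀ ℕ, ((u+v).sum fun _ e => e) =
        (u.sum fun _ e => e) + v.sum fun _ e => e := fun u v =>
      Finsupp.sum_add_index' (by simp) (by simp)
    conv_lhs => rw [h3]
    rw [h4, h4]; simp
  · exact absurd rfl hb

/-- The weight of a monomial. -/
def wtm {m : ℕ} (i : Fin m) (a : Sym2 (Fin m) →₀ ℕ) : ℕ :=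
  ∑ k, (if i = k then 2 else 1) * a s(i, k)

lemma coeff_X_pderiv {m : ℕ} (e : Sym2 (Fin m)) (f : MvPolynomial (Sym2 (Fin m)) ℚ)
    (a : Sym2 (Fin m) →₀ ℕ) : coeff a (X e * pderiv e f) = a e * coeff a f := by
  classical
  rw [coeff_X_mul']
  split_ifs with h
  · have h1 : 1 ≤ a e := by simpa [Nat.one_le_iff_ne_zero] using h
    rw [coeff_pderiv, tsub_add_cancel_of_le (by simpa using h1)]
    rw [Finsupp.tsub_apply, Finsupp.single_eq_same]
    push_cast [Nat.cast_sub h1]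
    ring
  · simp at h; simp [h]

lemma coeff_ED_diag {m : ℕ} (i : Fin m) (f : MvPolynomial (Sym2 (Fin m)) ℚ)
    (a : Sym2 (Fin m) →₀ ℕ) : coeff a (ED ℚ i i f) = wtm i a * coeff a f := by
  rw [ED_eq, coeff_sum, wtm]
  push_cast
  rw [Finset.sum_mul]
  apply Finset.sum_congr rfl
  intro k _
  rw [mul_smul_comm, coeff_smul, coeff_X_pderiv, cw, smul_eq_mul, mul_assoc]
  simp

lemma ED_comm {m : ℕ} (k i j : Fin m) (f : MvPolynomial (Sym2 (Fin m)) ℚ) :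
    ED ℚ k k (ED ℚ i j f) = ED ℚ i j (ED ℚ k k f) +
      (((if k = j then 1 else 0) - (if k = i then 1 else 0) : ℚ)) • ED ℚ i j f := by
  have : ⁅ED ℚ k k, ED ℚ i j⁆ =
      (((if k = j then 1 else 0) - (if k = i then 1 else 0) : ℚ)) • ED ℚ i j := by
    apply derivation_ext
    intro e
    induction e using Sym2.ind with
    | _ a b =>
    rw [Derivation.commutator_apply, Derivation.smul_apply]
    have hX : ∀ c d : Fin m, ED ℚ k k (X s(c, d)) =
      ((if c = k then 1 else 0) + (if d = k then 1 else 0) : ℚ) • X s(c, d) := by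
      intro c d
      rw [ED_X, add_smul]
      congr 1 <;> split_ifs with h <;> simp [h]
    rw [hX, Derivation.map_smul, ED_X, map_add, apply_ite (ED ℚ k k), apply_ite (ED ℚ k k), map_zero,
      hX, hX]
    have e1 : ∀ (p : Prop) [Decidable p] (x : MvPolynomial (Sym2 (Fin m)) ℚ),
      (if p then x else 0) = (if p then (1:ℚ) else 0) • x := by
      intro p _ x; split_ifs <;> simp
    rw [e1 (a = i), e1 (a = i), e1 (b = i), e1 (b = i)]
    rw [← sub_eq_zero]
    simp only [smul_add, smul_smul]
    rw [show ∀ A B A' B' C C' : MvPolynomial (Sym2 (Fin m)) ℚ,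
      A + B - (A' + B') - (C + C') = (A - A' - C) + (B - B' - C') by intros; ring]
    rw [← sub_smul, ← sub_smul, ← sub_smul, ← sub_smul]
    have z1 : ((if a = i then (1:ℚ) else 0) * ((if j = k then 1 else 0) + if b = k then 1 else 0) -
            ((if a = k then 1 else 0) + if b = k then 1 else 0) * (if a = i then (1:ℚ) else 0) -
          ((if k = j then 1 else 0) - if k = i then 1 else 0) * (if a = i then (1:ℚ) else 0)) = 0 := by
      by_cases h : a = i
      · subst h; simp [eq_comm]
      · simp [h]
    have z2 : ((if b = i then (1:ℚ) else 0) * ((if a = k then 1 else 0) + if j = k then 1 else 0) -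
            ((if a = k then 1 else 0) + if b = k then 1 else 0) * (if b = i then (1:ℚ) else 0) -
          ((if k = j then 1 else 0) - if k = i then 1 else 0) * (if b = i then (1:ℚ) else 0)) = 0 := by
      by_cases h : b = i
      · subst h; simp [eq_comm]
      · simp [h]
    rw [z1, z2]; simp
  have h2 := congrArg (fun D => D f) this
  simp only [Derivation.commutator_apply, Derivation.smul_apply] at h2
  rw [← h2]; ring

/-- Weight vectors. -/
def IsWt {m : ℕ} (l : Fin m → ℕ) (f : MvPolynomial (Sym2 (Fin m)) ℚ) : Prop :=
  ∀ k, ED ℚ k k f = (l k : ℚ) • f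

lemma exists_isWt {m : ℕ} (N : Submodule ℚ (MvPolynomial (Sym2 (Fin m)) ℚ))
    (hN : ∀ i j, ∀ x ∈ N, ED ℚ i j x ∈ N) (hne : ∃ x ∈ N, x ≠ 0) :
    ∃ g ∈ N, g ≠ 0 ∧ ∃ l, IsWt l g := by
  classical
  let P : ℕ → Prop := fun n => ∃ x ∈ N, x ≠ 0 ∧ x.support.card = n
  have hP : ∃ n, P n := by
    obtain ⟨x, hx, h0⟩ := hne
    exact ⟨_, x, hx, h0, rfl⟩
  obtain ⟨x, hx, h0, hc⟩ := Nat.find_spec hP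
  obtain ⟨a, ha⟩ := support_nonempty.2 h0
  refine ⟨x, hx, h0, fun k => wtm k a, fun k => ?_⟩
  by_contra hne'
  set y := ED ℚ k k x - (wtm k a : ℚ) • x with hy
  have hy0 : y ≠ 0 := sub_ne_zero.2 hne'
  have hyN : y ∈ N := N.sub_mem (hN _ _ _ hx) (N.smul_mem _ hx)
  have hcoef : ∀ b, coeff b y = ((wtm k b : ℚ) - wtm k a) * coeff b x := by
    intro b
    rw [hy, coeff_sub, coeff_ED_diag, coeff_smul, smul_eq_mul]; ring
  have hlt : y.support.card < x.support.card := by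
    apply Finset.card_lt_card
    refine ⟨fun b hb => ?_, fun hsub => ?_⟩
    · rw [mem_support_iff, hcoef] at hb
      exact mem_support_iff.2 (right_ne_zero_of_mul hb)
    · have := hsub ha
      rw [mem_support_iff, hcoef] at this
      simp at this
  rw [hc] at hlt
  exact Nat.find_min hP hlt ⟨y, hyN, hy0, rfl⟩

lemma exists_hw {m : ℕ} (N : Submodule ℚ (MvPolynomial (Sym2 (Fin m)) ℚ))
    (hN : ∀ i j, ∀ x ∈ N, ED ℚ i j x ∈ N) (hne : ∃ x ∈ N, x ≠ 0) :
    ∃ g ∈ N, g ≠ 0 ∧ (∃ l, IsWt l g) ∧ ∀ i j, j < i → ED ℚ i j g = 0 := by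
  classical
  let P : ℕ → Prop := fun n => ∃ x ∈ N, x ≠ 0 ∧ ∃ l, IsWt l x ∧ ∑ k : Fin m, (k : ℕ) * l k = n
  have hP : ∃ n, P n := by
    obtain ⟨x, hx, h0, l, hl⟩ := exists_isWt N hN hne
    exact ⟨_, x, hx, h0, l, hl, rfl⟩
  obtain ⟨x, hx, h0, l, hl, hs⟩ := Nat.find_spec hP
  refine ⟨x, hx, h0, ⟨l, hl⟩, fun i j hji => ?_⟩
  by_contra hne'
  set y := ED ℚ i j x with hy
  obtain ⟨a, ha⟩ := support_nonempty.2 hne'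
  rw [mem_support_iff] at ha
  have hwt : ∀ k, ED ℚ k k y = ((l k : ℚ) + ((if k = j then 1 else 0) - (if k = i then 1 else 0))) • y := by
    intro k
    rw [hy, ED_comm, hl k, Derivation.map_smul, add_smul]
  have hwa : ∀ k, (wtm k a : ℚ) = (l k : ℚ) + ((if k = j then 1 else 0) - (if k = i then 1 else 0)) := by
    intro k
    have := congrArg (coeff a) (hwt k)
    rw [coeff_ED_diag, coeff_smul, smul_eq_mul] at this
    exact mul_right_cancel₀ ha this
  have hy' : IsWt (fun k => wtm k a) y := by
    intro k; rw [hwt, hwa]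
  have hlt : ∑ k : Fin m, (k : ℕ) * wtm k a < ∑ k : Fin m, (k : ℕ) * l k := by
    have : (∑ k : Fin m, (k : ℚ) * wtm k a) = (∑ k : Fin m, (k : ℚ) * l k) + ((j : ℕ) - (i : ℕ)) := by
      simp only [hwa, mul_add, mul_sub, Finset.sum_add_distrib, Finset.sum_sub_distrib]
      simp
    have h2 : ((j : ℕ) : ℚ) < (i : ℕ) := by exact_mod_cast hji
    have : (∑ k : Fin m, (k : ℚ) * wtm k a) < (∑ k : Fin m, (k : ℚ) * l k) := by linarith
    exact_mod_cast this
  rw [hs] at hlt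
  exact Nat.find_min hP hlt ⟨y, hN _ _ _ hx, hne', _, hy', rfl⟩

/-- Leading principal minors. -/
noncomputable def lm (K : Type*) [Field K] (m k : ℕ) : MvPolynomial (Sym2 (Fin m)) K :=
  if h : k ≤ m then mnr K (Fin.castLE h) (Fin.castLE h) else 1

lemma lm_eq (K : Type*) [Field K] {m k : ℕ} (h : k ≤ m) :
    lm K m k = mnr K (Fin.castLE h) (Fin.castLE h) := dif_pos h

lemma lm_zero (K : Type*) [Field K] (m : ℕ) : lm K m 0 = 1 := by
  rw [lm_eq K (Nat.zero_le m)]; simp [mnr]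

lemma eval_mnr {K A : Type*} [Field K] [CommRing A] [Algebra K A] {m n : ℕ} (r c : Fin n → Fin m)
    (S : Sym2 (Fin m) → A) :
    aeval S (mnr K r c) = (Matrix.of fun a b => S s(r a, c b)).det := by
  unfold mnr
  rw [AlgHom.map_det]
  congr 1
  ext a b
  simp

/-- Highest weight condition. -/
def HW {m : ℕ} (f : MvPolynomial (Sym2 (Fin m)) ℚ) : Prop := ∀ i j : Fin m, j < i → ED ℚ i j f = 0

lemma mnr_row_eq (K : Type*) [Field K] {m n : ℕ} (r c : Fin n → Fin m) {a b : Fin n} (hne : a ≠ b)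
    (h : r a = r b) : mnr K r c = 0 :=
  Matrix.det_zero_of_row_eq hne (by funext k; simp [h])

lemma mnr_col_eq (K : Type*) [Field K] {m n : ℕ} (r c : Fin n → Fin m) {a b : Fin n} (hne : a ≠ b)
    (h : c a = c b) : mnr K r c = 0 :=
  Matrix.det_zero_of_column_eq hne (by intro k; simp [h])

lemma hw_lm (m k : ℕ) : HW (lm ℚ m k) := by
  intro i j hji
  by_cases hk : k ≤ m
  · rw [lm_eq ℚ hk, ED_mnr]
    have hj : ∀ p : Fin k, Fin.castLE hk p = i → ∃ q : Fin k, q ≠ p ∧ Fin.castLE hk q = j := by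
      rintro p rfl
      refine ⟨⟨j, lt_trans hji p.2⟩, ?_, rfl⟩
      intro h
      have h1 := congrArg Fin.val h
      have h2 : (j : ℕ) < p := hji
      simp at h1
      omega
    rw [Finset.sum_eq_zero, Finset.sum_eq_zero, add_zero]
    · intro p _
      split_ifs with h
      · obtain ⟨q, hq, hqj⟩ := hj p h
        exact mnr_col_eq _ _ _ hq (by simp [Function.update_of_ne hq, hqj])
      · rfl
    · intro p _
      split_ifs with h
      · obtain ⟨q, hq, hqj⟩ := hj p h
        exact mnr_row_eq _ _ _ hq (by simp [Function.update_of_ne hq, hqj])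
      · rfl
  · simp [lm, hk]

/-- The flow of a nilpotent operation on symmetric matrices. -/
noncomputable def flowP {m : ℕ} (S : Sym2 (Fin m) → ℚ) (k : Fin m) (c : Fin m → ℚ) :
    Sym2 (Fin m) → Polynomial ℚ :=
  Sym2.lift ⟨fun a b => Polynomial.C (S s(a, b)) +
    Polynomial.X * Polynomial.C (c a * S s(k, b) + c b * S s(a, k)) +
    Polynomial.X ^ 2 * Polynomial.C (c a * c b * S s(k, k)), by
    intro a b
    beta_reduce
    rw [Sym2.eq_swap (a := a) (b := b), Sym2.eq_swap (a := a) (b := k),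
      Sym2.eq_swap (a := k) (b := b), add_comm (c a * _), mul_comm (c a) (c b)]⟩

lemma flowP_mk {m : ℕ} (S : Sym2 (Fin m) → ℚ) (k : Fin m) (c : Fin m → ℚ) (a b : Fin m) :
    flowP S k c s(a, b) = Polynomial.C (S s(a, b)) +
    Polynomial.X * Polynomial.C (c a * S s(k, b) + c b * S s(a, k)) +
    Polynomial.X ^ 2 * Polynomial.C (c a * c b * S s(k, k)) := rfl

lemma flow_deriv {m : ℕ} (S : Sym2 (Fin m) → ℚ) (k : Fin m) (c : Fin m → ℚ) (hc : c k = 0)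
    (f : MvPolynomial (Sym2 (Fin m)) ℚ) :
    Polynomial.derivative (aeval (flowP S k c) f) =
      aeval (flowP S k c) (∑ i, c i • ED ℚ i k f) := by
  induction f using MvPolynomial.induction_on with
  | C a => simp
  | add p q hp hq =>
    simp only [map_add, smul_add, Finset.sum_add_distrib, Polynomial.derivative_add, hp, hq]
  | mul_X p e hp =>
    have h1 : ∑ i, c i • ED ℚ i k (p * X e) = p * (∑ i, c i • ED ℚ i k (X e)) +
        X e * ∑ i, c i • ED ℚ i k p := by
      simp only [Derivation.leibniz, smul_eq_mul, smul_add, Finset.sum_add_distrib,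
        Finset.mul_sum, mul_smul_comm]
    rw [h1, map_mul, Polynomial.derivative_mul, hp, map_add, map_mul, map_mul, aeval_X]
    have h2 : Polynomial.derivative (flowP S k c e) =
        aeval (flowP S k c) (∑ i, c i • ED ℚ i k (X e)) := by
      induction e using Sym2.ind with
      | _ a b =>
      have h3 : ∑ i, c i • ED ℚ i k (X s(a, b)) = c a • X s(k, b) + c b • X s(a, k) := by
        simp only [ED_X, smul_add, Finset.sum_add_distrib]
        simp
      rw [h3, map_add, map_smul, map_smul, aeval_X, aeval_X, flowP_mk, flowP_mk, flowP_mk, hc]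
      simp only [Polynomial.smul_eq_C_mul]
      simp
      ring
    rw [h2]; ring

lemma flow_inv {m : ℕ} (S : Sym2 (Fin m) → ℚ) (k : Fin m) (c : Fin m → ℚ)
    (hc : ∀ i ≤ k, c i = 0) (f : MvPolynomial (Sym2 (Fin m)) ℚ) (hf : HW f) :
    aeval S f = aeval (fun e => (flowP S k c e).eval 1) f := by
  have h0 : Polynomial.derivative (aeval (flowP S k c) f) = 0 := by
    rw [flow_deriv S k c (hc k le_rfl), Finset.sum_eq_zero, map_zero]
    intro i _
    by_cases h : i ≤ k
    · simp [hc i h]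
    · rw [hf i k (not_le.1 h), smul_zero]
  have h1 := Polynomial.derivative_eq_zero.1 h0
  obtain ⟨z, hz⟩ := Polynomial.natDegree_eq_zero.1 h1
  have hev : ∀ x : ℚ, aeval (fun e => (flowP S k c e).eval x) f =
      (aeval (flowP S k c) f).eval x := by
    intro x
    rw [← Polynomial.coe_aeval_eq_eval]
    change _ = Polynomial.aeval x (aeval (flowP S k c) f)
    rw [← AlgHom.comp_apply, comp_aeval]
  have hS : (fun e => (flowP S k c e).eval 0) = S := by
    funext e
    induction e using Sym2.ind with
    | _ a b => simp [flowP_mk]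
  rw [hev 1, ← hz]
  conv_lhs => rw [← hS]
  rw [hev 0, ← hz]; simp

/-- Diagonal symmetric matrices. -/
def dg {A : Type*} [Zero A] {m : ℕ} (d : Fin m → A) : Sym2 (Fin m) → A :=
  Sym2.lift ⟨fun a b => if a = b then d a else 0, by
    intro a b; beta_reduce; by_cases h : a = b
    · simp [h]
    · simp [h, Ne.symm h]⟩

lemma dg_mk {A : Type*} [Zero A] {m : ℕ} (d : Fin m → A) (a b : Fin m) :
    dg d s(a, b) = if a = b then d a else 0 := rfl

lemma lm_diag_part {K A : Type*} [Field K] [CommRing A] [Algebra K A] {m k : ℕ} (hk : k ≤ m)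
    (S : Sym2 (Fin m) → A)
    (hS : ∀ a b : Fin m, a ≠ b → (a : ℕ) < k → (b : ℕ) < k → S s(a, b) = 0) :
    aeval S (lm K m k) = ∏ i : Fin k, S s(Fin.castLE hk i, Fin.castLE hk i) := by
  rw [lm_eq K hk, eval_mnr]
  have : (Matrix.of fun a b : Fin k => S s(Fin.castLE hk a, Fin.castLE hk b)) =
      Matrix.diagonal fun i => S s(Fin.castLE hk i, Fin.castLE hk i) := by
    ext a b
    by_cases h : a = b
    · subst h; simp
    · simp only [Matrix.of_apply, Matrix.diagonal_apply_ne _ h]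
      exact hS _ _ (by simpa using h) a.2 b.2
  rw [this, Matrix.det_diagonal]

lemma lm_dg {K A : Type*} [Field K] [CommRing A] [Algebra K A] {m k : ℕ} (hk : k ≤ m)
    (d : Fin m → A) : aeval (dg d) (lm K m k) = ∏ i : Fin k, d (Fin.castLE hk i) := by
  rw [lm_diag_part hk]
  · simp [dg_mk]
  · intro a b hab _ _; simp [dg_mk, hab]

lemma diag_step {m : ℕ} (S : Sym2 (Fin m) → ℚ) (hS : ∀ k ≤ m, aeval S (lm ℚ m k) ≠ 0) (k : ℕ)
    (hk : k ≤ m) : ∃ S' : Sym2 (Fin m) → ℚ,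
      (∀ f, HW f → aeval S f = aeval S' f) ∧
      ∀ a b : Fin m, a ≠ b → ((a : ℕ) < k ∨ (b : ℕ) < k) → S' s(a, b) = 0 := by
  induction k with
  | zero => exact ⟨S, fun _ _ => rfl, by simp⟩
  | succ k ih =>
    obtain ⟨T, hT, hT0⟩ := ih (by omega)
    let kk : Fin m := ⟨k, hk⟩
    have hkk : T s(kk, kk) ≠ 0 := by
      have h1 := hS (k + 1) hk
      rw [hT _ (hw_lm m (k+1)), lm_diag_part hk] at h1
      · have := Finset.prod_ne_zero_iff.1 h1 (Fin.last k) (Finset.mem_univ _)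
        exact this
      · intro a b hab ha hb
        apply hT0 a b hab
        by_contra hcon
        push Not at hcon
        apply hab; ext; omega
    let c : Fin m → ℚ := fun i => if i ≤ kk then 0 else - T s(i, kk) / T s(kk, kk)
    refine ⟨fun e => (flowP T kk c e).eval 1, fun f hf => ?_, ?_⟩
    · rw [hT f hf]
      exact flow_inv T kk c (by intro i hi; simp [c, hi]) f hf
    · have key : ∀ a b : Fin m, a ≠ b → (a : ℕ) < k + 1 →
          (flowP T kk c s(a, b)).eval 1 = 0 := by
        intro a b hab ha
        have hca : c a = 0 := by
          have : a ≤ kk := by rw [Fin.le_def]; simp [kk]; omega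
          simp [c, this]
        simp only [flowP_mk, hca]
        simp
        by_cases hak : a = kk
        · subst hak
          by_cases hb : b ≤ kk
          · have : (b : ℕ) < k := by
              have h1 : (b : ℕ) ≤ k := hb
              have h2 : (b : ℕ) ≠ k := fun h => hab (Fin.ext h.symm)
              omega
            simp [c, hb, hT0 kk b hab (Or.inr this)]
          · simp only [c, hb, if_false]
            rw [Sym2.eq_swap (a := b)]
            field_simp
            ring
        · have : (a : ℕ) < k := by
            have h2 : (a : ℕ) ≠ k := fun h => hak (Fin.ext h)
            omega
          rw [hT0 a b hab (Or.inl this), hT0 a kk hak (Or.inl this)]; simp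
      intro a b hab h
      rcases h with h | h
      · exact key a b hab h
      · rw [Sym2.eq_swap]; exact key b a hab.symm h

lemma diag_red {m : ℕ} (S : Sym2 (Fin m) → ℚ) (hS : ∀ k ≤ m, aeval S (lm ℚ m k) ≠ 0) :
    ∃ d : Fin m → ℚ, ∀ f, HW f → aeval S f = aeval (dg d) f := by
  obtain ⟨T, hT, h0⟩ := diag_step S hS m le_rfl
  refine ⟨fun i => T s(i, i), fun f hf => ?_⟩
  rw [hT f hf]
  congr 2
  funext e
  induction e using Sym2.ind with
  | _ a b =>
    rw [dg_mk]
    split_ifs with h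
    · rw [h]
    · exact h0 a b h (Or.inl a.2)

lemma wt_dg {m : ℕ} (l : Fin m → ℕ) (g : MvPolynomial (Sym2 (Fin m)) ℚ) (hg : IsWt l g) :
    ∃ c : ℚ, ∀ d : Fin m → ℚ, aeval (dg d) g = c * ∏ i, d i ^ (l i / 2) := by
  classical
  refine ⟨∑ a ∈ g.support, if ∀ e : Sym2 (Fin m), ¬ e.IsDiag → a e = 0 then coeff a g else 0,
    fun d => ?_⟩
  conv_lhs => rw [g.as_sum, map_sum]
  rw [Finset.sum_mul]
  apply Finset.sum_congr rfl
  intro a ha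
  have hc : coeff a g ≠ 0 := mem_support_iff.1 ha
  have hw : ∀ i, wtm i a = l i := by
    intro i
    have h1 := coeff_ED_diag i g a
    rw [hg i, coeff_smul, smul_eq_mul] at h1
    have := mul_right_cancel₀ hc h1
    exact_mod_cast this.symm
  rw [aeval_monomial, Finsupp.prod_fintype _ _ (by simp)]
  change coeff a g * _ = _
  split_ifs with hd
  · congr 1
    symm
    apply Fintype.prod_of_injective (fun i : Fin m => s(i, i))
    · intro i j h; simpa using h
    · intro e he
      rw [hd e, pow_zero]
      intro hdiag
      induction e using Sym2.ind with
      | _ a b =>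
        rw [Sym2.mk_isDiag_iff] at hdiag
        subst hdiag
        exact he ⟨a, rfl⟩
    · intro i
      have h2 : l i = 2 * a s(i, i) := by
        rw [← hw i, wtm, Finset.sum_eq_single i]
        · simp
        · intro k _ hk
          rw [hd _ (by simpa using hk.symm), mul_zero]
        · simp
      rw [dg_mk, if_pos rfl, h2]
      simp
  · push Not at hd
    obtain ⟨e, he, hae⟩ := hd
    rw [zero_mul, Finset.prod_eq_zero (Finset.mem_univ e), mul_zero]
    induction e using Sym2.ind with
    | _ x y =>
      rw [dg_mk, if_neg (by simpa using he), zero_pow hae]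

lemma lm_ne_zero (K : Type*) [Field K] {m k : ℕ} (hk : k ≤ m) : lm K m k ≠ 0 := by
  intro h
  have h1 := lm_dg (K := K) (A := K) hk (fun _ => 1)
  rw [h] at h1
  simp at h1

lemma hw_ident {m : ℕ} (l : Fin m → ℕ) (g : MvPolynomial (Sym2 (Fin m)) ℚ) (hg : IsWt l g)
    (hw : HW g) : ∃ (c : ℚ) (α : ℕ → ℕ), α m = 0 ∧
      g * ∏ i ∈ Finset.range m, lm ℚ m i ^ α i =
        C c * ∏ i ∈ Finset.range m, lm ℚ m (i + 1) ^ α i := by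
  classical
  obtain ⟨c, hc⟩ := wt_dg l g hg
  let α : ℕ → ℕ := fun i => if h : i < m then l ⟨i, h⟩ / 2 else 0
  refine ⟨c, α, by simp [α], ?_⟩
  have hne : (∏ k ∈ Finset.range (m + 1), lm ℚ m k) ≠ 0 :=
    Finset.prod_ne_zero_iff.2 fun k hk => lm_ne_zero ℚ (by simp at hk; omega)
  apply mul_right_cancel₀ hne
  apply MvPolynomial.funext
  intro S
  simp only [map_mul]
  by_cases h0 : ∀ k ≤ m, aeval S (lm ℚ m k) ≠ 0
  · congr 1
    obtain ⟨d, hd⟩ := diag_red S h0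
    have ev : ∀ f, HW f → eval S f = aeval (dg d) f := fun f hf => by
      rw [← hd f hf]; rfl
    rw [ev g hw, hc, map_prod, map_prod, eval_C]
    let d' : ℕ → ℚ := fun i => if h : i < m then d ⟨i, h⟩ else 1
    have hl : ∀ k ≤ m, eval S (lm ℚ m k) = ∏ i ∈ Finset.range k, d' i := by
      intro k hk
      rw [ev _ (hw_lm m k), lm_dg hk, Finset.prod_range]
      apply Finset.prod_congr rfl
      intro i _
      have : (i : ℕ) < m := lt_of_lt_of_le i.2 hk
      simp [d', this]
      rfl
    have hp : ∏ i, d i ^ (l i / 2) = ∏ i ∈ Finset.range m, d' i ^ α i := by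
      rw [Finset.prod_range]
      apply Finset.prod_congr rfl
      intro i _
      simp [d', α]
    rw [hp, mul_assoc, ← Finset.prod_mul_distrib]
    congr 1
    apply Finset.prod_congr rfl
    intro i hi
    rw [Finset.mem_range] at hi
    rw [map_pow, map_pow, hl i hi.le, hl (i + 1) hi, Finset.prod_range_succ, mul_pow, mul_comm]
  · push Not at h0
    obtain ⟨k, hk, h⟩ := h0
    have : eval S (∏ k ∈ Finset.range (m + 1), lm ℚ m k) = 0 := by
      rw [map_prod]
      exact Finset.prod_eq_zero (Finset.mem_range.2 (by omega : k < m + 1)) h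
    rw [this, mul_zero, mul_zero]

/-- The permutation matrix of an adjacent transposition. -/
def swS {m : ℕ} (j : ℕ) : Sym2 (Fin m) → ℚ :=
  Sym2.lift ⟨fun a b => if (if (a : ℕ) = j then j + 1 else if (a : ℕ) = j + 1 then j else a) = (b : ℕ)
    then 1 else 0, by
    intro a b
    beta_reduce
    split_ifs <;> first | rfl | omega⟩

lemma swS_mk {m : ℕ} (j : ℕ) (a b : Fin m) : swS j s(a, b) =
   if (if (a : ℕ) = j then j + 1 else if (a : ℕ) = j + 1 then j else a) = (b : ℕ)
    then 1 else 0 := rfl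

lemma lm_swS_zero {m j : ℕ} (hj : j + 1 < m) : aeval (swS j) (lm ℚ m (j + 1)) = 0 := by
  rw [lm_eq ℚ hj.le, eval_mnr]
  apply Matrix.det_eq_zero_of_row_eq_zero (Fin.last j)
  intro b
  have := b.2
  simp [swS_mk]
  omega

lemma lm_swS_ne {m j k : ℕ} (hj : j + 1 < m) (hk : k ≤ m) (hkj : k ≠ j + 1) :
    aeval (swS j) (lm ℚ m k) ≠ 0 := by
  by_cases h : k ≤ j
  · rw [lm_diag_part hk]
    · apply Finset.prod_ne_zero_iff.2
      intro i _
      have := i.2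
      rw [swS_mk, if_pos]
      · exact one_ne_zero
      · simp only [Fin.val_castLE]
        rw [if_neg (by omega), if_neg (by omega)]
    · intro a b hab ha hb
      have : (a : ℕ) ≠ b := fun h => hab (Fin.ext h)
      rw [swS_mk]
      split_ifs <;> first | rfl | omega
  · have h1 : j < k := by omega
    have h2 : j + 1 < k := by omega
    rw [lm_eq ℚ hk, eval_mnr]
    have : (Matrix.of fun a b : Fin k => swS j s(Fin.castLE hk a, Fin.castLE hk b)) =
        (Equiv.swap (⟨j, h1⟩ : Fin k) ⟨j + 1, h2⟩).permMatrix ℚ := by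
      ext a b
      simp only [Matrix.of_apply, swS_mk, Equiv.toPEquiv_apply, PEquiv.toMatrix_apply,
        Equiv.swap_apply_def, Option.mem_def, Option.some.injEq]
      congr 1
      simp only [Fin.ext_iff, Fin.val_castLE]
      split_ifs <;> simp_all
    rw [this, Matrix.det_permutation]
    rcases Int.units_eq_one_or (Equiv.Perm.sign (Equiv.swap (⟨j, h1⟩ : Fin k) ⟨j + 1, h2⟩)) with h | h <;>
      simp [h]

lemma hw_struct {m : ℕ} (l : Fin m → ℕ) (g : MvPolynomial (Sym2 (Fin m)) ℚ) (hg : IsWt l g)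
    (hw : HW g) (hg0 : g ≠ 0) : ∃ (c : ℚ) (β : ℕ → ℕ), c ≠ 0 ∧
      g = C c * ∏ i ∈ Finset.range m, lm ℚ m (i + 1) ^ β i := by
  classical
  obtain ⟨c, α, hαm, h⟩ := hw_ident l g hg hw
  have hL : (∏ i ∈ Finset.range m, lm ℚ m i ^ α i) ≠ 0 :=
    Finset.prod_ne_zero_iff.2 fun k hk => pow_ne_zero _ (lm_ne_zero ℚ (by simp at hk; omega))
  have hc : c ≠ 0 := by
    rintro rfl
    rw [C_0, zero_mul] at h
    exact (mul_ne_zero hg0 hL) h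
  have dom : ∀ j, j < m → α (j + 1) ≤ α j := by
    intro j hj
    by_cases hj1 : j + 1 = m
    · rw [hj1, hαm]; omega
    have hj2 : j + 1 < m := by omega
    by_contra hlt
    push Not at hlt
    have hd1 : lm ℚ m (j + 1) ^ (α j + 1) ∣ g * ∏ i ∈ Finset.range m, lm ℚ m i ^ α i := by
      apply Dvd.dvd.mul_left
      exact (pow_dvd_pow _ hlt).trans
        (Finset.dvd_prod_of_mem (fun i => lm ℚ m i ^ α i) (Finset.mem_range.2 hj2))
    rw [h, ← Finset.mul_prod_erase _ _ (Finset.mem_range.2 hj), mul_left_comm, pow_succ] at hd1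
    have hd2 := (mul_dvd_mul_iff_left (pow_ne_zero _ (lm_ne_zero ℚ hj2.le))).1 hd1
    have hd3 := map_dvd (aeval (swS j) : MvPolynomial (Sym2 (Fin m)) ℚ →ₐ[ℚ] ℚ) hd2
    rw [lm_swS_zero hj2, zero_dvd_iff, map_mul, map_prod] at hd3
    rcases mul_eq_zero.1 hd3 with h1 | h1
    · simp at h1; exact hc h1
    · obtain ⟨i, hi, h2⟩ := Finset.prod_eq_zero_iff.1 h1
      rw [Finset.mem_erase, Finset.mem_range] at hi
      rw [map_pow] at h2
      exact lm_swS_ne hj2 (by omega : i + 1 ≤ m) (by omega) (eq_zero_of_pow_eq_zero h2)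
  refine ⟨c, fun i => α i - α (i + 1), hc, ?_⟩
  apply mul_right_cancel₀ hL
  rw [h, mul_assoc]
  congr 1
  have h3 : ∏ i ∈ Finset.range m, lm ℚ m i ^ α i = ∏ i ∈ Finset.range m, lm ℚ m (i + 1) ^ α (i + 1) := by
    have h4 := Finset.prod_range_succ (fun i => lm ℚ m i ^ α i) m
    have h5 := Finset.prod_range_succ' (fun i => lm ℚ m i ^ α i) m
    rw [h5, lm_zero, hαm] at h4
    simpa using h4.symm
  rw [h3, ← Finset.prod_mul_distrib]
  apply Finset.prod_congr rfl
  intro i hi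
  rw [← pow_add, Nat.sub_add_cancel (dom i (Finset.mem_range.1 hi))]

/-- The variables of the generic deformation of a matrix of rank at most `q`. -/
abbrev VV (m q : ℕ) := Option ((Fin m × Fin q) ⊕ Sym2 (Fin m))

/-- The generic point of the deformation. -/
noncomputable def PhiX (K : Type*) [Field K] (m q : ℕ) :
    Sym2 (Fin m) → MvPolynomial (VV m q) K :=
  Sym2.lift ⟨fun a b => (∑ p, X (some (.inl (a, p))) * X (some (.inl (b, p)))) +
    X none * X (some (.inr s(a, b))), by
    intro a b
    beta_reduce
    rw [Sym2.eq_swap (a := a)]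
    simp only [mul_comm]⟩

lemma PhiX_mk (K : Type*) [Field K] (m q : ℕ) (a b : Fin m) :
    PhiX K m q s(a, b) = (∑ p, X (some (.inl (a, p))) * X (some (.inl (b, p)))) +
    X none * X (some (.inr s(a, b))) := rfl

/-- The deformation map. -/
noncomputable def Phi (K : Type*) [Field K] (m q : ℕ) :
    MvPolynomial (Sym2 (Fin m)) K →ₐ[K] MvPolynomial (VV m q) K := aeval (PhiX K m q)

/-- The ideal of forms vanishing to order `N`. -/
noncomputable def DD (K : Type*) [Field K] (m q N : ℕ) : Ideal (MvPolynomial (Sym2 (Fin m)) K) :=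
  Ideal.comap (Phi K m q) (Ideal.span {X none ^ N})

lemma mem_DD {K : Type*} [Field K] {m q N : ℕ} {f : MvPolynomial (Sym2 (Fin m)) K} :
    f ∈ DD K m q N ↔ X none ^ N ∣ Phi K m q f := by
  rw [DD, Ideal.mem_comap, Ideal.mem_span_singleton]

/-- The lifted derivation. -/
noncomputable def ET (K : Type*) [Field K] {m q : ℕ} (i j : Fin m) :
    Derivation K (MvPolynomial (VV m q) K) (MvPolynomial (VV m q) K) :=
  mkDerivation K fun v => match v with
    | none => 0
    | some (.inl (a, p)) => if a = i then X (some (.inl (j, p))) else 0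
    | some (.inr e) => rename (fun e => some (.inr e)) (ED K i j (X e))

lemma ET_none (K : Type*) [Field K] {m q : ℕ} (i j : Fin m) :
    ET K (q := q) i j (X none) = 0 := by simp [ET]

lemma ET_z (K : Type*) [Field K] {m q : ℕ} (i j a : Fin m) (p : Fin q) :
    ET K (q := q) i j (X (some (.inl (a, p)))) = if a = i then X (some (.inl (j, p))) else 0 := by
  simp [ET]

lemma ET_w (K : Type*) [Field K] {m q : ℕ} (i j : Fin m) (a b : Fin m) :
    ET K (q := q) i j (X (some (.inr s(a, b)))) = (if a = i then X (some (.inr s(j, b))) else 0) +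
      (if b = i then X (some (.inr s(a, j))) else 0) := by
  simp only [ET, mkDerivation_X, ED_X, map_add]
  congr 1 <;> split_ifs <;> simp

lemma Phi_ED (K : Type*) [Field K] {m q : ℕ} (i j : Fin m) (f : MvPolynomial (Sym2 (Fin m)) K) :
    Phi K m q (ED K i j f) = ET K i j (Phi K m q f) := by
  induction f using MvPolynomial.induction_on with
  | C a =>
    have h1 : (C a : MvPolynomial (Sym2 (Fin m)) K) = algebraMap K _ a := rfl
    rw [h1, AlgHom.commutes, Derivation.map_algebraMap, Derivation.map_algebraMap, map_zero]
  | add p q hp hq => simp only [map_add, hp, hq]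
  | mul_X p e hp =>
    have h2 : Phi K m q (ED K i j (X e)) = ET K i j (Phi K m q (X e)) := by
      induction e using Sym2.ind with
      | _ a b =>
      have h3 : ∀ a b : Fin m, Phi K m q (X s(a, b)) = PhiX K m q s(a, b) := fun a b => by
        rw [Phi, aeval_X]
      rw [ED_X, map_add, apply_ite (Phi K m q), apply_ite (Phi K m q), h3, h3, h3, map_zero]
      simp only [PhiX_mk, map_add, map_sum, Derivation.leibniz, ET_z, ET_none, ET_w, smul_eq_mul,
        Finset.sum_add_distrib, mul_zero, add_zero]
      by_cases ha : a = i <;> by_cases hb : b = i <;> simp [ha, hb, mul_add] <;> 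
        simp only [mul_comm (X (some (Sum.inl (j, _))))] <;> ring
    simp only [map_mul, Derivation.leibniz, smul_eq_mul, map_add, hp, h2]

lemma DD_ED (K : Type*) [Field K] {m q N : ℕ} (i j : Fin m) (f : MvPolynomial (Sym2 (Fin m)) K)
    (hf : f ∈ DD K m q N) : ED K i j f ∈ DD K m q N := by
  rw [mem_DD] at hf ⊢
  rw [Phi_ED]
  obtain ⟨y, hy⟩ := hf
  rw [hy, Derivation.leibniz, Derivation.leibniz_pow, ET_none]
  simp

/-- A test specialisation. -/
noncomputable def psi (K : Type*) [Field K] (m q : ℕ) :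
    MvPolynomial (VV m q) K →ₐ[K] Polynomial K :=
  aeval fun v => match v with
    | none => Polynomial.X
    | some (.inl (a, p)) => if (a : ℕ) = p then 1 else 0
    | some (.inr e) => dg (fun i : Fin m => if (i : ℕ) < q then 0 else 1) e

/-- The test diagonal. -/
noncomputable def td (K : Type*) [Field K] (m q : ℕ) : Fin m → Polynomial K :=
  fun i => if (i : ℕ) < q then 1 else Polynomial.X

lemma psi_Phi (K : Type*) [Field K] (m q : ℕ) (f : MvPolynomial (Sym2 (Fin m)) K) :
    psi K m q (Phi K m q f) = aeval (dg (td K m q)) f := by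
  rw [Phi, ← AlgHom.comp_apply, comp_aeval]
  congr 2
  funext e
  induction e using Sym2.ind with
  | _ a b =>
    rw [PhiX_mk, map_add, map_sum, dg_mk]
    simp only [map_mul, psi, aeval_X, dg_mk, td]
    by_cases hq : (a : ℕ) < q
    · rw [Finset.sum_eq_single ⟨a, hq⟩]
      · by_cases hab : a = b
        · subst hab; simp [hq]
        · have : (b : ℕ) ≠ a := fun h => hab (Fin.ext h.symm)
          simp [hab, this]
      · intro p _ hp
        have : (a : ℕ) ≠ p := fun h => hp (Fin.ext h.symm)
        simp [this]
      · simp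
    · rw [Finset.sum_eq_zero]
      · simp [hq]
      · intro p _
        have : (a : ℕ) ≠ p := by have := p.2; omega
        simp [this]

lemma lm_td (K : Type*) [Field K] {m q k : ℕ} (hk : k ≤ m) :
    aeval (dg (td K m q)) (lm K m k) = Polynomial.X ^ (k - q) := by
  rw [lm_dg hk]
  have : ∏ i : Fin k, td K m q (Fin.castLE hk i) =
      ∏ i ∈ Finset.range k, if i < q then (1 : Polynomial K) else Polynomial.X := by
    rw [Finset.prod_range]; rfl
  rw [this]
  clear this hk
  induction k with
  | zero => simp
  | succ k ih =>
    rw [Finset.prod_range_succ, ih]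
    split_ifs with h
    · rw [mul_one]; congr 1; omega
    · rw [← pow_succ]; congr 1; omega

lemma DD_exponent {K : Type*} [Field K] {m q N : ℕ} {c : K} (hc : c ≠ 0) {β : ℕ → ℕ}
    (h : C c * ∏ i ∈ Finset.range m, lm K m (i + 1) ^ β i ∈ DD K m q N) :
    N ≤ ∑ i ∈ Finset.range m, β i * (i + 1 - q) := by
  rw [mem_DD] at h
  have h1 := map_dvd (psi K m q) h
  rw [psi_Phi, map_pow, map_mul, map_prod] at h1
  have h2 : ∏ i ∈ Finset.range m, aeval (dg (td K m q)) (lm K m (i + 1) ^ β i) =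
      Polynomial.X ^ ∑ i ∈ Finset.range m, β i * (i + 1 - q) := by
    rw [← Finset.prod_pow_eq_pow_sum]
    apply Finset.prod_congr rfl
    intro i hi
    rw [map_pow, lm_td K (Finset.mem_range.1 hi), ← pow_mul, mul_comm]
  rw [h2] at h1
  have h3 : psi K m q (X none) = Polynomial.X := by simp [psi]
  rw [h3] at h1
  have h4 : aeval (dg (td K m q)) (C c : MvPolynomial (Sym2 (Fin m)) K) = Polynomial.C c := by
    simp
  rw [h4, mul_comm] at h1
  have hu : IsUnit (Polynomial.C c) := Polynomial.isUnit_C.2 hc.isUnit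
  rw [hu.dvd_mul_right] at h1
  exact (pow_dvd_pow_iff Polynomial.X_ne_zero Polynomial.not_isUnit_X).1 h1

theorem thmX {m q N : ℕ} (A : Ideal (MvPolynomial (Sym2 (Fin m)) ℚ))
    (hA : ∀ i j, ∀ x ∈ A, ED ℚ i j x ∈ A)
    (hprod : ∀ β : ℕ → ℕ, N ≤ ∑ i ∈ Finset.range m, β i * (i + 1 - q) →
      ∏ i ∈ Finset.range m, lm ℚ m (i + 1) ^ β i ∈ A) :
    DD ℚ m q N ≤ A := by
  classical
  intro x hx
  by_contra hxA
  let V := restrictTotalDegree (Sym2 (Fin m)) ℚ x.totalDegree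
  have hxV : x ∈ V := by simp [V, mem_restrictTotalDegree]
  let D' : Submodule ℚ (MvPolynomial (Sym2 (Fin m)) ℚ) := (DD ℚ m q N).restrictScalars ℚ
  let A' : Submodule ℚ (MvPolynomial (Sym2 (Fin m)) ℚ) := A.restrictScalars ℚ
  let U : Submodule ℚ (MvPolynomial (Sym2 (Fin m)) ℚ) := A' ⊓ (D' ⊓ V)
  have hUV : U ≤ V := inf_le_right.trans inf_le_right
  have : Module.Finite ℚ V := inferInstance
  have hUfin : Module.Finite ℚ U :=
    Module.Finite.of_injective (Submodule.inclusion hUV) (Submodule.inclusion_injective hUV)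
  obtain ⟨w, hwU, hw⟩ := fis_proj U x
  let P : Submodule ℚ (MvPolynomial (Sym2 (Fin m)) ℚ) :=
    { carrier := {y | ∀ u ∈ U, fis m y u = 0}
      add_mem' := by
        intro a b ha hb u hu
        rw [map_add, LinearMap.add_apply, ha u hu, hb u hu, add_zero]
      zero_mem' := by intro u _; simp
      smul_mem' := by
        intro c a ha u hu
        rw [map_smul, LinearMap.smul_apply, ha u hu, smul_zero] }
  have hUED : ∀ i j, ∀ y ∈ U, ED ℚ i j y ∈ U := by
    intro i j y hy
    exact ⟨hA i j y hy.1, DD_ED ℚ i j y hy.2.1, ED_degree i j _ y hy.2.2⟩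
  obtain ⟨g, hgN, hg0, ⟨l, hl⟩, hhw⟩ := exists_hw (P ⊓ (D' ⊓ V)) (by
    intro i j y hy
    refine ⟨?_, DD_ED ℚ i j y hy.2.1, ED_degree i j _ y hy.2.2⟩
    intro u hu
    rw [fis_ED]
    exact hy.1 _ (hUED j i u hu)) ⟨x - w, ⟨fun u hu => hw u hu,
      (D' ⊓ V).sub_mem ⟨hx, hxV⟩ hwU.2⟩, fun h => hxA (by
        rw [sub_eq_zero.1 h]; exact hwU.1)⟩
  obtain ⟨c, β, hc, hgeq⟩ := hw_struct l g hl hhw hg0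
  have hN := DD_exponent hc (hgeq ▸ hgN.2.1 : C c * ∏ i ∈ Finset.range m, lm ℚ m (i + 1) ^ β i ∈ DD ℚ m q N)
  have hgA : g ∈ A := by rw [hgeq]; exact A.mul_mem_left _ (hprod β hN)
  exact hg0 (fis_pos g (hgN.1 g ⟨hgA, hgN.2⟩))

lemma det_mem_pow {A : Type*} [CommRing A] {n : Type*} [Fintype n] [DecidableEq n] (J : Ideal A)
    (M : Matrix n n A) (h : ∀ a b, M a b ∈ J) : M.det ∈ J ^ Fintype.card n := by
  rw [Matrix.det_apply]
  refine Submodule.sum_mem _ fun σ _ => ?_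
  have h1 : ∏ i, M (σ i) i ∈ J ^ Fintype.card n := by
    have := Ideal.prod_mem_prod (s := Finset.univ) (I := fun _ : n => J) (x := fun i => M (σ i) i)
      (fun i _ => h _ _)
    simpa using this
  rcases Int.units_eq_one_or (Equiv.Perm.sign σ) with h | h
  · rw [h, one_smul]; exact h1
  · rw [h, Units.neg_smul, one_smul]; exact Submodule.neg_mem _ h1

lemma mnr_pow_mem (K : Type*) [Field K] {m i : ℕ} (r c : Fin (i + 1) → Fin m) :
    mnr K r c ^ i ∈ symMinors K m i ^ (i + 1) := by
  unfold mnr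
  set M := Matrix.of fun a b => (X s(r a, c b) : MvPolynomial (Sym2 (Fin m)) K) with hM
  have h1 := Matrix.det_adjugate M
  rw [Fintype.card_fin, Nat.add_sub_cancel] at h1
  rw [← h1]
  have h2 := det_mem_pow (symMinors K m i) M.adjugate (by
    intro a b
    rw [Matrix.adjugate_fin_succ_eq_det_submatrix]
    apply Ideal.mul_mem_left
    exact mnr_mem K (fun x => r (b.succAbove x)) (fun x => c (a.succAbove x)))
  rwa [Fintype.card_fin] at h2

lemma symMinors_succ_le (K : Type*) [Field K] (m i : ℕ) :
    symMinors K m (i + 1) ≤ symMinors K m i := by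
  rw [symMinors, Ideal.span_le]
  rintro d ⟨r, c, -, -, rfl⟩
  rw [Matrix.det_succ_row_zero]
  refine Submodule.sum_mem _ fun a _ => ?_
  apply Ideal.mul_mem_left
  exact mnr_mem K (fun x => r x.succ) (fun x => c (a.succAbove x))

lemma symMinors_anti (K : Type*) [Field K] (m : ℕ) {i j : ℕ} (h : i ≤ j) :
    symMinors K m j ≤ symMinors K m i :=
  antitone_nat_of_succ_le (symMinors_succ_le K m) h

/-- Asymptotic containment with slope. -/
def PP {A : Type*} [CommRing A] (b : Ideal A) (p q : ℕ) (J : Ideal A) : Prop :=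
  ∃ C : ℕ, ∀ n r : ℕ, p * r + C ≤ q * n → J ^ n ≤ b ^ r

lemma PP_principal {A : Type*} [CommRing A] (b : Ideal A) {p q : ℕ} (hp : 0 < p) (d : A)
    (hd : d ^ p ∈ b ^ q) : PP b p q (Ideal.span {d}) := by
  refine ⟨p * q, fun n r h => ?_⟩
  rw [Ideal.span_singleton_pow, Ideal.span_singleton_le_iff_mem]
  have h1 : d ^ n = (d ^ p) ^ (n / p) * d ^ (n % p) := by
    rw [← pow_mul, ← pow_add, Nat.div_add_mod]
  rw [h1]
  apply Ideal.mul_mem_right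
  have h2 := Ideal.pow_mem_pow hd (n / p)
  rw [← pow_mul] at h2
  refine Ideal.pow_le_pow_right ?_ h2
  have h3 : n % p < p := Nat.mod_lt _ hp
  have h4 := Nat.div_add_mod n p
  have h5 : p * r ≤ p * (q * (n / p)) := by
    have : q * n = p * (q * (n / p)) + q * (n % p) := by
      conv_lhs => rw [← h4]
      ring
    have h6 : q * (n % p) ≤ q * p := Nat.mul_le_mul_left _ h3.le
    rw [mul_comm q p] at h6
    omega
  exact Nat.le_of_mul_le_mul_left h5 hp

lemma PP_sup {A : Type*} [CommRing A] (b : Ideal A) {p q : ℕ} (hp : 0 < p) {J1 J2 : Ideal A}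
    (h1 : PP b p q J1) (h2 : PP b p q J2) : PP b p q (J1 ⊔ J2) := by
  obtain ⟨C1, h1⟩ := h1
  obtain ⟨C2, h2⟩ := h2
  refine ⟨C1 + C2 + 2 * p, fun n r h => ?_⟩
  rw [← Ideal.add_eq_sup, add_pow, Ideal.sum_eq_sup]
  apply Finset.sup_le
  intro k hk
  rw [Finset.mem_range] at hk
  refine Ideal.mul_le_left.trans ?_
  have key : ∀ (J : Ideal A) (C : ℕ), (∀ n r : ℕ, p * r + C ≤ q * n → J ^ n ≤ b ^ r) →
      ∀ n, ∃ r, J ^ n ≤ b ^ r ∧ q * n ≤ p * r + C + p := by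
    intro J C hJ n
    by_cases hc : C ≤ q * n
    · refine ⟨(q * n - C) / p, hJ _ _ ?_, ?_⟩
      · have := Nat.mul_div_le (q * n - C) p; omega
      · have := Nat.lt_mul_div_succ (q * n - C) hp
        rw [Nat.mul_add] at this
        omega
    · exact ⟨0, by simp, by omega⟩
  obtain ⟨r1, hr1, hr1'⟩ := key J1 C1 h1 k
  obtain ⟨r2, hr2, hr2'⟩ := key J2 C2 h2 (n - k)
  refine (Ideal.mul_mono hr1 hr2).trans ?_
  rw [← pow_add]
  apply Ideal.pow_le_pow_right
  have h3 : q * n = q * k + q * (n - k) := by rw [← Nat.mul_add]; congr 1; omega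
  have h4 : p * r ≤ p * (r1 + r2) := by rw [Nat.mul_add]; omega
  exact Nat.le_of_mul_le_mul_left h4 hp

lemma PP_span {A : Type*} [CommRing A] (b : Ideal A) {p q : ℕ} (hp : 0 < p) (S : Set A)
    (hS : S.Finite) (h : ∀ d ∈ S, d ^ p ∈ b ^ q) : PP b p q (Ideal.span S) := by
  induction S, hS using Set.Finite.induction_on with
  | empty =>
    refine ⟨1, fun n r h => ?_⟩
    have : n ≠ 0 := by rintro rfl; simp at h
    rw [Ideal.span_empty, ← Ideal.zero_eq_bot, zero_pow this]
    exact bot_le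
  | insert _ _ ih =>
    rw [Set.insert_eq, Ideal.span_union]
    exact PP_sup b hp (PP_principal b hp _ (h _ (by simp)))
      (ih fun d hd => h d (by simp [hd]))

lemma PP_minors (K : Type*) [Field K] (m i : ℕ) (hi : 0 < i) :
    PP (symMinors K m i) i (i + 1) (symMinors K m (i + 1)) := by
  apply PP_span _ hi
  · apply (Set.finite_range fun x : (Fin (i + 1) → Fin m) × (Fin (i + 1) → Fin m) =>
      mnr K x.1 x.2).subset
    rintro d ⟨r, c, -, -, rfl⟩
    exact ⟨(r, c), rfl⟩
  · rintro d ⟨r, c, -, -, rfl⟩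
    exact mnr_pow_mem K r c

lemma PP_minors' (K : Type*) [Field K] (m t : ℕ) (ht : 0 < t) (i : ℕ) (hi : t ≤ i) :
    PP (symMinors K m t) t i (symMinors K m i) := by
  induction i, hi using Nat.le_induction with
  | base =>
    refine ⟨0, fun n r h => Ideal.pow_le_pow_right ?_⟩
    exact Nat.le_of_mul_le_mul_left (by omega : t * r ≤ t * n) ht
  | succ i hi ih =>
    obtain ⟨C, hC⟩ := ih
    obtain ⟨D, hD⟩ := PP_minors K m i (by omega)
    refine ⟨C + D + i, fun n r h => ?_⟩
    have h1 := Nat.mul_div_le ((i + 1) * n - D) i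
    have h2 := Nat.lt_mul_div_succ ((i + 1) * n - D) (by omega : 0 < i)
    rw [Nat.mul_add] at h2
    exact (hD n (((i + 1) * n - D) / i) (by omega)).trans (hC _ r (by omega))

lemma lm_mem (K : Type*) [Field K] {m k : ℕ} (hk : k ≤ m) : lm K m k ∈ symMinors K m k := by
  rw [lm_eq K hk]; exact mnr_mem K _ _

lemma lm_pow_bound (K : Type*) [Field K] {m t : ℕ} (ht : 0 < t) (htm : t ≤ m) (i : ℕ) (hi : i < m) :
    ∃ C : ℕ, ∀ b, ∃ ρ, lm K m (i + 1) ^ b ∈ symMinors K m t ^ ρ ∧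
      m * (b * (i + 1 - (t - 1))) ≤ (m - t + 1) * t * ρ + C := by
  by_cases hit : t ≤ i + 1
  · obtain ⟨C, hC⟩ := PP_minors' K m t ht (i + 1) hit
    refine ⟨(m - t + 1) * (C + t), fun b => ⟨((i + 1) * b - C) / t, ?_, ?_⟩⟩
    · by_cases h : C ≤ (i + 1) * b
      · apply hC b
        · have h1 := Nat.mul_div_le ((i + 1) * b - C) t
          omega
        · exact Ideal.pow_mem_pow (lm_mem K hi) b
      · rw [Nat.sub_eq_zero_of_le (by omega)]; simp
    · have h2 := Nat.lt_mul_div_succ ((i + 1) * b - C) ht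
      rw [Nat.mul_add] at h2
      set ρ := ((i + 1) * b - C) / t
      have h3 : (i + 1) * b ≤ t * ρ + (C + t) := by omega
      have h4 := Nat.mul_le_mul_left (m - t + 1) h3
      have h5 : m * (i + 1 - (t - 1)) ≤ (m - t + 1) * (i + 1) := by
        obtain ⟨q, rfl⟩ : ∃ q, t = q + 1 := ⟨t - 1, by omega⟩
        obtain ⟨u, hu⟩ : ∃ u, i = q + u := ⟨i - q, by omega⟩
        obtain ⟨v, hv⟩ : ∃ v, m = i + 1 + v := ⟨m - (i + 1), by omega⟩
        have e1 : i + 1 - (q + 1 - 1) = u + 1 := by omega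
        have e2 : m - (q + 1) + 1 = u + v + 1 := by omega
        rw [e1, e2, hv, hu]
        nlinarith
      have h6 := Nat.mul_le_mul_right b h5
      calc m * (b * (i + 1 - (t - 1))) = m * (i + 1 - (t - 1)) * b := by ring
        _ ≤ _ := h6
        _ = (m - t + 1) * ((i + 1) * b) := by ring
        _ ≤ _ := h4
        _ = _ := by ring
  · refine ⟨0, fun b => ⟨0, by simp, ?_⟩⟩
    rw [Nat.sub_eq_zero_of_le (by omega)]; simp

lemma prod_bound (K : Type*) [Field K] {m t : ℕ} (ht : 0 < t) (htm : t ≤ m) :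
    ∃ C : ℕ, ∀ N r : ℕ, (m - t + 1) * t * r + C ≤ m * N → ∀ β : ℕ → ℕ,
      N ≤ ∑ i ∈ Finset.range m, β i * (i + 1 - (t - 1)) →
      ∏ i ∈ Finset.range m, lm K m (i + 1) ^ β i ∈ symMinors K m t ^ r := by
  have h0 : ∀ i, ∃ C : ℕ, i < m → ∀ b, ∃ ρ, lm K m (i + 1) ^ b ∈ symMinors K m t ^ ρ ∧
      m * (b * (i + 1 - (t - 1))) ≤ (m - t + 1) * t * ρ + C := by
    intro i
    by_cases hi : i < m
    · obtain ⟨C, hC⟩ := lm_pow_bound K ht htm i hi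
      exact ⟨C, fun _ => hC⟩
    · exact ⟨0, fun h => absurd h hi⟩
  choose C hC using h0
  refine ⟨∑ i ∈ Finset.range m, C i, fun N r hN β hβ => ?_⟩
  have h1 : ∀ i, ∃ ρ, i < m → lm K m (i + 1) ^ β i ∈ symMinors K m t ^ ρ ∧
      m * (β i * (i + 1 - (t - 1))) ≤ (m - t + 1) * t * ρ + C i := by
    intro i
    by_cases hi : i < m
    · obtain ⟨ρ, hρ⟩ := hC i hi (β i)
      exact ⟨ρ, fun _ => hρ⟩
    · exact ⟨0, fun h => absurd h hi⟩
  choose ρ hρ using h1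
  have h2 := Ideal.prod_mem_prod (s := Finset.range m) (I := fun i => symMinors K m t ^ ρ i)
    (x := fun i => lm K m (i + 1) ^ β i) (fun i hi => (hρ i (Finset.mem_range.1 hi)).1)
  rw [Finset.prod_pow_eq_pow_sum] at h2
  refine Ideal.pow_le_pow_right ?_ h2
  have h3 : m * N ≤ (m - t + 1) * t * ∑ i ∈ Finset.range m, ρ i + ∑ i ∈ Finset.range m, C i := by
    refine (Nat.mul_le_mul_left m hβ).trans ?_
    rw [Finset.mul_sum, Finset.mul_sum, ← Finset.sum_add_distrib]
    exact Finset.sum_le_sum fun i hi => (hρ i (Finset.mem_range.1 hi)).2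
  have h4 : (m - t + 1) * t * r ≤ (m - t + 1) * t * ∑ i ∈ Finset.range m, ρ i := by omega
  exact Nat.le_of_mul_le_mul_left h4 (by positivity)

lemma DD_le_pow_rat {m t : ℕ} (ht : 0 < t) (htm : t ≤ m) :
    ∃ C : ℕ, ∀ N r : ℕ, (m - t + 1) * t * r + C ≤ m * N →
      DD ℚ m (t - 1) N ≤ symMinors ℚ m t ^ r := by
  obtain ⟨C, hC⟩ := prod_bound ℚ ht htm
  refine ⟨C, fun N r h => thmX _ (fun i j => deriv_pow_ideal _ _ (ED_symMinors ℚ i j) r) (hC N r h)⟩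

lemma DD_one_rat {m t : ℕ} (ht : 0 < t) : DD ℚ m (t - 1) 1 ≤ symMinors ℚ m t := by
  refine thmX _ (fun i j => ED_symMinors ℚ i j) fun β hβ => ?_
  obtain ⟨i, hi, h⟩ : ∃ i ∈ Finset.range m, β i * (i + 1 - (t - 1)) ≠ 0 := by
    by_contra hcon
    push Not at hcon
    rw [Finset.sum_eq_zero hcon] at hβ
    omega
  rw [Nat.mul_ne_zero_iff] at h
  have hm : lm ℚ m (i + 1) ∈ symMinors ℚ m t :=
    symMinors_anti ℚ m (by omega : t ≤ i + 1) (lm_mem ℚ (Finset.mem_range.1 hi))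
  have : lm ℚ m (i + 1) ∣ ∏ i ∈ Finset.range m, lm ℚ m (i + 1) ^ β i :=
    (dvd_pow_self _ h.1).trans
      (Finset.dvd_prod_of_mem (fun i => lm ℚ m (i + 1) ^ β i) hi)
  exact Ideal.mem_of_dvd _ this hm

lemma X_pow_dvd_iff_coeff {σ R : Type*} [CommRing R] (i : σ) (N : ℕ) (g : MvPolynomial σ R) :
    X i ^ N ∣ g ↔ ∀ a : σ →₀ ℕ, a i < N → coeff a g = 0 := by
  classical
  have hle : ∀ a : σ →₀ ℕ, Finsupp.single i N ≤ a ↔ N ≤ a i := by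
    intro a; rw [Finsupp.single_le_iff]
  rw [X_pow_eq_monomial, monomial_one_dvd_iff_modMonomial_eq_zero]
  constructor
  · intro h a ha
    rw [← coeff_modMonomial_of_not_le (s := Finsupp.single i N) _ (by rw [hle]; omega), h, coeff_zero]
  · intro h
    ext a
    by_cases ha : Finsupp.single i N ≤ a
    · rw [coeff_modMonomial_of_le _ ha, coeff_zero]
    · rw [coeff_modMonomial_of_not_le _ ha, coeff_zero]
      exact h a (by rw [hle] at ha; omega)

lemma Phi_map (K : Type*) [Field K] [CharZero K] (m q : ℕ) (f : MvPolynomial (Sym2 (Fin m)) ℚ) :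
    Phi K m q (MvPolynomial.map (algebraMap ℚ K) f) = MvPolynomial.map (algebraMap ℚ K) (Phi ℚ m q f) := by
  induction f using MvPolynomial.induction_on with
  | C a => simp [Phi, algebraMap_eq]
  | add p q hp hq => simp only [map_add, hp, hq]
  | mul_X p e hp =>
    simp only [map_mul, hp, map_X]
    congr 1
    induction e using Sym2.ind with
    | _ a b => simp [Phi, PhiX_mk]

lemma DD_descent (K : Type*) [Field K] [CharZero K] (m q N : ℕ) :
    DD K m q N ≤ Ideal.map (MvPolynomial.map (algebraMap ℚ K)) (DD ℚ m q N) := by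
  classical
  intro f hf
  let e := Module.Basis.ofVectorSpace ℚ K
  let F : Module.Basis.ofVectorSpaceIndex ℚ K → MvPolynomial (Sym2 (Fin m)) ℚ :=
    fun b => ∑ a ∈ f.support, monomial a (e.repr (coeff a f) b)
  let s := f.support.biUnion (fun a => (e.repr (coeff a f)).support)
  have hFc : ∀ b a, coeff a (F b) = e.repr (coeff a f) b := by
    intro b a
    simp only [F, coeff_sum, coeff_monomial, Finset.sum_ite_eq', mem_support_iff]
    split_ifs with h
    · rfl
    · simp only [not_not] at h; rw [h]; simp
  have hfs : f = ∑ b ∈ s, C (e b) * MvPolynomial.map (algebraMap ℚ K) (F b) := by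
    ext a
    simp only [coeff_sum, coeff_C_mul, coeff_map, hFc]
    by_cases ha : a ∈ f.support
    · conv_lhs => rw [← e.linearCombination_repr (coeff a f), Finsupp.linearCombination_apply]
      rw [Finsupp.sum_of_support_subset (s := s)]
      · apply Finset.sum_congr rfl
        intro b _
        rw [Algebra.smul_def, mul_comm]
      · exact Finset.subset_biUnion_of_mem (fun a => (e.repr (coeff a f)).support) ha
      · simp
    · rw [notMem_support_iff.1 ha]; simp
  rw [hfs]
  refine Submodule.sum_mem _ fun b hb => Ideal.mul_mem_left _ _ (Ideal.mem_map_of_mem _ ?_)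
  rw [mem_DD, X_pow_dvd_iff_coeff] at hf ⊢
  intro a ha
  have h1 := hf a ha
  rw [hfs, map_sum, coeff_sum] at h1
  have h2 : ∑ b ∈ s, (coeff a (Phi ℚ m q (F b))) • e b = 0 := by
    rw [← h1]
    apply Finset.sum_congr rfl
    intro b _
    have : Phi K m q (C (e b)) = C (e b) := by simp [Phi, algebraMap_eq]
    rw [map_mul, this, coeff_C_mul, Phi_map, coeff_map, Algebra.smul_def, mul_comm]
  exact linearIndependent_iff'.1 e.linearIndependent s _ h2 b hb

lemma map_symMinors (K : Type*) [Field K] [CharZero K] (m t : ℕ) :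
    Ideal.map (MvPolynomial.map (algebraMap ℚ K)) (symMinors ℚ m t) ≤ symMinors K m t := by
  rw [symMinors, Ideal.map_span, Ideal.span_le]
  rintro _ ⟨_, ⟨r, c, -, -, rfl⟩, rfl⟩
  have h : (MvPolynomial.map (algebraMap ℚ K)).mapMatrix
      (Matrix.of fun i j => (X s(r i, c j) : MvPolynomial (Sym2 (Fin m)) ℚ)) =
      Matrix.of fun i j => X s(r i, c j) := by
    ext a b
    simp
  rw [RingHom.map_det, h]
  exact mnr_mem K r c

lemma DD_le_pow (K : Type*) [Field K] [CharZero K] {m t : ℕ} (ht : 0 < t) (htm : t ≤ m) :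
    ∃ C : ℕ, ∀ N r : ℕ, (m - t + 1) * t * r + C ≤ m * N →
      DD K m (t - 1) N ≤ symMinors K m t ^ r := by
  obtain ⟨C, hC⟩ := DD_le_pow_rat ht htm
  refine ⟨C, fun N r h => ?_⟩
  refine (DD_descent K m (t - 1) N).trans ((Ideal.map_mono (hC N r h)).trans ?_)
  rw [Ideal.map_pow]
  exact Ideal.pow_right_mono (map_symMinors K m t) r

lemma DD_one_le (K : Type*) [Field K] [CharZero K] {m t : ℕ} (ht : 0 < t) :
    DD K m (t - 1) 1 ≤ symMinors K m t :=
  (DD_descent K m (t - 1) 1).trans ((Ideal.map_mono (DD_one_rat ht)).trans (map_symMinors K m t))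

lemma minors_le_DD (K : Type*) [Field K] (m q : ℕ) : symMinors K m (q + 1) ≤ DD K m q 1 := by
  rw [symMinors, Ideal.span_le]
  rintro d ⟨r, c, -, -, rfl⟩
  change mnr K r c ∈ DD K m q 1
  rw [DD, Ideal.mem_comap, Phi, eval_mnr, ← Ideal.Quotient.eq_zero_iff_mem, RingHom.map_det]
  set π := Ideal.Quotient.mk (Ideal.span {(X none : MvPolynomial (VV m q) K) ^ 1}) with hπ
  have hε : π (X none) = 0 := by
    rw [hπ, Ideal.Quotient.eq_zero_iff_mem]
    exact Ideal.mem_span_singleton.2 (by simp)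
  let A : (Fin (q + 1) → Fin m) → Matrix (Fin (q + 1)) (Fin (q + 1)) _ := fun r =>
    Matrix.of fun a p => Fin.lastCases (motive := fun _ => (MvPolynomial (VV m q) K ⧸
      Ideal.span {(X none : MvPolynomial (VV m q) K) ^ 1})) 0
      (fun p : Fin q => π (X (some (.inl (r a, p))))) p
  have h1 : π.mapMatrix (Matrix.of fun a b => PhiX K m q s(r a, c b)) = A r * (A c).transpose := by
    ext a b
    simp [Matrix.mul_apply, Fin.sum_univ_castSucc, A, PhiX_mk, hε]
  rw [h1, Matrix.det_mul, Matrix.det_eq_zero_of_column_eq_zero (Fin.last q), zero_mul]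
  intro a
  simp [A]

lemma DD_prime (K : Type*) [Field K] (m q : ℕ) : (DD K m q 1).IsPrime := by
  have h : Prime (X none : MvPolynomial (VV m q) K) := X_prime
  have h2 : (Ideal.span {(X none : MvPolynomial (VV m q) K) ^ 1}).IsPrime := by
    rw [pow_one]
    exact (Ideal.span_singleton_prime h.ne_zero).2 h
  exact Ideal.IsPrime.comap _

lemma minors_eq_DD (K : Type*) [Field K] [CharZero K] (m q : ℕ) :
    symMinors K m (q + 1) = DD K m q 1 :=
  le_antisymm (minors_le_DD K m q) (DD_one_le K (t := q + 1) (Nat.succ_pos q))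

lemma mem_symb_iff {R : Type*} [CommRing R] (I : Ideal R) (hI : I.IsPrime) (s : ℕ) (f : R) :
    f ∈ symbolicPower I s ↔ ∃ u, u ∉ I ∧ u * f ∈ I ^ s := by
  constructor
  · intro h
    rw [symbolicPower, Ideal.mem_iInf] at h
    have h1 := h ⟨I, hI, Ideal.Quotient.mk I 1, by
      ext r
      rw [Submodule.mem_annihilator_span_singleton]
      change _ ↔ Ideal.Quotient.mk I (r * 1) = 0
      rw [Ideal.Quotient.eq_zero_iff_mem, mul_one]⟩
    rw [Ideal.mem_comap, IsLocalization.mem_map_algebraMap_iff I.primeCompl] at h1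
    obtain ⟨⟨x, y⟩, hxy⟩ := h1
    rw [← map_mul] at hxy
    obtain ⟨z, hz⟩ := (IsLocalization.eq_iff_exists I.primeCompl _).1 hxy
    refine ⟨z * y, (z * y).2, ?_⟩
    have : (z : R) * y * f = z * (f * y) := by ring
    rw [this, hz]
    exact Ideal.mul_mem_left _ _ x.2
  · rintro ⟨u, hu, huf⟩
    rw [symbolicPower, Ideal.mem_iInf]
    rintro ⟨p, hp, x, hx⟩
    obtain ⟨y, rfl⟩ := Ideal.Quotient.mk_surjective x
    have hmem : ∀ r, r ∈ p ↔ r * y ∈ I := by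
      intro r
      rw [hx, Submodule.mem_annihilator_span_singleton]
      change Ideal.Quotient.mk I (r * y) = 0 ↔ _
      rw [Ideal.Quotient.eq_zero_iff_mem]
    have hy : y ∉ I := by
      intro hy
      apply hp.ne_top
      rw [Ideal.eq_top_iff_one, hmem, one_mul]; exact hy
    have hup : u ∉ p := by
      rw [hmem]
      intro h
      exact (hI.mem_or_mem h).elim hu hy
    change algebraMap R (Localization.AtPrime p) f ∈
      Ideal.map (algebraMap R (Localization.AtPrime p)) (I ^ s)
    have hunit : IsUnit (algebraMap R (Localization.AtPrime p) u) :=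
      IsLocalization.map_units (M := p.primeCompl) _ ⟨u, hup⟩
    have h2 := Ideal.mem_map_of_mem (algebraMap R (Localization.AtPrime p)) huf
    rw [map_mul] at h2
    exact (Ideal.unit_mul_mem_iff_mem _ hunit).1 h2

lemma symb_anti {R : Type*} [CommRing R] (I : Ideal R) (hI : I.IsPrime) {s s' : ℕ} (h : s ≤ s') :
    symbolicPower I s' ≤ symbolicPower I s := by
  intro f hf
  rw [mem_symb_iff I hI] at hf ⊢
  obtain ⟨u, hu, h1⟩ := hf
  exact ⟨u, hu, Ideal.pow_le_pow_right h h1⟩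

lemma minors_pow_le_DD (K : Type*) [Field K] (m q N : ℕ) : symMinors K m (q + 1) ^ N ≤ DD K m q N := by
  refine (Ideal.pow_right_mono (minors_le_DD K m q) N).trans ?_
  rw [DD, DD, ← Ideal.map_le_iff_le_comap, Ideal.map_pow]
  refine (Ideal.pow_right_mono Ideal.map_comap_le N).trans ?_
  rw [Ideal.span_singleton_pow, pow_one]

/-- F1 -/
lemma symb_le_DD (K : Type*) [Field K] [CharZero K] (m q N : ℕ) :
    symbolicPower (symMinors K m (q + 1)) N ≤ DD K m q N := by
  have hp := minors_eq_DD K m q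
  intro f hf
  rw [mem_symb_iff _ (hp ▸ DD_prime K m q)] at hf
  obtain ⟨u, hu, h⟩ := hf
  have h1 := minors_pow_le_DD K m q N h
  rw [hp, mem_DD, pow_one] at hu
  rw [mem_DD, map_mul] at h1
  rw [mem_DD]
  have h : Prime (X none : MvPolynomial (VV m q) K) := X_prime
  exact h.pow_dvd_of_dvd_mul_left N hu h1

lemma schur {R n l : Type*} [CommRing R] [Fintype n] [DecidableEq n] [Fintype l] [DecidableEq l]
    (A : Matrix n n R) (B : Matrix n l R) (C : Matrix l n R) (D : Matrix l l R) :
    A.det ^ Fintype.card l * (Matrix.fromBlocks A B C D).det =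
      A.det * (A.det • D - C * A.adjugate * B).det := by
  have h : Matrix.fromBlocks 1 0 (-(C * A.adjugate)) (A.det • (1 : Matrix l l R)) *
      Matrix.fromBlocks A B C D = Matrix.fromBlocks A B 0 (A.det • D - C * A.adjugate * B) := by
    rw [Matrix.fromBlocks_multiply]
    congr 1
    · simp
    · simp
    · rw [Matrix.neg_mul, Matrix.mul_assoc, Matrix.adjugate_mul]
      simp
    · rw [Matrix.neg_mul]
      simp
      abel
  have h2 := congrArg Matrix.det h
  rw [Matrix.det_mul, Matrix.det_fromBlocks_zero₁₂, Matrix.det_fromBlocks_zero₂₁, Matrix.det_one,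
    one_mul, Matrix.det_smul, Matrix.det_one, mul_one] at h2
  exact h2

lemma det_gen_mem (K : Type*) [Field K] {m t : ℕ} {n : Type*} [Fintype n] [DecidableEq n]
    (hn : Fintype.card n = t) (r c : n → Fin m) :
    (Matrix.of fun a b => (X s(r a, c b) : MvPolynomial (Sym2 (Fin m)) K)).det ∈ symMinors K m t := by
  have e := Fintype.equivFinOfCardEq hn
  rw [← Matrix.det_submatrix_equiv_self e.symm]
  exact mnr_mem K (fun a => r (e.symm a)) (fun a => c (e.symm a))

lemma lm_notMem (K : Type*) [Field K] {m q : ℕ} (hq : q ≤ m) : lm K m q ∉ DD K m q 1 := by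
  rw [mem_DD]
  intro h
  have h1 := map_dvd (psi K m q) h
  rw [psi_Phi, lm_td K hq, Nat.sub_self, pow_zero, pow_one] at h1
  have h3 : psi K m q (X none) = Polynomial.X := by simp [psi]
  rw [h3] at h1
  exact Polynomial.not_isUnit_X (isUnit_of_dvd_one h1)

lemma lm_schur_mem (K : Type*) [Field K] {m q l : ℕ} (h : q + l = m) :
    lm K m q ^ l * lm K m m ∈ symMinors K m (q + 1) ^ l := by
  let e : Fin q ⊕ Fin l ≃ Fin m := finSumFinEquiv.trans (finCongr h)
  have hel : ∀ a : Fin q, e (.inl a) = Fin.castLE (by omega) a := by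
    intro a; ext; simp [e]
  let M : Matrix (Fin q ⊕ Fin l) (Fin q ⊕ Fin l) (MvPolynomial (Sym2 (Fin m)) K) :=
    Matrix.of fun a b => X s(e a, e b)
  have hM : M.det = lm K m m := by
    rw [lm_eq K le_rfl, mnr, ← Matrix.det_submatrix_equiv_self e]
    rfl
  have hA : M.toBlocks₁₁.det = lm K m q := by
    rw [lm_eq K (by omega : q ≤ m), mnr]
    congr 1
  have h0 : lm K m q ≠ 0 := lm_ne_zero K (by omega)
  have h1 := schur M.toBlocks₁₁ M.toBlocks₁₂ M.toBlocks₂₁ M.toBlocks₂₂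
  rw [Matrix.fromBlocks_toBlocks, hM, hA, Fintype.card_fin] at h1
  rw [h1]
  apply Ideal.mul_mem_left
  have h2 := det_mem_pow (symMinors K m (q + 1))
    (lm K m q • M.toBlocks₂₂ - M.toBlocks₂₁ * M.toBlocks₁₁.adjugate * M.toBlocks₁₂) (by
      intro i j
      let B : Matrix (Fin q) Unit (MvPolynomial (Sym2 (Fin m)) K) := Matrix.of fun a _ => M.toBlocks₁₂ a j
      let C : Matrix Unit (Fin q) (MvPolynomial (Sym2 (Fin m)) K) := Matrix.of fun _ a => M.toBlocks₂₁ i a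
      let D : Matrix Unit Unit (MvPolynomial (Sym2 (Fin m)) K) := Matrix.of fun _ _ => M.toBlocks₂₂ i j
      have h3 := schur M.toBlocks₁₁ B C D
      rw [hA, Fintype.card_unit, pow_one] at h3
      have h4 := mul_left_cancel₀ h0 h3
      have h5 : (lm K m q • D - C * M.toBlocks₁₁.adjugate * B).det =
          (lm K m q • M.toBlocks₂₂ - M.toBlocks₂₁ * M.toBlocks₁₁.adjugate * M.toBlocks₁₂) i j := by
        rw [Matrix.det_unique]
        simp [Matrix.mul_apply, B, C, D]
      rw [← h5, ← h4]
      have h6 : Matrix.fromBlocks M.toBlocks₁₁ B C D = Matrix.of fun a b =>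
          X s(Sum.elim (fun a => e (.inl a)) (fun _ : Unit => e (.inr i)) a,
            Sum.elim (fun a => e (.inl a)) (fun _ : Unit => e (.inr j)) b) := by
        ext a b
        rcases a with a | a <;> rcases b with b | b <;> rfl
      rw [h6]
      exact det_gen_mem K (n := Fin q ⊕ Unit) (t := q + 1) (by simp) _ _)
  rwa [Fintype.card_fin] at h2

lemma lm_pow_symb (K : Type*) [Field K] [CharZero K] {m q l : ℕ} (h : q + l = m) (a : ℕ) :
    lm K m m ^ a ∈ symbolicPower (symMinors K m (q + 1)) (a * l) := by
  have hp := minors_eq_DD K m q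
  have hpr : (symMinors K m (q + 1)).IsPrime := hp ▸ DD_prime K m q
  rw [mem_symb_iff _ hpr]
  refine ⟨(lm K m q ^ l) ^ a, ?_, ?_⟩
  · intro hh
    have := hpr.mem_of_pow_mem _ (hpr.mem_of_pow_mem _ hh)
    rw [hp] at this
    exact lm_notMem K (by omega) this
  · rw [← mul_pow, mul_comm a l, pow_mul]
    exact Ideal.pow_mem_pow (lm_schur_mem K h) a

lemma minors_le_vars (K : Type*) [Field K] (m t : ℕ) :
    symMinors K m t ≤ idealOfVars (Sym2 (Fin m)) K ^ t := by
  rw [symMinors, Ideal.span_le]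
  rintro d ⟨r, c, -, -, rfl⟩
  have := det_mem_pow (idealOfVars (Sym2 (Fin m)) K)
    (Matrix.of fun a b => (X s(r a, c b) : MvPolynomial (Sym2 (Fin m)) K))
    (fun a b => Ideal.subset_span ⟨_, rfl⟩)
  rwa [Fintype.card_fin] at this

lemma degree_bound (K : Type*) [Field K] {m t r d : ℕ} {f : MvPolynomial (Sym2 (Fin m)) K}
    (hf : f ∈ symMinors K m t ^ r) (h0 : f ≠ 0) (hd : f.IsHomogeneous d) : t * r ≤ d := by
  have h1 := Ideal.pow_right_mono (minors_le_vars K m t) r hf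
  rw [← pow_mul, mem_pow_idealOfVars_iff] at h1
  obtain ⟨a, ha⟩ := support_nonempty.2 h0
  have h2 := h1 a ha
  have h3 := hd (mem_support_iff.1 ha)
  have h4 : Finsupp.degree a = Finsupp.weight 1 a :=
    DFunLike.congr_fun (Finsupp.degree_eq_weight_one (R := ℕ)) a
  rwa [h4, h3] at h2

lemma lm_homog (K : Type*) [Field K] {m k : ℕ} (hk : k ≤ m) : (lm K m k).IsHomogeneous k := by
  rw [lm_eq K hk, mnr, Matrix.det_apply]
  apply IsHomogeneous.sum
  intro σ _
  have h : (∏ i, Matrix.of (fun a b => (X s(Fin.castLE hk a, Fin.castLE hk b) :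
      MvPolynomial (Sym2 (Fin m)) K)) (σ i) i).IsHomogeneous k := by
    have := IsHomogeneous.prod (Finset.univ : Finset (Fin k)) (fun i =>
      (X s(Fin.castLE hk (σ i), Fin.castLE hk i) : MvPolynomial (Sym2 (Fin m)) K)) (fun _ => 1)
      (fun i _ => isHomogeneous_X _ _)
    simpa using this
  rcases Int.units_eq_one_or (Equiv.Perm.sign σ) with h' | h'
  · rw [h', one_smul]; exact h
  · rw [h', Units.neg_smul, one_smul]; exact h.neg

lemma alphaDeg_le {σ K : Type*} [CommSemiring K] {I : Ideal (MvPolynomial σ K)} {d : ℕ}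
    {f : MvPolynomial σ K} (hf : f ∈ I) (h0 : f ≠ 0) (hd : f.IsHomogeneous d) : alphaDeg I ≤ d :=
  Nat.sInf_le ⟨f, hf, h0, hd⟩

lemma alphaDeg_spec {σ K : Type*} [CommSemiring K] {I : Ideal (MvPolynomial σ K)} {d : ℕ}
    {f : MvPolynomial σ K} (hf : f ∈ I) (h0 : f ≠ 0) (hd : f.IsHomogeneous d) :
    ∃ g ∈ I, g ≠ 0 ∧ g.IsHomogeneous (alphaDeg I) :=
  Nat.sInf_mem (s := {d | ∃ f ∈ I, f ≠ 0 ∧ MvPolynomial.IsHomogeneous f d}) ⟨d, f, hf, h0, hd⟩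

lemma alphaDeg_minors (K : Type*) [Field K] {m t : ℕ} (htm : t ≤ m) :
    alphaDeg (symMinors K m t) = t := by
  apply le_antisymm
  · exact alphaDeg_le (lm_mem K htm) (lm_ne_zero K htm) (lm_homog K htm)
  · obtain ⟨g, hg, h0, hd⟩ := alphaDeg_spec (lm_mem K htm) (lm_ne_zero K htm) (lm_homog K htm)
    have := degree_bound K (r := 1) (by rwa [pow_one]) h0 hd
    omega

lemma lm_symb' (K : Type*) [Field K] [CharZero K] {m q l : ℕ} (h : q + l = m) (hl : 0 < l) (s : ℕ) :
    lm K m m ^ (s / l + 1) ∈ symbolicPower (symMinors K m (q + 1)) s := by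
  have hpr : (symMinors K m (q + 1)).IsPrime := minors_eq_DD K m q ▸ DD_prime K m q
  apply symb_anti _ hpr _ (lm_pow_symb K h _)
  have := Nat.lt_mul_div_succ s hl
  rw [mul_comm]; exact this.le

theorem symmetric_determinantal_asymp_resurgence {K : Type*} [Field K] [CharZero K]
    (m t : ℕ) (ht1 : 1 ≤ t) (htm : t ≤ m) :
    asympResurgence (symMinors K m t) = (t * (m - t + 1) : ℕ) / (m : ℝ) ∧
    ∃ W : ℝ, Tendsto (fun s : ℕ =>
        (alphaDeg (symbolicPower (symMinors K m t) s) : ℝ) / s) atTop (nhds W) ∧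
      (alphaDeg (symMinors K m t) : ℝ) / W = (t * (m - t + 1) : ℕ) / (m : ℝ) := by
  obtain ⟨q, rfl⟩ : ∃ q, t = q + 1 := ⟨t - 1, by omega⟩
  obtain ⟨C, hC⟩ := DD_le_pow K ht1 htm
  rw [Nat.add_sub_cancel] at hC
  generalize hl : m - (q + 1) + 1 = l at hC ⊢
  have hl0 : 0 < l := by omega
  have hm0 : 0 < m := by omega
  have hql : q + l = m := by omega
  generalize ht : q + 1 = t at hC ht1 htm ⊢
  have ht0 : 0 < t := ht1
  have F1 : ∀ N r : ℕ, l * t * r + C ≤ m * N → symbolicPower (symMinors K m t) N ≤ symMinors K m t ^ r := by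
    intro N r h
    refine le_trans ?_ (hC N r h)
    rw [← ht]; exact symb_le_DD K m q N
  have F2 : ∀ s, lm K m m ^ (s / l + 1) ∈ symbolicPower (symMinors K m t) s := by
    rw [← ht]; exact lm_symb' K hql hl0
  have F2n : ∀ k, lm K m m ^ k ≠ 0 := fun k => pow_ne_zero _ (lm_ne_zero K le_rfl)
  have F2h : ∀ k, (lm K m m ^ k).IsHomogeneous (m * k) := fun k => (lm_homog K le_rfl).pow k
  have hmR : (0 : ℝ) < m := by exact_mod_cast hm0
  have hlR : (0 : ℝ) < l := by exact_mod_cast hl0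
  have htR : (0 : ℝ) < t := by exact_mod_cast ht0
  constructor
  · have low : ∀ w : ℝ, w < ((t * l : ℕ) : ℝ) / m → ∃ a ∈ {x : ℝ | ∃ s r : ℕ, 0 < s ∧ 0 < r ∧
        x = (s : ℝ) / r ∧ ∀ᶠ T in atTop,
          ¬ symbolicPower (symMinors K m t) (s * T) ≤ symMinors K m t ^ (r * T)}, w < a := by
      intro w hw
      have hb : (0 : ℝ) < ((t * l : ℕ) : ℝ) / m := by
        push_cast; positivity
      obtain ⟨x, hx1, hx2⟩ := exists_rat_btwn (max_lt hw hb)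
      have hx0 : 0 < x := by
        have : (0 : ℝ) < x := lt_of_le_of_lt (le_max_right _ _) hx1
        exact_mod_cast this
      have hnum : 0 < x.num := Rat.num_pos.2 hx0
      obtain ⟨s, hs⟩ := Int.eq_ofNat_of_zero_le hnum.le
      have hs0 : 0 < s := by omega
      have hxe : (x : ℝ) = (s : ℝ) / x.den := by
        conv_lhs => rw [← Rat.num_div_den x]
        rw [hs]; push_cast; rfl
      refine ⟨x, ⟨s, x.den, hs0, x.den_pos, hxe, ?_⟩, lt_of_le_of_lt (le_max_left _ _) hx1⟩
      have hdR : (0 : ℝ) < x.den := by exact_mod_cast x.den_pos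
      rw [hxe, div_lt_div_iff₀ hdR hmR] at hx2
      have hlt : s * m < t * l * x.den := by exact_mod_cast hx2
      generalize x.den = r at hlt
      filter_upwards [eventually_gt_atTop (m * l)] with T hT hle
      have h1 := degree_bound K (hle (F2 (s * T))) (F2n _) (F2h _)
      have h2 := Nat.mul_div_le (s * T) l
      set k := s * T / l
      have h3 : l * (t * (r * T)) ≤ l * (m * (k + 1)) := Nat.mul_le_mul_left l h1
      have h4 : (s * m + 1) * T ≤ t * l * r * T := Nat.mul_le_mul_right T hlt
      have h5 : m * (l * k) ≤ m * (s * T) := Nat.mul_le_mul_left m h2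
      nlinarith
    unfold asympResurgence
    apply csSup_eq_of_forall_le_of_forall_lt_exists_gt
    · obtain ⟨a, ha, -⟩ := low _ (sub_one_lt _)
      exact ⟨a, ha⟩
    · rintro x ⟨s, r, hs, hr, rfl, hev⟩
      by_contra hcon
      push Not at hcon
      have hrR : (0 : ℝ) < r := by exact_mod_cast hr
      rw [div_lt_div_iff₀ hmR hrR] at hcon
      have hlt : t * l * r < s * m := by exact_mod_cast hcon
      obtain ⟨T, hT1, hT2⟩ := (hev.and (eventually_ge_atTop C)).exists
      apply hT1
      apply F1
      have h4 : (t * l * r + 1) * T ≤ s * m * T := Nat.mul_le_mul_right T hlt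
      nlinarith
    · exact low
  · refine ⟨(m : ℝ) / l, ?_, ?_⟩
    · have up : ∀ s, l * alphaDeg (symbolicPower (symMinors K m t) s) ≤ m * s + m * l := by
        intro s
        have h1 := alphaDeg_le (F2 s) (F2n _) (F2h _)
        have h2 := Nat.mul_div_le s l
        set k := s / l
        have h3 := Nat.mul_le_mul_left l h1
        have h5 : m * (l * k) ≤ m * s := Nat.mul_le_mul_left m h2
        nlinarith
      have lo : ∀ s, m * s ≤ l * alphaDeg (symbolicPower (symMinors K m t) s) + (C + l * t) := by
        intro s
        obtain ⟨g, hg, h0, hd⟩ := alphaDeg_spec (F2 s) (F2n _) (F2h _)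
        by_cases hc : C ≤ m * s
        · have h1 := Nat.mul_div_le (m * s - C) (l * t)
          have h2 := Nat.lt_mul_div_succ (m * s - C) (by positivity : 0 < l * t)
          set r := (m * s - C) / (l * t)
          have h3 := degree_bound K (F1 s r (by omega) hg) h0 hd
          have h4 := Nat.mul_le_mul_left l h3
          rw [Nat.mul_add, mul_one] at h2
          rw [← mul_assoc] at h4
          omega
        · omega
      have habs : ∀ s : ℕ, 0 < s → |(alphaDeg (symbolicPower (symMinors K m t) s) : ℝ) / s - (m : ℝ) / l|
          ≤ ((m * l + C + l * t : ℕ) : ℝ) / s := by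
        intro s hs
        have hsR : (0 : ℝ) < s := by exact_mod_cast hs
        have hl1 : (1 : ℝ) ≤ l := by exact_mod_cast hl0
        have h1 : (l : ℝ) * alphaDeg (symbolicPower (symMinors K m t) s) ≤ m * s + m * l := by
          exact_mod_cast up s
        have h2 : (m : ℝ) * s ≤ l * alphaDeg (symbolicPower (symMinors K m t) s) + (C + l * t) := by
          exact_mod_cast lo s
        generalize (alphaDeg (symbolicPower (symMinors K m t) s) : ℝ) = a at h1 h2 ⊢
        have e : a / s - (m : ℝ) / l = (l * a - m * s) / l / s := by field_simp
        rw [e, abs_div, abs_of_pos hsR]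
        gcongr
        rw [abs_div, abs_of_pos hlR]
        refine (div_le_self (abs_nonneg _) hl1).trans ?_
        have hCR : (0 : ℝ) ≤ C := Nat.cast_nonneg C
        have p1 : (0 : ℝ) < m * l := by positivity
        have p2 : (0 : ℝ) < l * t := by positivity
        push_cast
        rw [abs_le]
        constructor <;> linarith
      rw [tendsto_iff_dist_tendsto_zero]
      refine squeeze_zero' (Eventually.of_forall fun _ => dist_nonneg) ?_
        (tendsto_const_div_atTop_nhds_zero_nat ((m * l + C + l * t : ℕ) : ℝ))
      filter_upwards [eventually_gt_atTop 0] with s hs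
      rw [Real.dist_eq]
      exact habs s hs
    · rw [alphaDeg_minors K htm]
      push_cast
      field_simp
end
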